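/- For every constant c > 0 the following holds for all sufficiently large odd integers N: with D = \sqrt{N} L^{-c} and r_2(m) = \sum_{d | m, D < d < N/D} χ(d), one has \sum_{p_1+p_2+p_3=N} r_2(p_1-1) r_2(p_2-1) (\log p_1)(\log p_2)(\log p_3) \ll N^2 L^{-2\theta_0} (\log L)^{13}, the sum being over ordered triples of primes, θ_0 = 1/2 - (1/4) e log 2, and the implied constant depending only on c. -/

import Mathlib

open Finset

noncomputable section

/-- The non-principal Dirichlet character modulo 4. -/
def chi4 (n : ℕ) : ℝ := if n % 4 = 1 then 1 else if n % 4 = 3 then -1 else 0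

/-- θ₀ = 1/2 - (1/4) e log 2. -/
def theta0 : ℝ := 1 / 2 - (1 / 4) * Real.exp 1 * Real.log 2

/-- Weighted sum over ordered triples of primes with p₁ + p₂ + p₃ = N. -/
def tripleSum (N : ℕ) (w1 w2 : ℕ → ℝ) : ℝ :=
  ∑ p1 ∈ Finset.range (N + 1), ∑ p2 ∈ Finset.range (N + 1), ∑ p3 ∈ Finset.range (N + 1),
    if p1.Prime ∧ p2.Prime ∧ p3.Prime ∧ p1 + p2 + p3 = N then
      w1 p1 * w2 p2 * Real.log p1 * Real.log p2 * Real.log p3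
    else 0

/-- r₁(m) = ∑_{d ∣ m, d ≤ D} χ(d). -/
def r1 (D : ℝ) (m : ℕ) : ℝ := ∑ d ∈ m.divisors, if (d : ℝ) ≤ D then chi4 d else 0

/-- r₂(m) = ∑_{d ∣ m, D < d < N/D} χ(d). -/
def r2 (D NR : ℝ) (m : ℕ) : ℝ :=
  ∑ d ∈ m.divisors, if D < (d : ℝ) ∧ (d : ℝ) < NR / D then chi4 d else 0

/-- r₃(m) = ∑_{d ∣ m, d ≥ N/D} χ(d). -/
def r3 (D NR : ℝ) (m : ℕ) : ℝ :=
  ∑ d ∈ m.divisors, if NR / D ≤ (d : ℝ) then chi4 d else 0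

/-- The number of elements of a residue class in an interval. -/
theorem abs_card_modEq_sub_le {u v r : ℕ} (hr : 0 < r) (huv : u ≤ v) (c : ℕ) :
    |(#{x ∈ Ioc u v | x ≡ c [MOD r]} : ℝ) - ((v : ℝ) - u) / r| ≤ 1 := by
  have h := Nat.Ioc_filter_modEq_card u v hr c
  set A : ℚ := ((v : ℚ) - c) / r
  set B : ℚ := ((u : ℚ) - c) / r
  have hr' : (0 : ℚ) < r := by exact_mod_cast hr
  have hAB : B ≤ A := by
    have : (u : ℚ) ≤ v := by exact_mod_cast huv
    simp only [A, B]; gcongr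
  have h2 : (⌊B⌋ : ℤ) ≤ ⌊A⌋ := Int.floor_le_floor hAB
  rw [max_eq_left (by omega)] at h
  have h3 : (#{x ∈ Ioc u v | x ≡ c [MOD r]} : ℚ) = ⌊A⌋ - ⌊B⌋ := by exact_mod_cast h
  have h4 : |(#{x ∈ Ioc u v | x ≡ c [MOD r]} : ℚ) - ((v : ℚ) - u) / r| ≤ 1 := by
    have e : ((v : ℚ) - u) / r = A - B := by simp only [A, B]; ring
    rw [h3, e, abs_le]
    have := Int.floor_le A
    have := Int.floor_le B
    have := Int.lt_floor_add_one A
    have := Int.lt_floor_add_one B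
    constructor <;> linarith
  have h5 := (Rat.cast_le (K := ℝ)).2 h4
  push_cast at h5
  exact h5

set_option maxHeartbeats 800000 in
theorem abs_card_residues_sub_le (T : Finset ℕ) (hT : ∀ q ∈ T, q.Prime) (Ω : ℕ → Finset ℕ)
    (hΩ : ∀ q ∈ T, Ω q ⊆ range q) {u v : ℕ} (huv : u ≤ v) :
    ∀ d : ℕ, 0 < d → (∀ q ∈ T, d.Coprime q) → ∀ c : ℕ,
    |(#{x ∈ Ioc u v | x ≡ c [MOD d] ∧ ∀ q ∈ T, x % q ∈ Ω q} : ℝ)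
      - ((v : ℝ) - u) / d * ∏ q ∈ T, ((#(Ω q) : ℝ) / q)| ≤ ∏ q ∈ T, (#(Ω q) : ℝ) := by
  induction T using Finset.induction_on with
  | empty =>
    intro d hd _ c
    simpa using abs_card_modEq_sub_le hd huv c
  | insert q T hq ih =>
    intro d hd hcop c
    have hqp : q.Prime := hT q (mem_insert_self _ _)
    have ih' := ih (fun p hp => hT p (mem_insert_of_mem hp))
      (fun p hp => hΩ p (mem_insert_of_mem hp))
    have hdq : d.Coprime q := hcop q (mem_insert_self _ _)
    set X : ℕ → ℕ := fun ρ => (Nat.chineseRemainder hdq c ρ : ℕ)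
    have hX : ∀ ρ x : ℕ, x ≡ X ρ [MOD d * q] ↔ x ≡ c [MOD d] ∧ x ≡ ρ [MOD q] := by
      intro ρ x
      have h1 := (Nat.chineseRemainder hdq c ρ).2
      rw [← Nat.modEq_and_modEq_iff_modEq_mul hdq]
      constructor
      · rintro ⟨a, b⟩
        exact ⟨a.trans h1.1, b.trans h1.2⟩
      · rintro ⟨a, b⟩
        exact ⟨a.trans h1.1.symm, b.trans h1.2.symm⟩
    have hset : {x ∈ Ioc u v | x ≡ c [MOD d] ∧ ∀ p ∈ insert q T, x % p ∈ Ω p}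
        = (Ω q).biUnion fun ρ =>
          {x ∈ Ioc u v | x ≡ X ρ [MOD d * q] ∧ ∀ p ∈ T, x % p ∈ Ω p} := by
      ext x
      simp only [mem_filter, mem_biUnion, mem_insert, forall_eq_or_imp, hX]
      constructor
      · rintro ⟨h1, h2, h3, h4⟩
        exact ⟨x % q, h3, h1, ⟨h2, (Nat.mod_modEq x q).symm⟩, h4⟩
      · rintro ⟨ρ, hρ, h1, ⟨h2, h3⟩, h4⟩
        refine ⟨h1, h2, ?_, h4⟩
        have : x % q = ρ := by
          rw [h3]; exact Nat.mod_eq_of_lt (mem_range.1 (hΩ q (mem_insert_self _ _) hρ))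
        rwa [this]
    have hcard : (#{x ∈ Ioc u v | x ≡ c [MOD d] ∧ ∀ p ∈ insert q T, x % p ∈ Ω p} : ℝ)
        = ∑ ρ ∈ Ω q, (#{x ∈ Ioc u v | x ≡ X ρ [MOD d * q] ∧ ∀ p ∈ T, x % p ∈ Ω p} : ℝ) := by
      rw [hset, card_biUnion]
      · push_cast; rfl
      · intro a ha b hb hab
        refine disjoint_left.2 fun x hx hx' => hab ?_
        simp only [mem_filter, hX] at hx hx'
        have h1 := hx.2.1.2.symm.trans hx'.2.1.2
        have h2 := mem_range.1 (hΩ q (mem_insert_self _ _) ha)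
        have h3 := mem_range.1 (hΩ q (mem_insert_self _ _) hb)
        exact Nat.ModEq.eq_of_lt_of_lt h1 h2 h3
    have hbound : ∀ ρ ∈ Ω q,
        |(#{x ∈ Ioc u v | x ≡ X ρ [MOD d * q] ∧ ∀ p ∈ T, x % p ∈ Ω p} : ℝ)
          - ((v : ℝ) - u) / (d * q : ℕ) * ∏ q ∈ T, ((#(Ω q) : ℝ) / q)|
          ≤ ∏ q ∈ T, (#(Ω q) : ℝ) := by
      intro ρ _
      refine ih' (d * q) (Nat.mul_pos hd hqp.pos) (fun p hp => ?_) (X ρ)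
      refine Nat.Coprime.mul_left (hcop p (mem_insert_of_mem hp)) ?_
      rw [Nat.coprime_primes hqp (hT p (mem_insert_of_mem hp))]
      rintro rfl; exact hq hp
    rw [prod_insert hq, prod_insert hq, hcard]
    have e : ((v : ℝ) - u) / d * ((#(Ω q) : ℝ) / q * ∏ q ∈ T, ((#(Ω q) : ℝ) / q))
        = ∑ ρ ∈ Ω q, ((v : ℝ) - u) / (d * q : ℕ) * ∏ q ∈ T, ((#(Ω q) : ℝ) / q) := by
      rw [sum_const, nsmul_eq_mul]
      push_cast
      have : (q : ℝ) ≠ 0 := by exact_mod_cast hqp.ne_zero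
      have : (d : ℝ) ≠ 0 := by exact_mod_cast hd.ne'
      generalize ∏ q ∈ T, ((#(Ω q) : ℝ) / q) = A
      field_simp
    rw [e, ← sum_sub_distrib]
    refine (abs_sum_le_sum_abs _ _).trans ((sum_le_sum hbound).trans ?_)
    rw [sum_const, nsmul_eq_mul]

open Classical in
/-- Brun's truncated inclusion-exclusion weight attached to the set of `q ∈ P` with `B q`. -/
def brunWeight (P : Finset ℕ) (R : ℕ) (B : ℕ → Prop) : ℝ :=
  ∑ T ∈ P.powerset with #T ≤ R, if ∀ q ∈ T, B q then (-1 : ℝ) ^ #T else 0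

theorem brunWeight_def (P : Finset ℕ) (R : ℕ) (B : ℕ → Prop) [DecidablePred B] :
    brunWeight P R B =
      ∑ T ∈ P.powerset with #T ≤ R, if ∀ q ∈ T, B q then (-1 : ℝ) ^ #T else 0 := by
  unfold brunWeight
  refine sum_congr rfl fun T _ => ?_
  congr

theorem brunWeight_eq_sum_range (P : Finset ℕ) (R : ℕ) (B : ℕ → Prop) [DecidablePred B] :
    brunWeight P R B =
      ∑ j ∈ range (R + 1), (-1 : ℝ) ^ j * ((#(P.filter B)).choose j : ℝ) := by
  classical
  set S := P.filter B
  have h1 : brunWeight P R B = ∑ T ∈ S.powerset with #T ≤ R, (-1 : ℝ) ^ #T := by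
    rw [brunWeight_def, ← sum_filter, filter_filter]
    refine sum_congr ?_ fun _ _ => rfl
    ext T
    simp only [mem_filter, mem_powerset, S, subset_iff]
    constructor
    · rintro ⟨h1, h2, h3⟩; exact ⟨fun x hx => ⟨h1 hx, h3 x hx⟩, h2⟩
    · rintro ⟨h1, h2⟩; exact ⟨fun x hx => (h1 hx).1, h2, fun x hx => (h1 hx).2⟩
  rw [h1]
  have h2 : ∑ T ∈ S.powerset with #T ≤ R, (-1 : ℝ) ^ #T
      = ∑ j ∈ range (R + 1), ∑ T ∈ {T ∈ S.powerset | #T ≤ R} with #T = j, (-1 : ℝ) ^ #T := by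
    refine (sum_fiberwise_of_maps_to ?_ _).symm
    intro T hT
    simp only [mem_filter] at hT
    simpa [Nat.lt_succ_iff] using hT.2
  rw [h2]
  refine sum_congr rfl fun j hj => ?_
  have : {T ∈ {T ∈ S.powerset | #T ≤ R} | #T = j} = powersetCard j S := by
    ext T
    simp only [mem_filter, mem_powerset, mem_powersetCard, mem_range] at *
    constructor
    · rintro ⟨⟨a, b⟩, c⟩; exact ⟨a, c⟩
    · rintro ⟨a, c⟩; exact ⟨⟨a, by omega⟩, c⟩
  rw [this, sum_congr rfl (g := fun _ => (-1 : ℝ) ^ j)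
    (fun T hT => by rw [(mem_powersetCard.1 hT).2]), sum_const, card_powersetCard, nsmul_eq_mul,
    mul_comm]

theorem brunWeight_nonneg (P : Finset ℕ) {R : ℕ} (hR : Even R) (B : ℕ → Prop) :
    0 ≤ brunWeight P R B := by
  classical
  rw [brunWeight_eq_sum_range]
  rcases Nat.eq_zero_or_pos (#(P.filter B)) with h | h
  · rw [h, sum_range_succ']
    simp
  · obtain ⟨n, hn⟩ := Nat.exists_eq_succ_of_ne_zero h.ne'
    rw [hn]
    have := Int.alternating_sum_range_choose_eq_choose (n := n) (m := R)
    have h2 : (∑ k ∈ range (R + 1), ((-1 : ℝ) ^ k * ((n + 1).choose k : ℝ)))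
        = (-1) ^ R * (n.choose R : ℝ) := by exact_mod_cast this
    rw [Nat.succ_eq_add_one, h2, hR.neg_one_pow]
    positivity

theorem brunWeight_eq_one (P : Finset ℕ) (R : ℕ) {B : ℕ → Prop} (hB : ∀ q ∈ P, ¬ B q) :
    brunWeight P R B = 1 := by
  classical
  rw [brunWeight_eq_sum_range, filter_false_of_mem hB, sum_range_succ']
  simp

theorem brunWeight_congr {P : Finset ℕ} (R : ℕ) {B B' : ℕ → Prop} (h : ∀ q ∈ P, (B q ↔ B' q)) :
    brunWeight P R B = brunWeight P R B' := by
  classical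
  rw [brunWeight_eq_sum_range, brunWeight_eq_sum_range, filter_congr h]

theorem sum_powerset_card_le_prod_le (P : Finset ℕ) (R : ℕ) {ω : ℕ → ℝ} (hω : ∀ q ∈ P, 0 ≤ ω q)
    {Z : ℝ} (hZ : 1 ≤ Z) (hZω : ∑ q ∈ P, ω q ≤ Z) :
    ∑ T ∈ P.powerset with #T ≤ R, ∏ q ∈ T, ω q ≤ 3 * Z ^ R := by
  have hZ0 : 0 < Z := by linarith
  calc ∑ T ∈ P.powerset with #T ≤ R, ∏ q ∈ T, ω q
      ≤ ∑ T ∈ P.powerset with #T ≤ R, Z ^ R * ∏ q ∈ T, (ω q / Z) := by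
        refine sum_le_sum fun T hT => ?_
        simp only [mem_filter, mem_powerset] at hT
        rw [prod_div_distrib, prod_const]
        have h1 : 0 ≤ ∏ q ∈ T, ω q := prod_nonneg fun q hq => hω q (hT.1 hq)
        have h2 : Z ^ #T ≤ Z ^ R := pow_le_pow_right₀ hZ hT.2
        rw [mul_div_assoc', le_div_iff₀ (by positivity), mul_comm]
        gcongr
    _ ≤ ∑ T ∈ P.powerset, Z ^ R * ∏ q ∈ T, (ω q / Z) := by
        refine sum_le_sum_of_subset_of_nonneg (filter_subset _ _) fun T hT _ => ?_
        have : 0 ≤ ∏ q ∈ T, (ω q / Z) := prod_nonneg fun q hq =>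
          div_nonneg (hω q (mem_powerset.1 hT hq)) hZ0.le
        positivity
    _ = Z ^ R * ∏ q ∈ P, (1 + ω q / Z) := by rw [← mul_sum, prod_one_add]
    _ ≤ Z ^ R * Real.exp (∑ q ∈ P, ω q / Z) := by
        gcongr
        rw [Real.exp_sum]
        refine prod_le_prod (fun q hq => ?_) fun q hq => ?_
        · have := div_nonneg (hω q hq) hZ0.le; linarith
        · linarith [Real.add_one_le_exp (ω q / Z)]
    _ ≤ Z ^ R * 3 := by
        gcongr
        rw [← sum_div]
        refine (Real.exp_le_exp.2 ((div_le_one hZ0).2 hZω)).trans ?_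
        linarith [Real.exp_one_lt_d9]
    _ = _ := mul_comm _ _

theorem sum_powerset_card_le_neg_one_pow_mul_prod_le (P : Finset ℕ) (R : ℕ) {x : ℕ → ℝ}
    (hx0 : ∀ q ∈ P, 0 ≤ x q) (hx1 : ∀ q ∈ P, x q ≤ 1) :
    ∑ T ∈ P.powerset with #T ≤ R, (-1 : ℝ) ^ #T * ∏ q ∈ T, x q
      ≤ Real.exp (-∑ q ∈ P, x q) + Real.exp (3 * ∑ q ∈ P, x q - R) := by
  have hall : ∑ T ∈ P.powerset, (-1 : ℝ) ^ #T * ∏ q ∈ T, x q = ∏ q ∈ P, (1 - x q) := by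
    simp_rw [sub_eq_add_neg]
    rw [prod_one_add]
    refine sum_congr rfl fun T _ => ?_
    rw [prod_neg]
  have hmain : ∏ q ∈ P, (1 - x q) ≤ Real.exp (-∑ q ∈ P, x q) := by
    rw [← sum_neg_distrib, Real.exp_sum]
    refine prod_le_prod (fun q hq => by linarith [hx1 q hq]) fun q hq => ?_
    linarith [Real.add_one_le_exp (-x q)]
  have htail : -∑ T ∈ P.powerset with ¬ #T ≤ R, (-1 : ℝ) ^ #T * ∏ q ∈ T, x q
      ≤ Real.exp (3 * ∑ q ∈ P, x q - R) := by
    rw [← sum_neg_distrib]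
    calc ∑ T ∈ P.powerset with ¬ #T ≤ R, -((-1 : ℝ) ^ #T * ∏ q ∈ T, x q)
        ≤ ∑ T ∈ P.powerset with ¬ #T ≤ R, Real.exp (-R) * ∏ q ∈ T, (Real.exp 1 * x q) := by
          refine sum_le_sum fun T hT => ?_
          simp only [mem_filter, mem_powerset, not_le] at hT
          have h1 : 0 ≤ ∏ q ∈ T, x q := prod_nonneg fun q hq => hx0 q (hT.1 hq)
          rw [prod_mul_distrib, prod_const, ← Real.exp_nat_mul, ← mul_assoc, ← Real.exp_add]
          have h2 : (1 : ℝ) ≤ Real.exp (-R + #T * 1) := by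
            apply Real.one_le_exp
            have : (R : ℝ) ≤ #T := by exact_mod_cast hT.2.le
            linarith
          have h3 : -((-1 : ℝ) ^ #T * ∏ q ∈ T, x q) ≤ ∏ q ∈ T, x q := by
            rcases neg_one_pow_eq_or ℝ #T with h | h <;> rw [h] <;> linarith
          nlinarith
      _ ≤ ∑ T ∈ P.powerset, Real.exp (-R) * ∏ q ∈ T, (Real.exp 1 * x q) := by
          refine sum_le_sum_of_subset_of_nonneg (filter_subset _ _) fun T hT _ => ?_
          have : 0 ≤ ∏ q ∈ T, (Real.exp 1 * x q) := prod_nonneg fun q hq =>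
            mul_nonneg (Real.exp_pos _).le (hx0 q (mem_powerset.1 hT hq))
          positivity
      _ = Real.exp (-R) * ∏ q ∈ P, (1 + Real.exp 1 * x q) := by rw [← mul_sum, prod_one_add]
      _ ≤ Real.exp (-R) * Real.exp (∑ q ∈ P, 3 * x q) := by
          gcongr
          rw [Real.exp_sum]
          refine prod_le_prod (fun q hq => ?_) fun q hq => ?_
          · have := mul_nonneg (Real.exp_pos 1).le (hx0 q hq); linarith
          · have h1 := Real.add_one_le_exp (3 * x q)
            have h2 : Real.exp 1 * x q ≤ 3 * x q :=
              mul_le_mul_of_nonneg_right (by linarith [Real.exp_one_lt_d9]) (hx0 q hq)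
            linarith
      _ = _ := by rw [← Real.exp_add, ← mul_sum]; ring_nf
  have hsplit := sum_filter_add_sum_filter_not P.powerset (fun T => #T ≤ R)
    (fun T => (-1 : ℝ) ^ #T * ∏ q ∈ T, x q)
  linarith

/-- Brun's pure sieve, upper bound. -/
theorem sum_brunWeight_le (P : Finset ℕ) (hP : ∀ q ∈ P, q.Prime) (R : ℕ) (Ω : ℕ → Finset ℕ)
    (hΩ : ∀ q ∈ P, Ω q ⊆ range q) {u v : ℕ} (huv : u ≤ v) {Z : ℝ} (hZ : 1 ≤ Z)
    (hZΩ : ∑ q ∈ P, (#(Ω q) : ℝ) ≤ Z) :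
    ∑ n ∈ Ioc u v, brunWeight P R (fun q => n % q ∈ Ω q)
      ≤ ((v : ℝ) - u) * (Real.exp (-∑ q ∈ P, (#(Ω q) : ℝ) / q)
          + Real.exp (3 * ∑ q ∈ P, (#(Ω q) : ℝ) / q - R)) + 3 * Z ^ R := by
  classical
  simp_rw [brunWeight_def]
  rw [sum_comm]
  have hcount : ∀ T ∈ P.powerset.filter (fun T => #T ≤ R),
      ∑ n ∈ Ioc u v, (if ∀ q ∈ T, n % q ∈ Ω q then (-1 : ℝ) ^ #T else 0)
      ≤ ((v : ℝ) - u) * ((-1 : ℝ) ^ #T * ∏ q ∈ T, ((#(Ω q) : ℝ) / q))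
        + ∏ q ∈ T, (#(Ω q) : ℝ) := by
    intro T hT
    simp only [mem_filter, mem_powerset] at hT
    have h := abs_card_residues_sub_le T (fun q hq => hP q (hT.1 hq)) Ω
      (fun q hq => hΩ q (hT.1 hq)) huv 1 one_pos (fun q _ => Nat.coprime_one_left q) 0
    simp only [Nat.modEq_one, true_and, Nat.cast_one, div_one] at h
    rw [← sum_filter, sum_const, nsmul_eq_mul]
    rw [abs_le] at h
    rcases neg_one_pow_eq_or ℝ #T with h' | h' <;> rw [h'] <;> linarith
  refine (sum_le_sum hcount).trans ?_
  rw [sum_add_distrib, ← mul_sum]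
  have huv' : (0 : ℝ) ≤ (v : ℝ) - u := by
    have : (u : ℝ) ≤ v := by exact_mod_cast huv
    linarith
  refine add_le_add (mul_le_mul_of_nonneg_left ?_ huv') ?_
  · refine sum_powerset_card_le_neg_one_pow_mul_prod_le P R (fun q _ => by positivity)
      fun q hq => ?_
    have : (0 : ℝ) < q := by exact_mod_cast (hP q hq).pos
    rw [div_le_one this]
    have := card_le_card (hΩ q hq)
    rw [card_range] at this
    exact_mod_cast this
  · exact sum_powerset_card_le_prod_le P R (fun q _ => by positivity) hZ hZΩ

theorem sum_factoredNumbers_le (f : ℕ →* ℝ) (hf : ∀ n, 0 ≤ f n)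
    (hf1 : ∀ p : ℕ, p.Prime → f p < 1) (s A : Finset ℕ)
    (hA : ∀ a ∈ A, a ∈ Nat.factoredNumbers s) :
    ∑ a ∈ A, f a ≤ ∏ p ∈ s with p.Prime, (1 - f p)⁻¹ := by
  have h := (EulerProduct.summable_and_hasSum_factoredNumbers_prod_filter_prime_geometric
    (f := f) (fun {p} hp => by rw [Real.norm_of_nonneg (hf p)]; exact hf1 p hp) s).2
  let B : Finset (Nat.factoredNumbers s) := A.subtype (· ∈ Nat.factoredNumbers s)
  have h2 := sum_le_hasSum B (fun i _ => hf i) h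
  refine le_trans (le_of_eq ?_) h2
  rw [← sum_subtype_of_mem f hA]

theorem sum_one_div_mul_pred_le (S : Finset ℕ) (w : ℕ) (hw : 1 ≤ w) (hS : ∀ n ∈ S, w < n) :
    ∑ n ∈ S, (1 : ℝ) / (n * (n - 1)) ≤ 1 / w := by
  have key : ∀ m : ℕ, w ≤ m →
      ∑ n ∈ Ioc w m, (1 : ℝ) / (n * (n - 1)) = 1 / w - 1 / m := by
    intro m hm
    induction m, hm using Nat.le_induction with
    | base => simp
    | succ m hm ih =>
      rw [sum_Ioc_succ_top hm, ih]
      have : (m : ℝ) ≠ 0 := by exact_mod_cast (by omega : m ≠ 0)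
      have : (w : ℝ) ≠ 0 := by exact_mod_cast (by omega : w ≠ 0)
      have : (m : ℝ) + 1 ≠ 0 := by positivity
      push_cast
      rw [add_sub_cancel_right]
      field_simp
      ring
  set m := w + S.sup id
  have hsub : S ⊆ Ioc w m := by
    intro n hn
    have : n ≤ S.sup id := le_sup (f := id) hn
    simp only [mem_Ioc, m]
    exact ⟨hS n hn, by omega⟩
  calc _ ≤ ∑ n ∈ Ioc w m, (1 : ℝ) / (n * (n - 1)) := by
        refine sum_le_sum_of_subset_of_nonneg hsub fun n hn _ => ?_
        have : (1 : ℝ) ≤ n := by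
          have := (mem_Ioc.1 hn).1
          exact_mod_cast (by omega : 1 ≤ n)
        exact div_nonneg zero_le_one (mul_nonneg (by linarith) (by linarith))
    _ ≤ 1 / w := by
        rw [key m (by omega)]
        have : (0 : ℝ) ≤ 1 / m := by positivity
        linarith

/-- Lower bound in Mertens' second theorem. -/
theorem log_log_sub_one_le_sum_one_div_prime {n : ℕ} (hn : 2 ≤ n) :
    Real.log (Real.log n) - 1 ≤ ∑ q ∈ range (n + 1) with q.Prime, (1 : ℝ) / q := by
  let f : ℕ →* ℝ :=
    { toFun := fun m => ((m : ℝ))⁻¹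
      map_one' := by simp
      map_mul' := fun a b => by push_cast; rw [mul_inv] }
  have hlog : 0 < Real.log n := Real.log_pos (by exact_mod_cast hn)
  have h1 : Real.log n ≤ ∑ m ∈ Icc 1 n, f m := by
    have h := log_add_one_le_harmonic n
    rw [harmonic_eq_sum_Icc] at h
    push_cast at h
    refine le_trans (Real.log_le_log (by positivity) (by linarith)) h
  have h2 : ∑ m ∈ Icc 1 n, f m ≤ ∏ p ∈ range (n + 1) with p.Prime, (1 - f p)⁻¹ := by
    refine sum_factoredNumbers_le f (fun m => by simp [f]) (fun p hp => ?_) _ _ fun a ha => ?_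
    · exact inv_lt_one_of_one_lt₀ (by exact_mod_cast hp.one_lt)
    · rw [mem_Icc] at ha
      rw [Nat.mem_factoredNumbers_iff_primeFactors_subset]
      refine ⟨by omega, fun p hp => ?_⟩
      have := Nat.le_of_mem_primeFactors hp
      simp; omega
  have h3 : ∏ p ∈ range (n + 1) with p.Prime, (1 - f p)⁻¹
      ≤ Real.exp (∑ p ∈ range (n + 1) with p.Prime, ((1 : ℝ) / p + 1 / (p * (p - 1)))) := by
    rw [Real.exp_sum]
    refine prod_le_prod (fun p hp => ?_) fun p hp => ?_
    · have hp1 : (1 : ℝ) < p := by exact_mod_cast (mem_filter.1 hp).2.one_lt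
      have : f p < 1 := inv_lt_one_of_one_lt₀ hp1
      exact inv_nonneg.2 (by linarith)
    · have hp1 : (1 : ℝ) < p := by exact_mod_cast (mem_filter.1 hp).2.one_lt
      have e1 : (1 : ℝ) / p + 1 / (p * (p - 1)) = 1 / (p - 1) := by
        have : (p : ℝ) - 1 ≠ 0 := by linarith
        field_simp; ring
      have e2 : (1 - f p)⁻¹ = 1 / ((p : ℝ) - 1) + 1 := by
        have : (p : ℝ) - 1 ≠ 0 := by linarith
        have : (p : ℝ) ≠ 0 := by linarith
        change (1 - (p : ℝ)⁻¹)⁻¹ = _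
        rw [show 1 - (p : ℝ)⁻¹ = (p - 1) / p by field_simp]
        field_simp; ring
      rw [e1, e2]
      exact Real.add_one_le_exp _
  have h4 : ∑ p ∈ range (n + 1) with p.Prime, (1 : ℝ) / (p * (p - 1)) ≤ 1 := by
    have := sum_one_div_mul_pred_le ((range (n + 1)).filter Nat.Prime) 1 le_rfl
      fun p hp => (mem_filter.1 hp).2.one_lt
    simpa using this
  have h5 : Real.log (Real.log n) ≤
      ∑ p ∈ range (n + 1) with p.Prime, ((1 : ℝ) / p + 1 / (p * (p - 1))) := by
    rw [Real.log_le_iff_le_exp hlog]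
    exact h1.trans (h2.trans h3)
  rw [sum_add_distrib] at h5
  linarith

theorem sum_one_div_prime_dyadic_le {k : ℕ} (hk : 1 ≤ k) :
    ∑ q ∈ (Ioc (2 ^ k) (2 ^ (k + 1)) : Finset ℕ) with q.Prime, (1 : ℝ) / q ≤ 4 / k := by
  have hlog2 := Real.log_pos one_lt_two
  have hk0 : (0 : ℝ) < k := by exact_mod_cast hk
  have hθ := Chebyshev.theta_le_log4_mul_x (x := ((2 ^ (k + 1) : ℕ) : ℝ)) (by positivity)
  rw [Chebyshev.theta_eq_sum_Icc, Nat.floor_natCast] at hθ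
  have hlog4 : Real.log 4 = 2 * Real.log 2 := by
    rw [show (4 : ℝ) = 2 ^ 2 by norm_num, Real.log_pow]; norm_num
  calc ∑ q ∈ (Ioc (2 ^ k) (2 ^ (k + 1)) : Finset ℕ) with q.Prime, (1 : ℝ) / q
      ≤ ∑ q ∈ (Ioc (2 ^ k) (2 ^ (k + 1)) : Finset ℕ) with q.Prime,
          Real.log q * (1 / (2 ^ k * (k * Real.log 2))) := by
        refine sum_le_sum fun q hq => ?_
        simp only [mem_filter, mem_Ioc] at hq
        have h1 : (2 : ℝ) ^ k ≤ q := by exact_mod_cast hq.1.1.le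
        have h2 : k * Real.log 2 ≤ Real.log q := by
          rw [← Real.log_pow]; exact Real.log_le_log (by positivity) h1
        have h3 : (0 : ℝ) < q := by exact_mod_cast hq.2.pos
        rw [mul_one_div, div_le_div_iff₀ h3 (by positivity), one_mul, mul_comm]
        exact mul_le_mul h2 h1 (by positivity) (by linarith [mul_pos hk0 hlog2])
    _ ≤ (∑ q ∈ (Icc 0 (2 ^ (k + 1)) : Finset ℕ) with q.Prime, Real.log q)
          * (1 / (2 ^ k * (k * Real.log 2))) := by
        rw [← sum_mul]
        refine mul_le_mul_of_nonneg_right ?_ (by positivity)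
        refine sum_le_sum_of_subset_of_nonneg ?_ fun q hq _ => Real.log_natCast_nonneg q
        intro q hq
        simp only [mem_filter, mem_Ioc, mem_Icc] at hq ⊢
        exact ⟨⟨Nat.zero_le _, hq.1.2⟩, hq.2⟩
    _ ≤ (Real.log 4 * ((2 ^ (k + 1) : ℕ) : ℝ)) * (1 / (2 ^ k * (k * Real.log 2))) := by
        gcongr
    _ = 4 / k := by
        rw [hlog4]; push_cast; rw [pow_succ]; field_simp; norm_num

/-- A Chebyshev-type upper bound for the sum of reciprocals of primes. -/
theorem sum_one_div_prime_le {n : ℕ} (hn : 1 ≤ n) :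
    ∑ q ∈ range (n + 1) with q.Prime, (1 : ℝ) / q ≤ 5 + 4 * Real.log (2 * Real.log n + 1) := by
  have key : ∀ K : ℕ, ∑ q ∈ (Ioc 0 (2 ^ (K + 1)) : Finset ℕ) with q.Prime, (1 : ℝ) / q
      ≤ 1 / 2 + ∑ k ∈ Icc 1 K, (4 : ℝ) / k := by
    intro K
    induction K with
    | zero =>
      have : (Ioc 0 (2 ^ (0 + 1)) : Finset ℕ).filter Nat.Prime = {2} := by decide
      rw [this]; simp
    | succ K ih =>
      rw [sum_Icc_succ_top (by omega)]
      have hsplit : (Ioc 0 (2 ^ (K + 1 + 1)) : Finset ℕ).filter Nat.Prime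
          = (Ioc 0 (2 ^ (K + 1)) : Finset ℕ).filter Nat.Prime
            ∪ (Ioc (2 ^ (K + 1)) (2 ^ (K + 1 + 1))).filter Nat.Prime := by
        rw [← filter_union, Ioc_union_Ioc_eq_Ioc (by positivity)
          (Nat.pow_le_pow_right (by norm_num) (by omega))]
      rw [hsplit, sum_union]
      · have := sum_one_div_prime_dyadic_le (k := K + 1) (by omega)
        linarith
      · refine disjoint_left.2 fun x hx hx' => ?_
        simp only [mem_filter, mem_Ioc] at hx hx'
        omega
  set K := Nat.log 2 n
  have hnK : n < 2 ^ (K + 1) := Nat.lt_pow_succ_log_self (by norm_num) n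
  have h1 : ∑ q ∈ range (n + 1) with q.Prime, (1 : ℝ) / q
      ≤ ∑ q ∈ (Ioc 0 (2 ^ (K + 1)) : Finset ℕ) with q.Prime, (1 : ℝ) / q := by
    refine sum_le_sum_of_subset_of_nonneg ?_ fun q hq _ => by positivity
    intro q hq
    simp only [mem_filter, mem_range, mem_Ioc] at hq ⊢
    exact ⟨⟨hq.2.pos, by omega⟩, hq.2⟩
  have h2 : ∑ k ∈ Icc 1 K, (4 : ℝ) / k ≤ 4 * (1 + Real.log (K + 1)) := by
    have h := harmonic_le_one_add_log K
    rw [harmonic_eq_sum_Icc] at h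
    push_cast at h
    have e : ∑ k ∈ Icc 1 K, (4 : ℝ) / k = 4 * ∑ k ∈ Icc 1 K, ((k : ℝ))⁻¹ := by
      rw [mul_sum]; rfl
    rw [e]
    have : Real.log K ≤ Real.log (K + 1) := by
      rcases Nat.eq_zero_or_pos K with h0 | h0
      · simp [h0]
      · exact Real.log_le_log (by exact_mod_cast h0) (by linarith)
    linarith
  have h3 : (K : ℝ) + 1 ≤ 2 * Real.log n + 1 := by
    have hp : ((2 ^ K : ℕ) : ℝ) ≤ n := by
      exact_mod_cast Nat.pow_log_le_self 2 (by omega)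
    have := Real.log_le_log (by positivity) hp
    push_cast at this
    rw [Real.log_pow] at this
    have hl := Real.log_two_gt_d9
    nlinarith [(Nat.cast_nonneg K : (0 : ℝ) ≤ K)]
  have h4 := Real.log_le_log (by positivity) h3
  linarith [key K]

theorem chi4_mul (a b : ℕ) : chi4 (a * b) = chi4 a * chi4 b := by
  unfold chi4
  rw [Nat.mul_mod]
  have ha := Nat.mod_lt a (show 0 < 4 by norm_num)
  have hb := Nat.mod_lt b (show 0 < 4 by norm_num)
  generalize a % 4 = x at *
  generalize b % 4 = y at *
  interval_cases x <;> interval_cases y <;> norm_num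

theorem chi4_add_two (n : ℕ) : chi4 (n + 2) = -chi4 n := by
  unfold chi4
  rw [Nat.add_mod]
  have ha := Nat.mod_lt n (show 0 < 4 by norm_num)
  generalize n % 4 = x at *
  interval_cases x <;> norm_num

theorem abs_chi4_le_one (n : ℕ) : |chi4 n| ≤ 1 := by
  unfold chi4
  split_ifs <;> norm_num

theorem chi4_mul_self (n : ℕ) : chi4 n * chi4 n = if Odd n then 1 else 0 := by
  unfold chi4
  simp only [Nat.odd_iff]
  have : n % 2 = n % 4 % 2 := by omega
  simp only [this]
  have ha := Nat.mod_lt n (show 0 < 4 by norm_num)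
  generalize n % 4 = x at *
  interval_cases x <;> norm_num

theorem chi4_add_two_mul_odd (n : ℕ) {δ : ℕ} (hδ : Odd δ) : chi4 (n + 2 * δ) = -chi4 n := by
  obtain ⟨k, rfl⟩ := hδ
  have h4 : ∀ m, chi4 (m + 4 * k) = chi4 m := by
    intro m; unfold chi4; simp
  rw [show n + 2 * (2 * k + 1) = (n + 2) + 4 * k by ring, h4, chi4_add_two]

theorem modEq_of_dvd_mul_add_one {δ s e e' : ℕ} (h : δ ∣ s * e + 1) (h' : δ ∣ s * e' + 1) :
    e ≡ e' [MOD δ] := by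
  have hcop : δ.Coprime s := by
    refine Nat.Coprime.symm (Nat.Coprime.coprime_dvd_right h ?_)
    simp
  have h1 : s * e + 1 ≡ s * e' + 1 [MOD δ] :=
    ((Nat.modEq_zero_iff_dvd.2 h)).trans (Nat.modEq_zero_iff_dvd.2 h').symm
  exact Nat.ModEq.cancel_left_of_coprime hcop (Nat.ModEq.add_right_cancel' 1 h1)

theorem card_dvd_mul_add_one_le {δ : ℕ} (hδ : 0 < δ) (s : ℕ) {u v : ℕ} (huv : u ≤ v) :
    (#{e ∈ Ioc u v | δ ∣ s * e + 1} : ℝ) ≤ ((v : ℝ) - u) / δ + 1 := by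
  have huv' : (0 : ℝ) ≤ ((v : ℝ) - u) / δ := by
    have : (u : ℝ) ≤ v := by exact_mod_cast huv
    exact div_nonneg (by linarith) (by positivity)
  rcases ({e ∈ Ioc u v | δ ∣ s * e + 1} : Finset ℕ).eq_empty_or_nonempty with h | ⟨e₀, he₀⟩
  · rw [h]; simp; linarith
  · have h0 := (mem_filter.1 he₀).2
    have h1 : #{e ∈ Ioc u v | δ ∣ s * e + 1} ≤ #{x ∈ Ioc u v | x ≡ e₀ [MOD δ]} :=
      card_le_card (monotone_filter_right _ fun e _ he => modEq_of_dvd_mul_add_one he h0)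
    have h2 := (abs_le.1 (abs_card_modEq_sub_le hδ huv e₀)).2
    have h3 : (#{e ∈ Ioc u v | δ ∣ s * e + 1} : ℝ) ≤ #{x ∈ Ioc u v | x ≡ e₀ [MOD δ]} := by
      exact_mod_cast h1
    linarith

theorem abs_sum_chi4_dvd_le {δ : ℕ} (hδ : Odd δ) (s : ℕ) (u v : ℕ) :
    |∑ e ∈ Ioc u v, if δ ∣ s * e + 1 then chi4 e else 0| ≤ 5 := by
  set f : ℕ → ℝ := fun e => if δ ∣ s * e + 1 then chi4 e else 0
  have hδ0 : 0 < δ := hδ.pos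
  have hf : ∀ e, f (e + 2 * δ) = -f e := by
    intro e
    simp only [f]
    have : δ ∣ s * (e + 2 * δ) + 1 ↔ δ ∣ s * e + 1 := by
      rw [show s * (e + 2 * δ) + 1 = s * e + 1 + δ * (2 * s) by ring]
      exact (Nat.dvd_add_iff_left (Dvd.intro _ rfl)).symm
    simp only [this, chi4_add_two_mul_odd e hδ]
    split_ifs <;> simp
  have hshift : ∀ a b, ∑ e ∈ Ioc (a + 2 * δ) (b + 2 * δ), f e = -∑ e ∈ Ioc a b, f e := by
    intro a b
    rw [← map_add_right_Ioc, sum_map, ← sum_neg_distrib]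
    exact sum_congr rfl fun e _ => hf e
  have main : ∀ ℓ u, |∑ e ∈ Ioc u (u + ℓ), f e| ≤ 5 := by
    intro ℓ
    induction ℓ using Nat.strong_induction_on with
    | _ ℓ ih =>
      intro u
      rcases lt_or_ge ℓ (4 * δ) with h | h
      · have hle : u ≤ u + ℓ := by omega
        calc |∑ e ∈ Ioc u (u + ℓ), f e| ≤ ∑ e ∈ Ioc u (u + ℓ), |f e| := abs_sum_le_sum_abs _ _
          _ ≤ ∑ e ∈ Ioc u (u + ℓ), if δ ∣ s * e + 1 then (1 : ℝ) else 0 := by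
              refine sum_le_sum fun e _ => ?_
              simp only [f]
              split_ifs
              · exact abs_chi4_le_one e
              · simp
          _ = (#{e ∈ Ioc u (u + ℓ) | δ ∣ s * e + 1} : ℝ) := by rw [sum_boole]
          _ ≤ _ := card_dvd_mul_add_one_le hδ0 s hle
          _ ≤ 5 := by
              push_cast
              have h1 : (ℓ : ℝ) ≤ 4 * δ := by exact_mod_cast h.le
              have h2 : (0 : ℝ) < δ := by exact_mod_cast hδ0
              have : ((u : ℝ) + ℓ - u) / δ ≤ 4 := by
                rw [div_le_iff₀ h2]; linarith
              linarith
      · have h1 : ∑ e ∈ Ioc u (u + ℓ), f e = ∑ e ∈ Ioc (u + 4 * δ) (u + ℓ), f e := by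
          rw [← sum_Ioc_consecutive f (show u ≤ u + 4 * δ by omega) (show _ ≤ u + ℓ by omega),
            ← sum_Ioc_consecutive f (show u ≤ u + 2 * δ by omega)
              (show u + 2 * δ ≤ u + 4 * δ by omega),
            show u + 4 * δ = u + 2 * δ + 2 * δ by ring, hshift]
          ring
        rw [h1]
        have := ih (ℓ - 4 * δ) (by omega) (u + 4 * δ)
        rwa [show u + 4 * δ + (ℓ - 4 * δ) = u + ℓ by omega] at this
  rcases le_total u v with h | h
  · have := main (v - u) u
    rwa [show u + (v - u) = v by omega] at this
  · rw [Ioc_eq_empty (by omega)]; simp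

theorem sum_moebius_divisors_dvd (e : ℕ) {K : ℕ} (hK : K ≠ 0) :
    ∑ k ∈ K.divisors, (if k ∣ e then (ArithmeticFunction.moebius k : ℝ) else 0)
      = if e.Coprime K then 1 else 0 := by
  have h : K.divisors.filter (· ∣ e) = (Nat.gcd e K).divisors := by
    ext k
    simp [Nat.dvd_gcd_iff, hK]
    tauto
  rw [← sum_filter, h]
  have := ArithmeticFunction.coe_mul_zeta_apply (f := ArithmeticFunction.moebius) (x := Nat.gcd e K)
  rw [ArithmeticFunction.moebius_mul_coe_zeta, ArithmeticFunction.one_apply] at this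
  simp only [Nat.coprime_iff_gcd_eq_one]
  have h2 : ((∑ i ∈ (Nat.gcd e K).divisors, ArithmeticFunction.moebius i : ℤ) : ℝ)
      = ((if Nat.gcd e K = 1 then 1 else 0 : ℤ) : ℝ) := by rw [← this]
  push_cast at h2
  exact h2

theorem sum_Ioc_dvd (f : ℕ → ℝ) {k : ℕ} (hk : 0 < k) (u v : ℕ) :
    ∑ e ∈ Ioc u v, (if k ∣ e then f e else 0) = ∑ e ∈ Ioc (u / k) (v / k), f (k * e) := by
  rw [← sum_filter]
  symm
  refine sum_nbij' (fun e => k * e) (fun e => e / k) ?_ ?_ ?_ ?_ ?_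
  · intro e he
    rw [mem_Ioc, Nat.div_lt_iff_lt_mul hk, Nat.le_div_iff_mul_le hk] at he
    simp only [mem_filter, mem_Ioc]
    refine ⟨⟨by linarith [mul_comm k e], by linarith [mul_comm k e]⟩, Dvd.intro _ rfl⟩
  · intro e he
    simp only [mem_filter, mem_Ioc] at he
    obtain ⟨⟨h1, h2⟩, c, rfl⟩ := he
    rw [Nat.mul_div_cancel_left _ hk, mem_Ioc, Nat.div_lt_iff_lt_mul hk, Nat.le_div_iff_mul_le hk]
    exact ⟨by linarith [mul_comm k c], by linarith [mul_comm k c]⟩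
  · intro e _; exact Nat.mul_div_cancel_left _ hk
  · intro e he; exact Nat.mul_div_cancel' (mem_filter.1 he).2
  · intro e _; rfl

theorem abs_sum_chi4_coprime_dvd_le {δ : ℕ} (hδ : Odd δ) (s : ℕ) {K : ℕ} (hK : K ≠ 0) (u v : ℕ) :
    |∑ e ∈ Ioc u v, if e.Coprime K ∧ δ ∣ s * e + 1 then chi4 e else 0|
      ≤ 5 * (#K.divisors : ℝ) := by
  have h1 : ∑ e ∈ Ioc u v, (if e.Coprime K ∧ δ ∣ s * e + 1 then chi4 e else 0)
      = ∑ k ∈ K.divisors, ∑ e ∈ Ioc u v, (if k ∣ e then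
        (ArithmeticFunction.moebius k : ℝ) * (if δ ∣ s * e + 1 then chi4 e else 0) else 0) := by
    rw [sum_comm]
    refine sum_congr rfl fun e _ => ?_
    have := sum_moebius_divisors_dvd e hK
    have h2 : (if e.Coprime K ∧ δ ∣ s * e + 1 then chi4 e else 0)
        = (if e.Coprime K then 1 else 0) * (if δ ∣ s * e + 1 then chi4 e else 0) := by
      by_cases h : e.Coprime K <;> by_cases h' : δ ∣ s * e + 1 <;> simp [h, h']
    rw [h2, ← this, sum_mul]
    refine sum_congr rfl fun k _ => ?_
    split_ifs <;> simp
  rw [h1]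
  refine (abs_sum_le_sum_abs _ _).trans ?_
  rw [mul_comm, ← nsmul_eq_mul, ← sum_const]
  refine sum_le_sum fun k hk => ?_
  have hk0 : 0 < k := Nat.pos_of_mem_divisors hk
  rw [sum_Ioc_dvd _ hk0]
  have h3 : ∑ e ∈ Ioc (u / k) (v / k), (ArithmeticFunction.moebius k : ℝ)
        * (if δ ∣ s * (k * e) + 1 then chi4 (k * e) else 0)
      = (ArithmeticFunction.moebius k : ℝ) * chi4 k *
        ∑ e ∈ Ioc (u / k) (v / k), (if δ ∣ (s * k) * e + 1 then chi4 e else 0) := by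
    rw [mul_sum]
    refine sum_congr rfl fun e _ => ?_
    rw [← mul_assoc s, chi4_mul]
    split_ifs <;> ring
  rw [h3, abs_mul, abs_mul]
  have h4 : |(ArithmeticFunction.moebius k : ℝ)| ≤ 1 := by
    exact_mod_cast ArithmeticFunction.abs_moebius_le_one
  have h5 := abs_chi4_le_one k
  have h6 := abs_sum_chi4_dvd_le hδ (s * k) (u / k) (v / k)
  calc _ ≤ 1 * 1 * (5 : ℝ) := by gcongr
    _ = 5 := by norm_num

theorem card_divisors_le_two_mul_sqrt (n : ℕ) : (#n.divisors : ℝ) ≤ 2 * Real.sqrt n := by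
  have hsub : n.divisors ⊆ Icc 1 (Nat.sqrt n) ∪ (Icc 1 (Nat.sqrt n)).image (n / ·) := by
    intro d hd
    rw [Nat.mem_divisors] at hd
    obtain ⟨⟨e, rfl⟩, h0⟩ := hd
    have hd0 : 0 < d := Nat.pos_of_ne_zero fun h => h0 (by simp [h])
    have he0 : 0 < e := Nat.pos_of_ne_zero fun h => h0 (by simp [h])
    simp only [mem_union, mem_image, mem_Icc]
    rcases le_total d e with h | h
    · left; exact ⟨hd0, Nat.le_sqrt.2 (Nat.mul_le_mul_left d h)⟩
    · right
      exact ⟨e, ⟨he0, Nat.le_sqrt.2 (Nat.mul_le_mul_right e h)⟩, Nat.mul_div_cancel _ he0⟩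
  have h1 : #n.divisors ≤ 2 * Nat.sqrt n := by
    refine (card_le_card hsub).trans ((card_union_le _ _).trans ?_)
    have := card_image_le (s := Icc 1 (Nat.sqrt n)) (f := (n / ·))
    simp at this ⊢
    omega
  have h2 : (#n.divisors : ℝ) ≤ 2 * (Nat.sqrt n : ℝ) := by exact_mod_cast h1
  linarith [Real.nat_sqrt_le_real_sqrt (a := n)]

theorem sum_card_divisors_div_sq_le (S : Finset ℕ) {E : ℕ} (hE : 1 ≤ E) (hS : ∀ e ∈ S, E < e) :
    ∑ e ∈ S, (#e.divisors : ℝ) / (e : ℝ) ^ 2 ≤ 4 / Real.sqrt E := by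
  have hterm : ∀ e : ℕ, 2 ≤ e → (#e.divisors : ℝ) / (e : ℝ) ^ 2
      ≤ 4 * (1 / Real.sqrt (e - 1 : ℕ) - 1 / Real.sqrt e) := by
    intro e he
    have hx : (0 : ℝ) < Real.sqrt e := Real.sqrt_pos.2 (by exact_mod_cast (by omega : 0 < e))
    have hy : (0 : ℝ) < Real.sqrt (e - 1 : ℕ) :=
      Real.sqrt_pos.2 (by exact_mod_cast (by omega : 0 < e - 1))
    have hxx : Real.sqrt e ^ 2 = e := Real.sq_sqrt (by positivity)
    have hyy : Real.sqrt (e - 1 : ℕ) ^ 2 = e - 1 := by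
      rw [Real.sq_sqrt (by positivity), Nat.cast_sub (by omega)]; simp
    have hyx : Real.sqrt (e - 1 : ℕ) ≤ Real.sqrt e :=
      Real.sqrt_le_sqrt (by exact_mod_cast Nat.sub_le e 1)
    have hτ := card_divisors_le_two_mul_sqrt e
    set x := Real.sqrt e
    set y := Real.sqrt (e - 1 : ℕ)
    rw [← hxx]
    have h1 : (#e.divisors : ℝ) / (x ^ 2) ^ 2 ≤ 2 * x / (x ^ 2) ^ 2 := by gcongr
    refine h1.trans ?_
    have h2 : 1 / y - 1 / x = (x - y) / (x * y) := by field_simp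
    have h3 : (x - y) * (x + y) = 1 := by nlinarith
    have h4 : x - y = 1 / (x + y) := by
      rw [eq_div_iff (by positivity)]; exact h3
    rw [h2, h4, div_div, mul_one_div, div_le_div_iff₀ (by positivity) (by positivity)]
    have h5 : (x + y) * (x * y) ≤ (2 * x) * (x * x) := by
      have : x + y ≤ 2 * x := by linarith
      gcongr
    nlinarith
  have key : ∀ m : ℕ, E ≤ m →
      ∑ e ∈ Ioc E m, 4 * (1 / Real.sqrt (e - 1 : ℕ) - 1 / Real.sqrt e)
        = 4 * (1 / Real.sqrt E - 1 / Real.sqrt m) := by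
    intro m hm
    induction m, hm using Nat.le_induction with
    | base => simp
    | succ m hm ih =>
      rw [sum_Ioc_succ_top hm, ih, Nat.add_sub_cancel]
      ring
  set m := E + S.sup id
  have hsub : S ⊆ Ioc E m := by
    intro n hn
    have : n ≤ S.sup id := le_sup (f := id) hn
    simp only [mem_Ioc, m]
    exact ⟨hS n hn, by omega⟩
  calc _ ≤ ∑ e ∈ Ioc E m, (#e.divisors : ℝ) / (e : ℝ) ^ 2 :=
        sum_le_sum_of_subset_of_nonneg hsub fun _ _ _ => by positivity
    _ ≤ ∑ e ∈ Ioc E m, 4 * (1 / Real.sqrt (e - 1 : ℕ) - 1 / Real.sqrt e) :=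
        sum_le_sum fun e he => hterm e (by have := (mem_Ioc.1 he).1; omega)
    _ ≤ _ := by
        rw [key m (by omega)]
        have : (0 : ℝ) ≤ 1 / Real.sqrt m := by positivity
        rw [mul_sub, mul_one_div]
        linarith

theorem exists_odd_dvd_mul_add_one {s δ : ℕ} (hδ : Odd δ) (h : s.Coprime δ) :
    ∃ c, Odd c ∧ δ ∣ s * c + 1 := by
  have hδ0 : 0 < δ := hδ.pos
  obtain ⟨c, hc⟩ : ∃ c, δ ∣ s * c + 1 := by
    have : NeZero δ := ⟨hδ0.ne'⟩
    refine ⟨(-(s : ZMod δ)⁻¹).val, ?_⟩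
    rw [← ZMod.natCast_eq_zero_iff]
    push_cast
    rw [ZMod.natCast_val, ZMod.cast_id', id_eq, mul_neg, ZMod.coe_mul_inv_eq_one s h]
    ring
  rcases Nat.even_or_odd c with he | ho
  · refine ⟨c + δ, he.add_odd hδ, ?_⟩
    rw [show s * (c + δ) + 1 = s * c + 1 + s * δ by ring]
    exact dvd_add hc (Dvd.intro_left _ rfl)
  · exact ⟨c, ho, hc⟩

theorem odd_and_dvd_mul_add_one_iff {s δ c g : ℕ} (hδ : Odd δ) (hc : Odd c) (h : δ ∣ s * c + 1) :
    (Odd g ∧ δ ∣ s * g + 1) ↔ g ≡ c [MOD 2 * δ] := by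
  have h2δ : Nat.Coprime 2 δ := Nat.coprime_two_left.2 hδ
  rw [← Nat.modEq_and_modEq_iff_modEq_mul h2δ]
  have h2 : Odd g ↔ g ≡ c [MOD 2] := by
    unfold Nat.ModEq
    rw [Nat.odd_iff] at hc ⊢
    omega
  rw [h2]
  refine and_congr_right fun _ => ⟨fun hg => modEq_of_dvd_mul_add_one hg h, fun hg => ?_⟩
  have : s * g + 1 ≡ s * c + 1 [MOD δ] := (hg.mul_left s).add_right 1
  exact (Nat.modEq_zero_iff_dvd.1 (this.trans (Nat.modEq_zero_iff_dvd.2 h)))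

theorem abs_card_odd_dvd_sub_le {δ : ℕ} (hδ : Odd δ) (s a b : ℕ) :
    |(#{g ∈ Ioc a b | Odd g ∧ δ ∣ s * g + 1} : ℝ)
      - (if s.Coprime δ then (1 : ℝ) / δ else 0) * #{g ∈ Ioc a b | Odd g}| ≤ 2 := by
  have hδ0 : 0 < δ := hδ.pos
  rcases le_total b a with hab | hab
  · rw [Ioc_eq_empty (by omega)]; simp
  by_cases hs : s.Coprime δ
  · obtain ⟨c, hc, hcd⟩ := exists_odd_dvd_mul_add_one hδ hs
    have h1 := abs_card_modEq_sub_le (show 0 < 2 * δ by omega) hab c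
    have h2 := abs_card_modEq_sub_le (show 0 < 2 * 1 by omega) hab 1
    rw [filter_congr fun g _ => odd_and_dvd_mul_add_one_iff hδ hc hcd]
    have h3 : ({g ∈ Ioc a b | Odd g} : Finset ℕ) = {g ∈ Ioc a b | g ≡ 1 [MOD 2 * 1]} := by
      refine filter_congr fun g _ => ?_
      rw [Nat.odd_iff]; rfl
    rw [h3, if_pos hs]
    push_cast at h1 h2
    have hδ1 : (1 : ℝ) ≤ δ := by exact_mod_cast hδ0
    set x : ℝ := ((#{x ∈ Ioc a b | x ≡ c [MOD 2 * δ]} : ℕ) : ℝ)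
    set z : ℝ := ((#{x ∈ Ioc a b | x ≡ 1 [MOD 2 * 1]} : ℕ) : ℝ)
    have h4 : x - 1 / δ * z
        = (x - ((b : ℝ) - a) / (2 * δ)) - 1 / δ * (z - ((b : ℝ) - a) / (2 * 1)) := by
      field_simp; ring
    rw [h4]
    refine (abs_sub _ _).trans ?_
    rw [abs_mul, abs_of_nonneg (by positivity : (0 : ℝ) ≤ 1 / δ)]
    have h5 : 1 / (δ : ℝ) ≤ 1 := by rw [div_le_one (by linarith)]; exact hδ1
    have h6 : |z - ((b : ℝ) - a) / (2 * 1)| ≤ 1 := by rwa [mul_one]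
    have : 1 / (δ : ℝ) * |z - ((b : ℝ) - a) / (2 * 1)| ≤ 1 * 1 := by gcongr
    linarith
  · rw [if_neg hs, zero_mul, sub_zero, filter_eq_empty_iff.2]
    · simp
    · rintro g _ ⟨_, hg⟩
      apply hs
      refine Nat.Coprime.symm (Nat.Coprime.coprime_dvd_left hg ?_)
      rw [Nat.coprime_comm]
      refine Nat.Coprime.coprime_dvd_left (Dvd.intro _ rfl : s ∣ s * g) ?_
      simp

/-- The parameters `e₁, e₂, g, m` describing a pair of divisors `g e₁, g e₂` in `(D₀, D₁]` of
`n = g e₁ e₂ m ≤ N` with greatest common divisor `g`. -/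
def DivisorPair (N D0 D1 e1 e2 g m : ℕ) : Prop :=
  e1.Coprime e2 ∧ (D0 < g * e1 ∧ g * e1 ≤ D1) ∧ (D0 < g * e2 ∧ g * e2 ≤ D1) ∧
    g * e1 * e2 * m ≤ N

instance (N D0 D1 e1 e2 g m : ℕ) : Decidable (DivisorPair N D0 D1 e1 e2 g m) := by
  unfold DivisorPair; infer_instance

section

variable {N D0 D1 Y : ℕ}

theorem DivisorPair.bounds (hD1 : D1 ≤ Y) (hY : N < (Y + 1) * (D0 + 1)) {e1 e2 g m : ℕ}
    (h : DivisorPair N D0 D1 e1 e2 g m) : g * e2 ≤ Y ∧ m * e2 ≤ Y := by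
  obtain ⟨_, ⟨h1, _⟩, ⟨_, h3⟩, h4⟩ := h
  refine ⟨h3.trans hD1, ?_⟩
  by_contra! hlt
  have : (Y + 1) * (D0 + 1) ≤ (m * e2) * (g * e1) := Nat.mul_le_mul hlt h1
  have e : (m * e2) * (g * e1) = g * e1 * e2 * m := by ring
  omega

theorem DivisorPair.left_le {Q2 : ℕ} (hQ : D1 ≤ Q2 * D0) {e1 e2 g m : ℕ}
    (h : DivisorPair N D0 D1 e1 e2 g m) : e1 ≤ Q2 * e2 := by
  obtain ⟨_, ⟨h1, h2⟩, ⟨h3, h4⟩, _⟩ := h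
  by_contra! hlt
  have hg : 0 < g := Nat.pos_of_ne_zero fun h => by simp [h] at h1
  have : g * (Q2 * e2) ≤ g * e1 := Nat.mul_le_mul_left g hlt.le
  have h5 : Q2 * D0 ≤ Q2 * (g * e2) := Nat.mul_le_mul_left _ h3.le
  have e : g * (Q2 * e2) = Q2 * (g * e2) := by ring
  have h6 : g * (Q2 * e2) < g * e1 := Nat.mul_lt_mul_of_pos_left hlt hg
  omega

theorem abs_sum_divisorPair_left_le (hD1 : D1 ≤ Y) (hY : N < (Y + 1) * (D0 + 1))
    {δ : ℕ} (hδ : Odd δ) {K : ℕ} (hK : K ≠ 0) {e2 g m : ℕ} (he2 : 0 < e2) (hg : 0 < g)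
    (hm : 0 < m) (hKe : e2 ∣ K) :
    |∑ e1 ∈ Ioc 0 Y, if DivisorPair N D0 D1 e1 e2 g m ∧ e1.Coprime K ∧ δ ∣ g * e1 * e2 * m + 1
        then chi4 e1 else 0|
      ≤ if g * e2 ≤ Y ∧ m * e2 ≤ Y then 5 * (#K.divisors : ℝ) else 0 := by
  by_cases hb : g * e2 ≤ Y ∧ m * e2 ≤ Y
  swap
  · rw [if_neg hb, sum_eq_zero, abs_zero]
    intro e1 _
    rw [if_neg]
    rintro ⟨h, _⟩
    exact hb (h.bounds hD1 hY)
  rw [if_pos hb]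
  by_cases h2 : D0 < g * e2 ∧ g * e2 ≤ D1
  swap
  · rw [sum_eq_zero, abs_zero]
    · positivity
    · intro e1 _
      rw [if_neg]
      rintro ⟨h, _⟩
      exact h2 h.2.2.1
  set u := D0 / g
  set v := min (min (D1 / g) Y) (N / (g * e2 * m))
  convert abs_sum_chi4_coprime_dvd_le hδ (g * e2 * m) hK u v using 2
  rw [← sum_filter, ← sum_filter]
  refine sum_congr ?_ fun _ _ => rfl
  ext e1
  have hs : 0 < g * e2 * m := by positivity
  rw [mem_filter, mem_filter]
  simp only [mem_Ioc, u, v, le_min_iff, Nat.div_lt_iff_lt_mul hg,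
    Nat.le_div_iff_mul_le hg, Nat.le_div_iff_mul_le hs, DivisorPair]
  rw [show g * e2 * m * e1 = g * e1 * e2 * m by ring,
    show e1 * (g * e2 * m) = g * e1 * e2 * m by ring,
    show e1 * g = g * e1 by ring]
  constructor
  · rintro ⟨⟨h0, h1⟩, ⟨_, ⟨h3, h4⟩, _, h5⟩, h6, h7⟩
    exact ⟨⟨h3, ⟨h4, h1⟩, h5⟩, h6, h7⟩
  · rintro ⟨⟨h3, ⟨h4, h1⟩, h5⟩, h6, h7⟩
    refine ⟨⟨Nat.pos_of_ne_zero ?_, h1⟩, ⟨h6.coprime_dvd_right hKe, ⟨h3, h4⟩, h2, h5⟩, h6, h7⟩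
    rintro rfl
    simp at h3

theorem card_filter_mul_le {e : ℕ} (he : 0 < e) (Y : ℕ) :
    (#{g ∈ Ioc 0 Y | g * e ≤ Y} : ℝ) ≤ (Y : ℝ) / e := by
  have : ({g ∈ Ioc 0 Y | g * e ≤ Y} : Finset ℕ) ⊆ Ioc 0 (Y / e) := by
    intro g hg
    simp only [mem_filter, mem_Ioc] at hg
    rw [mem_Ioc, Nat.le_div_iff_mul_le he]
    exact ⟨hg.1.1, hg.2⟩
  have h := card_le_card this
  rw [Nat.card_Ioc, Nat.sub_zero] at h
  have h2 : (#{g ∈ Ioc 0 Y | g * e ≤ Y} : ℝ) ≤ ((Y / e : ℕ) : ℝ) := by exact_mod_cast h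
  exact h2.trans Nat.cast_div_le

theorem sum_sum_box_le {e : ℕ} (he : 0 < e) (Y : ℕ) {B : ℝ} (hB : 0 ≤ B) :
    ∑ g ∈ Ioc 0 Y, ∑ m ∈ Ioc 0 Y, (if g * e ≤ Y ∧ m * e ≤ Y then B else 0)
      ≤ B * ((Y : ℝ) ^ 2 / (e : ℝ) ^ 2) := by
  have h1 : ∑ g ∈ Ioc 0 Y, ∑ m ∈ Ioc 0 Y, (if g * e ≤ Y ∧ m * e ≤ Y then B else 0)
      = B * ((#{g ∈ Ioc 0 Y | g * e ≤ Y} : ℝ) * (#{g ∈ Ioc 0 Y | g * e ≤ Y} : ℝ)) := by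
    rw [← sum_boole, sum_mul_sum, mul_sum]
    refine sum_congr rfl fun g _ => ?_
    rw [mul_sum]
    refine sum_congr rfl fun m _ => ?_
    by_cases h : g * e ≤ Y <;> by_cases h' : m * e ≤ Y <;> simp [h, h']
  rw [h1, ← div_pow, sq]
  have := card_filter_mul_le he Y
  gcongr

/-- Divisor-pair sum for a fixed sieving modulus `δ`. -/
def pairSum (N D0 D1 Y δ e2 : ℕ) : ℝ :=
  ∑ g ∈ Ioc 0 Y, ∑ m ∈ Ioc 0 Y, ∑ e1 ∈ Ioc 0 Y,
    if DivisorPair N D0 D1 e1 e2 g m ∧ Odd g ∧ δ ∣ g * e1 * e2 * m + 1 then chi4 e1 else 0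

theorem abs_pairSum_le (hD1 : D1 ≤ Y) (hY : N < (Y + 1) * (D0 + 1)) {δ : ℕ} (hδ : Odd δ)
    {e2 : ℕ} (he2 : 0 < e2) :
    |pairSum N D0 D1 Y δ e2| ≤ 5 * (#e2.divisors : ℝ) * ((Y : ℝ) ^ 2 / (e2 : ℝ) ^ 2) := by
  refine le_trans ?_ (sum_sum_box_le he2 Y (by positivity))
  unfold pairSum
  refine (abs_sum_le_sum_abs _ _).trans (sum_le_sum fun g hg => ?_)
  refine (abs_sum_le_sum_abs _ _).trans (sum_le_sum fun m hm => ?_)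
  have hg0 := (mem_Ioc.1 hg).1
  have hm0 := (mem_Ioc.1 hm).1
  refine le_trans ?_ (abs_sum_divisorPair_left_le hD1 hY hδ he2.ne' he2 hg0 hm0 dvd_rfl)
  by_cases ho : Odd g
  · refine le_of_eq (congrArg _ (sum_congr rfl fun e1 _ => ?_))
    refine if_congr ?_ rfl rfl
    constructor
    · rintro ⟨h, _, h'⟩; exact ⟨h, h.1, h'⟩
    · rintro ⟨h, _, h'⟩; exact ⟨h, ho, h'⟩
  · simp [ho]

theorem abs_card_divisorPair_sub_le {Q2 : ℕ} (hD1 : D1 ≤ Y) (hY : N < (Y + 1) * (D0 + 1))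
    (hQ : D1 ≤ Q2 * D0) {δ : ℕ} (hδ : Odd δ) {e1 e2 m : ℕ} (he1 : 0 < e1) (he2 : 0 < e2)
    (hm : 0 < m) :
    |(#{g ∈ Ioc 0 Y | DivisorPair N D0 D1 e1 e2 g m ∧ Odd g ∧ δ ∣ g * e1 * e2 * m + 1} : ℝ)
      - (if (e1 * e2 * m).Coprime δ then (1 : ℝ) / δ else 0)
        * #{g ∈ Ioc 0 Y | DivisorPair N D0 D1 e1 e2 g m ∧ Odd g}|
      ≤ if m * e2 ≤ Y ∧ e1 ≤ Q2 * e2 then 2 else 0 := by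
  by_cases hb : m * e2 ≤ Y ∧ e1 ≤ Q2 * e2
  swap
  · rw [if_neg hb, filter_eq_empty_iff.2, filter_eq_empty_iff.2]
    · simp
    · rintro g _ ⟨h, _⟩; exact hb ⟨(h.bounds hD1 hY).2, h.left_le hQ⟩
    · rintro g _ ⟨h, _⟩; exact hb ⟨(h.bounds hD1 hY).2, h.left_le hQ⟩
  rw [if_pos hb]
  by_cases hc : e1.Coprime e2
  swap
  · rw [filter_eq_empty_iff.2, filter_eq_empty_iff.2]
    · simp
    · rintro g _ ⟨h, _⟩; exact hc h.1
    · rintro g _ ⟨h, _⟩; exact hc h.1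
  set a := max (D0 / e1) (D0 / e2)
  set b := min (min (D1 / e1) (D1 / e2)) (min Y (N / (e1 * e2 * m)))
  have hs : 0 < e1 * e2 * m := by positivity
  have hab : ∀ g, (g ∈ Ioc 0 Y ∧ DivisorPair N D0 D1 e1 e2 g m) ↔ g ∈ Ioc a b := by
    intro g
    simp only [mem_Ioc, a, b, le_min_iff, max_lt_iff, Nat.div_lt_iff_lt_mul he1,
      Nat.div_lt_iff_lt_mul he2, Nat.le_div_iff_mul_le he1, Nat.le_div_iff_mul_le he2,
      Nat.le_div_iff_mul_le hs, DivisorPair]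
    rw [show g * (e1 * e2 * m) = g * e1 * e2 * m by ring]
    constructor
    · rintro ⟨⟨_, h1⟩, _, ⟨h2, h3⟩, ⟨h4, h5⟩, h6⟩
      exact ⟨⟨h2, h4⟩, ⟨h3, h5⟩, h1, h6⟩
    · rintro ⟨⟨h2, h4⟩, ⟨h3, h5⟩, h1, h6⟩
      refine ⟨⟨Nat.pos_of_ne_zero ?_, h1⟩, hc, ⟨h2, h3⟩, ⟨h4, h5⟩, h6⟩
      rintro rfl
      simp at h2
  have h1 : ({g ∈ Ioc 0 Y | DivisorPair N D0 D1 e1 e2 g m ∧ Odd g ∧ δ ∣ g * e1 * e2 * m + 1}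
      : Finset ℕ) = {g ∈ Ioc a b | Odd g ∧ δ ∣ (e1 * e2 * m) * g + 1} := by
    ext g
    rw [mem_filter, mem_filter, ← hab, show e1 * e2 * m * g = g * e1 * e2 * m by ring]
    tauto
  have h2 : ({g ∈ Ioc 0 Y | DivisorPair N D0 D1 e1 e2 g m ∧ Odd g} : Finset ℕ)
      = {g ∈ Ioc a b | Odd g} := by
    ext g
    rw [mem_filter, mem_filter, ← hab]
    tauto
  rw [h1, h2]
  exact abs_card_odd_dvd_sub_le hδ _ a b

theorem abs_pairSum_le_div_add {Q2 : ℕ} (hD1 : D1 ≤ Y) (hY : N < (Y + 1) * (D0 + 1))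
    (hQ : D1 ≤ Q2 * D0) {δ : ℕ} (hδ : Odd δ) {e2 : ℕ} (he2 : 0 < e2) :
    |pairSum N D0 D1 Y δ e2|
      ≤ 5 * (#(e2 * δ).divisors : ℝ) / δ * ((Y : ℝ) ^ 2 / (e2 : ℝ) ^ 2) + 2 * Q2 * Y := by
  have hδ0 : 0 < δ := hδ.pos
  let κ : ℕ → ℕ → ℝ := fun m e1 => if (e1 * e2 * m).Coprime δ then (1 : ℝ) / δ else 0
  have hmain : pairSum N D0 D1 Y δ e2
      = ∑ m ∈ Ioc 0 Y, ∑ e1 ∈ Ioc 0 Y, chi4 e1 *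
        (#{g ∈ Ioc 0 Y | DivisorPair N D0 D1 e1 e2 g m ∧ Odd g ∧ δ ∣ g * e1 * e2 * m + 1} : ℝ) := by
    unfold pairSum
    rw [sum_comm]
    refine sum_congr rfl fun m _ => ?_
    rw [sum_comm]
    refine sum_congr rfl fun e1 _ => ?_
    rw [← sum_filter, sum_const, nsmul_eq_mul, mul_comm]
  have hsub : ∑ m ∈ Ioc 0 Y, ∑ e1 ∈ Ioc 0 Y, chi4 e1 * (κ m e1 *
        (#{g ∈ Ioc 0 Y | DivisorPair N D0 D1 e1 e2 g m ∧ Odd g} : ℝ))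
      = ∑ g ∈ Ioc 0 Y, ∑ m ∈ Ioc 0 Y, (if Odd g ∧ (e2 * m).Coprime δ then (1 : ℝ) / δ else 0) *
        ∑ e1 ∈ Ioc 0 Y, if DivisorPair N D0 D1 e1 e2 g m ∧ e1.Coprime (e2 * δ)
          ∧ 1 ∣ g * e1 * e2 * m + 1 then chi4 e1 else 0 := by
    rw [sum_comm]
    conv_rhs => rw [sum_comm]
    rw [sum_comm]
    refine sum_congr rfl fun m _ => ?_
    have : ∀ e1, chi4 e1 * (κ m e1 * (#{g ∈ Ioc 0 Y | DivisorPair N D0 D1 e1 e2 g m ∧ Odd g} : ℝ))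
        = ∑ g ∈ Ioc 0 Y, if DivisorPair N D0 D1 e1 e2 g m ∧ Odd g then chi4 e1 * κ m e1 else 0 := by
      intro e1
      rw [← sum_filter, sum_const, nsmul_eq_mul]; ring
    simp_rw [this]
    rw [sum_comm]
    refine sum_congr rfl fun g _ => ?_
    rw [mul_sum]
    refine sum_congr rfl fun e1 _ => ?_
    simp only [κ, one_dvd, and_true]
    by_cases hp : DivisorPair N D0 D1 e1 e2 g m
    · have h1 : e1.Coprime (e2 * δ) ↔ e1.Coprime δ := by
        rw [Nat.coprime_mul_iff_right]
        exact ⟨fun h => h.2, fun h => ⟨hp.1, h⟩⟩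
      have h2 : (e1 * e2 * m).Coprime δ ↔ e1.Coprime δ ∧ (e2 * m).Coprime δ := by
        rw [mul_assoc, Nat.coprime_mul_iff_left]
      simp only [hp, h1, h2, true_and]
      split_ifs <;> first | ring1 | (exfalso; tauto)
    · simp [hp]
  have hA : |∑ m ∈ Ioc 0 Y, ∑ e1 ∈ Ioc 0 Y, chi4 e1 * (κ m e1 *
        (#{g ∈ Ioc 0 Y | DivisorPair N D0 D1 e1 e2 g m ∧ Odd g} : ℝ))|
      ≤ 5 * (#(e2 * δ).divisors : ℝ) / δ * ((Y : ℝ) ^ 2 / (e2 : ℝ) ^ 2) := by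
    rw [hsub]
    refine le_trans ?_ (sum_sum_box_le he2 Y (by positivity))
    refine (abs_sum_le_sum_abs _ _).trans (sum_le_sum fun g hg => ?_)
    refine (abs_sum_le_sum_abs _ _).trans (sum_le_sum fun m hm => ?_)
    have hg0 := (mem_Ioc.1 hg).1
    have hm0 := (mem_Ioc.1 hm).1
    have h := abs_sum_divisorPair_left_le (N := N) (D0 := D0) hD1 hY odd_one
      (mul_ne_zero he2.ne' hδ0.ne') he2 hg0 hm0 (Dvd.intro _ rfl : e2 ∣ e2 * δ)
    rw [abs_mul]
    have h2 : |(if Odd g ∧ (e2 * m).Coprime δ then (1 : ℝ) / δ else 0)| ≤ 1 / δ := by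
      split_ifs
      · rw [abs_of_nonneg (by positivity)]
      · simp
    refine (mul_le_mul h2 h (abs_nonneg _) (by positivity)).trans (le_of_eq ?_)
    split_ifs
    · ring
    · simp
  have hB : |pairSum N D0 D1 Y δ e2 - ∑ m ∈ Ioc 0 Y, ∑ e1 ∈ Ioc 0 Y, chi4 e1 * (κ m e1 *
        (#{g ∈ Ioc 0 Y | DivisorPair N D0 D1 e1 e2 g m ∧ Odd g} : ℝ))| ≤ 2 * Q2 * Y := by
    rw [hmain, ← sum_sub_distrib]
    simp_rw [← sum_sub_distrib, ← mul_sub]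
    calc _ ≤ ∑ m ∈ Ioc 0 Y, ∑ e1 ∈ Ioc 0 Y, (if m * e2 ≤ Y ∧ e1 ≤ Q2 * e2 then (2 : ℝ) else 0) := by
          refine (abs_sum_le_sum_abs _ _).trans (sum_le_sum fun m hm => ?_)
          refine (abs_sum_le_sum_abs _ _).trans (sum_le_sum fun e1 he1 => ?_)
          rw [abs_mul]
          have h := abs_card_divisorPair_sub_le hD1 hY hQ hδ (mem_Ioc.1 he1).1 he2 (mem_Ioc.1 hm).1
          have := mul_le_mul (abs_chi4_le_one e1) h (abs_nonneg _) zero_le_one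
          rwa [one_mul] at this
      _ = 2 * ((#{m ∈ Ioc 0 Y | m * e2 ≤ Y} : ℝ) * (#{e1 ∈ Ioc 0 Y | e1 ≤ Q2 * e2} : ℝ)) := by
          rw [← sum_boole, ← sum_boole, sum_mul_sum, mul_sum]
          refine sum_congr rfl fun g _ => ?_
          rw [mul_sum]
          refine sum_congr rfl fun m _ => ?_
          by_cases h : g * e2 ≤ Y <;> by_cases h' : m ≤ Q2 * e2 <;> simp [h, h']
      _ ≤ 2 * ((Y : ℝ) / e2 * (Q2 * e2)) := by
          have h1 := card_filter_mul_le he2 Y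
          have h2 : (#{e1 ∈ Ioc 0 Y | e1 ≤ Q2 * e2} : ℝ) ≤ Q2 * e2 := by
            have : ({e1 ∈ Ioc 0 Y | e1 ≤ Q2 * e2} : Finset ℕ) ⊆ Ioc 0 (Q2 * e2) := by
              intro x hx
              simp only [mem_filter, mem_Ioc] at hx ⊢
              exact ⟨hx.1.1, hx.2⟩
            have h := card_le_card this
            rw [Nat.card_Ioc, Nat.sub_zero] at h
            exact_mod_cast h
          gcongr
      _ = _ := by
          have : (e2 : ℝ) ≠ 0 := by exact_mod_cast he2.ne'
          field_simp
  have := abs_le.1 hA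
  have := abs_le.1 hB
  rw [abs_le]
  constructor <;> linarith

end

theorem sum_Ioc_one_div_le_log_sub_log {a b : ℕ} (ha : 1 ≤ a) (hab : a ≤ b) :
    ∑ g ∈ Ioc a b, (1 : ℝ) / g ≤ Real.log b - Real.log a := by
  induction b, hab using Nat.le_induction with
  | base => simp
  | succ b hb ih =>
    rw [sum_Ioc_succ_top hb]
    have hb0 : (0 : ℝ) < b := by exact_mod_cast (by omega : 0 < b)
    have h := Real.log_le_sub_one_of_pos (show (0 : ℝ) < b / (b + 1) by positivity)
    rw [Real.log_div hb0.ne' (by positivity)] at h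
    have h2 : (b : ℝ) / (b + 1) - 1 = -(1 / (b + 1)) := by field_simp; ring
    push_cast
    linarith

theorem sum_Ioc_one_div_le {a b Q : ℕ} (hQ : 1 ≤ Q) (hb : b ≤ Q * (a + 1)) :
    ∑ g ∈ Ioc a b, (1 : ℝ) / g ≤ 1 + Real.log Q := by
  have hlogQ : 0 ≤ Real.log Q := Real.log_nonneg (by exact_mod_cast hQ)
  rcases le_or_gt b a with h | h
  · rw [Ioc_eq_empty (by omega)]; simp; linarith
  · rw [← sum_Ioc_consecutive _ (show a ≤ a + 1 by omega) (show a + 1 ≤ b by omega)]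
    have h1 := sum_Ioc_one_div_le_log_sub_log (show 1 ≤ a + 1 by omega) (show a + 1 ≤ b by omega)
    have h2 : ∑ g ∈ Ioc a (a + 1), (1 : ℝ) / g ≤ 1 := by
      rw [Nat.Ioc_succ_singleton, sum_singleton, div_le_one (by positivity)]
      push_cast
      linarith [(Nat.cast_nonneg a : (0 : ℝ) ≤ a)]
    have h3 : Real.log b ≤ Real.log Q + Real.log (a + 1 : ℕ) := by
      rw [← Real.log_mul (by positivity) (by positivity)]
      exact Real.log_le_log (by exact_mod_cast (by omega : 0 < b)) (by exact_mod_cast hb)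
    linarith

theorem sum_brunWeight_dvd_mul_add_one_le (P : Finset ℕ) (hP : ∀ q ∈ P, q.Prime) (R k M : ℕ)
    {b Z : ℝ} (hb : ∑ q ∈ P with q ∣ k, (1 : ℝ) / q ≤ b) (hZ : 1 ≤ Z) (hPZ : (#P : ℝ) ≤ Z) :
    ∑ m ∈ Ioc 0 M, brunWeight P R (fun q => q ∣ k * m + 1)
      ≤ M * (Real.exp (b - ∑ q ∈ P, (1 : ℝ) / q) + Real.exp (3 * ∑ q ∈ P, (1 : ℝ) / q - R))
        + 3 * Z ^ R := by
  set Ω : ℕ → Finset ℕ := fun q => {c ∈ range q | q ∣ k * c + 1}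
  have hΩ : ∀ q ∈ P, #(Ω q) = if q ∣ k then 0 else 1 := by
    intro q hq
    have hq0 := (hP q hq).pos
    split_ifs with h
    · rw [card_eq_zero, filter_eq_empty_iff]
      rintro c _ hc
      have := (Nat.dvd_add_right (h.mul_right c)).1 hc
      exact (hP q hq).one_lt.ne' (Nat.dvd_one.1 this)
    · rw [card_eq_one]
      have : NeZero q := ⟨hq0.ne'⟩
      have hk : k.Coprime q := ((Nat.Prime.coprime_iff_not_dvd (hP q hq)).2 h).symm
      refine ⟨(-(k : ZMod q)⁻¹).val, ?_⟩
      have hsol : q ∣ k * (-(k : ZMod q)⁻¹).val + 1 := by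
        rw [← ZMod.natCast_eq_zero_iff]
        push_cast
        rw [ZMod.natCast_val, ZMod.cast_id', id_eq, mul_neg, ZMod.coe_mul_inv_eq_one k hk]
        ring
      ext c
      simp only [Ω, mem_filter, mem_range, mem_singleton]
      constructor
      · rintro ⟨hc, hd⟩
        have := modEq_of_dvd_mul_add_one hd hsol
        exact Nat.ModEq.eq_of_lt_of_lt this hc (ZMod.val_lt _)
      · rintro rfl
        exact ⟨ZMod.val_lt _, hsol⟩
  have hcongr : ∀ m, brunWeight P R (fun q => q ∣ k * m + 1)
      = brunWeight P R (fun q => m % q ∈ Ω q) := by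
    intro m
    refine brunWeight_congr R fun q hq => ?_
    have hq0 := (hP q hq).pos
    simp only [Ω, mem_filter, mem_range, Nat.mod_lt _ hq0, true_and]
    have : k * m + 1 ≡ k * (m % q) + 1 [MOD q] :=
      ((Nat.mod_modEq m q).symm.mul_left k).add_right 1
    rw [← Nat.modEq_zero_iff_dvd, ← Nat.modEq_zero_iff_dvd]
    exact ⟨fun h => this.symm.trans h, fun h => this.trans h⟩
  simp_rw [hcongr]
  have hcardle : ∀ q ∈ P, (#(Ω q) : ℝ) ≤ 1 := by
    intro q hq
    rw [hΩ q hq]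
    split_ifs <;> simp
  have hZΩ : ∑ q ∈ P, (#(Ω q) : ℝ) ≤ Z := by
    refine (sum_le_sum hcardle).trans ?_
    simpa using hPZ
  refine (sum_brunWeight_le P hP R Ω (fun q _ => filter_subset _ _) (Nat.zero_le M) hZ hZΩ).trans ?_
  have h1 : ∑ q ∈ P, (#(Ω q) : ℝ) / q
      = ∑ q ∈ P, (1 : ℝ) / q - ∑ q ∈ P with q ∣ k, (1 : ℝ) / q := by
    rw [sum_filter, ← sum_sub_distrib]
    refine sum_congr rfl fun q hq => ?_
    rw [hΩ q hq]
    split_ifs <;> simp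
  have h2 : 0 ≤ ∑ q ∈ P with q ∣ k, (1 : ℝ) / q := sum_nonneg fun _ _ => by positivity
  rw [h1, Nat.cast_zero, sub_zero]
  have h3 : Real.exp (-(∑ q ∈ P, (1 : ℝ) / q - ∑ q ∈ P with q ∣ k, (1 : ℝ) / q))
      ≤ Real.exp (b - ∑ q ∈ P, (1 : ℝ) / q) := Real.exp_le_exp.2 (by linarith)
  have h4 : Real.exp (3 * (∑ q ∈ P, (1 : ℝ) / q - ∑ q ∈ P with q ∣ k, (1 : ℝ) / q) - R)
      ≤ Real.exp (3 * ∑ q ∈ P, (1 : ℝ) / q - R) := Real.exp_le_exp.2 (by linarith)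
  gcongr

theorem card_divisors_mul_le (a b : ℕ) : #(a * b).divisors ≤ #a.divisors * #b.divisors := by
  rw [Nat.divisors_mul]
  exact card_mul_le

theorem card_divisors_prod_le (T : Finset ℕ) (hT : ∀ q ∈ T, q.Prime) :
    #(∏ q ∈ T, q).divisors ≤ 2 ^ #T := by
  induction T using Finset.induction_on with
  | empty => simp
  | insert q T hq ih =>
    rw [prod_insert hq, card_insert_of_notMem hq, pow_succ']
    refine (card_divisors_mul_le _ _).trans (Nat.mul_le_mul ?_ ?_)
    · rw [(hT q (mem_insert_self q T)).divisors]; exact card_le_two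
    · exact ih fun p hp => hT p (mem_insert_of_mem hp)

theorem forall_dvd_iff_prod_dvd (T : Finset ℕ) (hT : ∀ q ∈ T, q.Prime) (n : ℕ) :
    (∀ q ∈ T, q ∣ n) ↔ ∏ q ∈ T, q ∣ n :=
  ⟨fun h => prod_primes_dvd n (fun q hq => (hT q hq).prime) h,
    fun h _ hq => (dvd_prod_of_mem _ hq).trans h⟩

theorem sum_powerset_prod_le_exp (P : Finset ℕ) {f : ℕ → ℝ} (hf : ∀ q ∈ P, 0 ≤ f q) :
    ∑ T ∈ P.powerset, ∏ q ∈ T, f q ≤ Real.exp (∑ q ∈ P, f q) := by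
  rw [← prod_one_add, Real.exp_sum]
  refine prod_le_prod (fun q hq => by linarith [hf q hq]) fun q _ => ?_
  linarith [Real.add_one_le_exp (f q)]

/-- The part of `∑ ρ(n)² w(n)` with second reduced divisor `e₂`. -/
def reducedSum (N D0 D1 Y : ℕ) (w : ℕ → ℝ) (e2 : ℕ) : ℝ :=
  ∑ g ∈ Ioc 0 Y, ∑ m ∈ Ioc 0 Y, ∑ e1 ∈ Ioc 0 Y,
    if DivisorPair N D0 D1 e1 e2 g m ∧ Odd g then chi4 e1 * chi4 e2 * w (g * e1 * e2 * m) else 0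

/-- The restricted character sum over divisors of `n` in `(D₀, D₁]`. -/
def rho (D0 D1 n : ℕ) : ℝ := ∑ d ∈ Ioc D0 D1, if d ∣ n then chi4 d else 0

theorem sum_rho_sq_mul_eq {N D0 D1 Y : ℕ} (hD1 : D1 ≤ Y) (hY : N < (Y + 1) * (D0 + 1))
    (w : ℕ → ℝ) :
    ∑ n ∈ Ioc 0 N, rho D0 D1 n ^ 2 * w n = ∑ e2 ∈ Ioc 0 Y, reducedSum N D0 D1 Y w e2 := by
  have h1 : ∀ n, rho D0 D1 n ^ 2 * w n = ∑ d1 ∈ Ioc D0 D1, ∑ d2 ∈ Ioc D0 D1,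
      if d1 ∣ n ∧ d2 ∣ n then chi4 d1 * chi4 d2 * w n else 0 := by
    intro n
    rw [sq, rho, sum_mul_sum, sum_mul]
    refine sum_congr rfl fun d1 _ => ?_
    rw [sum_mul]
    refine sum_congr rfl fun d2 _ => ?_
    split_ifs <;> first | ring1 | (exfalso; tauto)
  have h2 : ∑ n ∈ Ioc 0 N, rho D0 D1 n ^ 2 * w n
      = ∑ x ∈ (Ioc 0 N ×ˢ Ioc D0 D1 ×ˢ Ioc D0 D1).filter (fun x => x.2.1 ∣ x.1 ∧ x.2.2 ∣ x.1),
        chi4 x.2.1 * chi4 x.2.2 * w x.1 := by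
    rw [sum_filter, sum_product]
    refine sum_congr rfl fun n _ => ?_
    rw [h1, sum_product]
  have h3 : ∑ e2 ∈ Ioc 0 Y, reducedSum N D0 D1 Y w e2
      = ∑ x ∈ (Ioc 0 Y ×ˢ Ioc 0 Y ×ˢ Ioc 0 Y ×ˢ Ioc 0 Y).filter
          (fun x => DivisorPair N D0 D1 x.2.2.2 x.1 x.2.1 x.2.2.1),
        chi4 (x.2.1 * x.2.2.2) * chi4 (x.2.1 * x.1) * w (x.2.1 * x.2.2.2 * x.1 * x.2.2.1) := by
    rw [sum_filter, sum_product]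
    refine sum_congr rfl fun e2 _ => ?_
    rw [sum_product, reducedSum]
    refine sum_congr rfl fun g _ => ?_
    rw [sum_product]
    refine sum_congr rfl fun m _ => sum_congr rfl fun e1 _ => ?_
    dsimp only
    have h := chi4_mul_self g
    rw [chi4_mul, chi4_mul]
    by_cases hp : DivisorPair N D0 D1 e1 e2 g m
    · by_cases ho : Odd g
      · rw [if_pos ho] at h
        rw [if_pos ⟨hp, ho⟩, if_pos hp]
        linear_combination (-(chi4 e1 * chi4 e2 * w (g * e1 * e2 * m))) * h
      · rw [if_neg ho] at h
        rw [if_neg (fun h => ho h.2), if_pos hp]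
        linear_combination (-(chi4 e1 * chi4 e2 * w (g * e1 * e2 * m))) * h
    · rw [if_neg (fun h => hp h.1), if_neg hp]
  rw [h2, h3]
  refine sum_nbij' (fun x => (x.2.2 / Nat.gcd x.2.1 x.2.2, Nat.gcd x.2.1 x.2.2,
      x.1 / Nat.lcm x.2.1 x.2.2, x.2.1 / Nat.gcd x.2.1 x.2.2))
    (fun x => (x.2.1 * x.2.2.2 * x.1 * x.2.2.1, x.2.1 * x.2.2.2, x.2.1 * x.1)) ?_ ?_ ?_ ?_ ?_
  · rintro ⟨n, d1, d2⟩ hx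
    simp only [mem_filter, mem_product, mem_Ioc] at hx
    obtain ⟨⟨⟨hn0, hnN⟩, ⟨h1a, h1b⟩, ⟨h2a, h2b⟩⟩, hd1, hd2⟩ := hx
    have hd1p : 0 < d1 := by omega
    have hd2p : 0 < d2 := by omega
    have hgp : 0 < Nat.gcd d1 d2 := Nat.gcd_pos_of_pos_left _ hd1p
    have hg1 := Nat.gcd_dvd_left d1 d2
    have hg2 := Nat.gcd_dvd_right d1 d2
    have hl : Nat.lcm d1 d2 ∣ n := Nat.lcm_dvd hd1 hd2
    have e1 : Nat.gcd d1 d2 * (d1 / Nat.gcd d1 d2) = d1 := Nat.mul_div_cancel' hg1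
    have e2 : Nat.gcd d1 d2 * (d2 / Nat.gcd d1 d2) = d2 := Nat.mul_div_cancel' hg2
    have hlcm : d1 * (d2 / Nat.gcd d1 d2) = Nat.lcm d1 d2 := by
      rw [Nat.lcm, Nat.mul_div_assoc _ hg2]
    have hprod : Nat.gcd d1 d2 * (d1 / Nat.gcd d1 d2) * (d2 / Nat.gcd d1 d2)
        * (n / Nat.lcm d1 d2) = n := by
      rw [e1, hlcm, Nat.mul_div_cancel' hl]
    have hDP : DivisorPair N D0 D1 (d1 / Nat.gcd d1 d2) (d2 / Nat.gcd d1 d2) (Nat.gcd d1 d2)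
        (n / Nat.lcm d1 d2) := by
      refine ⟨Nat.coprime_div_gcd_div_gcd hgp, ?_, ?_, ?_⟩
      · rw [e1]; exact ⟨h1a, h1b⟩
      · rw [e2]; exact ⟨h2a, h2b⟩
      · rw [hprod]; exact hnN
    have hb := hDP.bounds hD1 hY
    simp only [mem_filter, mem_product, mem_Ioc]
    have hp1 : 0 < d1 / Nat.gcd d1 d2 := Nat.div_pos (Nat.le_of_dvd hd1p hg1) hgp
    have hp2 : 0 < d2 / Nat.gcd d1 d2 := Nat.div_pos (Nat.le_of_dvd hd2p hg2) hgp
    refine ⟨⟨⟨hp2, ?_⟩, ⟨hgp, ?_⟩, ⟨?_, ?_⟩, ⟨hp1, ?_⟩⟩, hDP⟩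
    · exact (Nat.div_le_self _ _).trans (h2b.trans hD1)
    · exact (Nat.le_of_dvd hd1p hg1).trans (h1b.trans hD1)
    · exact Nat.div_pos (Nat.le_of_dvd hn0 hl) (Nat.lcm_pos hd1p hd2p)
    · exact (Nat.le_mul_of_pos_right _ hp2).trans hb.2
    · exact (Nat.div_le_self _ _).trans (h1b.trans hD1)
  · rintro ⟨e2, g, m, e1⟩ hx
    simp only [mem_filter, mem_product, mem_Ioc] at hx ⊢
    obtain ⟨⟨⟨_, _⟩, ⟨_, _⟩, ⟨_, _⟩, ⟨_, _⟩⟩, _, h1, h2, h3⟩ := hx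
    refine ⟨⟨⟨by positivity, h3⟩, h1, h2⟩, ?_, ?_⟩
    · exact ⟨e2 * m, by ring⟩
    · exact ⟨e1 * m, by ring⟩
  · rintro ⟨n, d1, d2⟩ hx
    simp only [mem_filter, mem_product, mem_Ioc] at hx
    obtain ⟨_, hd1, hd2⟩ := hx
    have hg1 := Nat.gcd_dvd_left d1 d2
    have hg2 := Nat.gcd_dvd_right d1 d2
    have hl : Nat.lcm d1 d2 ∣ n := Nat.lcm_dvd hd1 hd2
    have hlcm : d1 * (d2 / Nat.gcd d1 d2) = Nat.lcm d1 d2 := by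
      rw [Nat.lcm, Nat.mul_div_assoc _ hg2]
    dsimp only
    rw [Nat.mul_div_cancel' hg1, Nat.mul_div_cancel' hg2, hlcm, Nat.mul_div_cancel' hl]
  · rintro ⟨e2, g, m, e1⟩ hx
    simp only [mem_filter, mem_product, mem_Ioc] at hx
    obtain ⟨⟨⟨he2, _⟩, ⟨hg, _⟩, ⟨hm, _⟩, ⟨he1, _⟩⟩, hc, h1, h2, h3⟩ := hx
    have hgcd : Nat.gcd (g * e1) (g * e2) = g := by
      rw [Nat.gcd_mul_left, hc.gcd_eq_one, mul_one]
    have hlcm : Nat.lcm (g * e1) (g * e2) = g * e1 * e2 := by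
      rw [Nat.lcm_mul_left, hc.lcm_eq_mul, mul_assoc]
    dsimp only
    rw [hgcd, hlcm, Nat.mul_div_cancel_left _ hg, Nat.mul_div_cancel_left _ hg,
      Nat.mul_div_cancel_left _ (by positivity)]
  · rintro ⟨n, d1, d2⟩ hx
    simp only [mem_filter, mem_product, mem_Ioc] at hx
    obtain ⟨_, hd1, hd2⟩ := hx
    have hg1 := Nat.gcd_dvd_left d1 d2
    have hg2 := Nat.gcd_dvd_right d1 d2
    have hl : Nat.lcm d1 d2 ∣ n := Nat.lcm_dvd hd1 hd2
    have hlcm : d1 * (d2 / Nat.gcd d1 d2) = Nat.lcm d1 d2 := by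
      rw [Nat.lcm, Nat.mul_div_assoc _ hg2]
    dsimp only
    rw [Nat.mul_div_cancel' hg1, Nat.mul_div_cancel' hg2, hlcm, Nat.mul_div_cancel' hl]

section

variable {N D0 D1 Y : ℕ}

theorem reducedSum_brunWeight_eq (P : Finset ℕ) (hP : ∀ q ∈ P, q.Prime) (R e2 : ℕ) :
    reducedSum N D0 D1 Y (fun n => brunWeight P R (fun q => q ∣ n + 1)) e2
      = ∑ T ∈ P.powerset with #T ≤ R, (-1 : ℝ) ^ #T * chi4 e2 *
          pairSum N D0 D1 Y (∏ q ∈ T, q) e2 := by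
  have h : ∀ e1 g m : ℕ, (if DivisorPair N D0 D1 e1 e2 g m ∧ Odd g then
        chi4 e1 * chi4 e2 * brunWeight P R (fun q => q ∣ g * e1 * e2 * m + 1) else 0)
      = ∑ T ∈ P.powerset with #T ≤ R, (-1 : ℝ) ^ #T * chi4 e2 *
        if DivisorPair N D0 D1 e1 e2 g m ∧ Odd g ∧ (∏ q ∈ T, q) ∣ g * e1 * e2 * m + 1
          then chi4 e1 else 0 := by
    intro e1 g m
    by_cases hp : DivisorPair N D0 D1 e1 e2 g m ∧ Odd g
    · rw [if_pos hp, brunWeight_def, mul_sum]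
      refine sum_congr rfl fun T hT => ?_
      rw [mem_filter, mem_powerset] at hT
      have h1 := forall_dvd_iff_prod_dvd T (fun q hq => hP q (hT.1 hq)) (g * e1 * e2 * m + 1)
      simp only [h1, hp, true_and]
      split_ifs <;> ring
    · rw [if_neg hp, sum_eq_zero]
      intro T _
      rw [if_neg (fun h => hp ⟨h.1, h.2.1⟩), mul_zero]
  unfold reducedSum pairSum
  simp_rw [h, mul_sum]
  symm
  rw [sum_comm]
  refine sum_congr rfl fun g _ => ?_
  rw [sum_comm]
  refine sum_congr rfl fun m _ => ?_
  rw [sum_comm]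

end

section

variable {N D0 D1 Y : ℕ}

theorem abs_reducedSum_le (P : Finset ℕ) (hP : ∀ q ∈ P, q.Prime) (R e2 : ℕ) :
    |reducedSum N D0 D1 Y (fun n => brunWeight P R (fun q => q ∣ n + 1)) e2|
      ≤ ∑ T ∈ P.powerset with #T ≤ R, |pairSum N D0 D1 Y (∏ q ∈ T, q) e2| := by
  rw [reducedSum_brunWeight_eq P hP]
  refine (abs_sum_le_sum_abs _ _).trans (sum_le_sum fun T _ => ?_)
  rw [abs_mul, abs_mul, abs_pow, abs_neg, abs_one, one_pow, one_mul]
  exact mul_le_of_le_one_left (abs_nonneg _) (abs_chi4_le_one e2)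

theorem card_powerset_filter_le (P : Finset ℕ) (R : ℕ) {Z : ℝ} (hZ : 1 ≤ Z) (hPZ : (#P : ℝ) ≤ Z) :
    (#{T ∈ P.powerset | #T ≤ R} : ℝ) ≤ 3 * Z ^ R := by
  have := sum_powerset_card_le_prod_le P R (ω := fun _ => 1) (fun _ _ => zero_le_one) hZ
    (by simpa using hPZ)
  simpa using this

theorem odd_prod_of_subset {P T : Finset ℕ} (hP : ∀ q ∈ P, Odd q) (hT : T ⊆ P) :
    Odd (∏ q ∈ T, q) := by
  refine Finset.prod_induction _ Odd (fun _ _ => Odd.mul) odd_one fun q hq => hP q (hT hq)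

theorem abs_reducedSum_le_of_large (hD1 : D1 ≤ Y) (hY : N < (Y + 1) * (D0 + 1)) (P : Finset ℕ)
    (hP : ∀ q ∈ P, q.Prime) (hodd : ∀ q ∈ P, Odd q) (R : ℕ) {Z : ℝ} (hZ : 1 ≤ Z)
    (hPZ : (#P : ℝ) ≤ Z) {e2 : ℕ} (he2 : 0 < e2) :
    |reducedSum N D0 D1 Y (fun n => brunWeight P R (fun q => q ∣ n + 1)) e2|
      ≤ 3 * Z ^ R * (5 * Y ^ 2) * ((#e2.divisors : ℝ) / (e2 : ℝ) ^ 2) := by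
  refine (abs_reducedSum_le P hP R e2).trans ?_
  calc _ ≤ ∑ T ∈ P.powerset with #T ≤ R,
        5 * (#e2.divisors : ℝ) * ((Y : ℝ) ^ 2 / (e2 : ℝ) ^ 2) := by
        refine sum_le_sum fun T hT => ?_
        rw [mem_filter, mem_powerset] at hT
        exact abs_pairSum_le hD1 hY (odd_prod_of_subset hodd hT.1) he2
    _ = (#{T ∈ P.powerset | #T ≤ R} : ℝ)
          * (5 * (#e2.divisors : ℝ) * ((Y : ℝ) ^ 2 / (e2 : ℝ) ^ 2)) := by
        rw [sum_const, nsmul_eq_mul]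
    _ ≤ 3 * Z ^ R * (5 * (#e2.divisors : ℝ) * ((Y : ℝ) ^ 2 / (e2 : ℝ) ^ 2)) := by
        gcongr
        exact card_powerset_filter_le P R hZ hPZ
    _ = _ := by ring

theorem abs_reducedSum_le_of_medium {Q2 : ℕ} (hD1 : D1 ≤ Y) (hY : N < (Y + 1) * (D0 + 1))
    (hQ : D1 ≤ Q2 * D0) (P : Finset ℕ)
    (hP : ∀ q ∈ P, q.Prime) (hodd : ∀ q ∈ P, Odd q) (R : ℕ) {Z : ℝ} (hZ : 1 ≤ Z)
    (hPZ : (#P : ℝ) ≤ Z) {e2 : ℕ} (he2 : 0 < e2) :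
    |reducedSum N D0 D1 Y (fun n => brunWeight P R (fun q => q ∣ n + 1)) e2|
      ≤ Real.exp (2 * ∑ q ∈ P, (1 : ℝ) / q) * (5 * Y ^ 2) * ((#e2.divisors : ℝ) / (e2 : ℝ) ^ 2)
        + 3 * Z ^ R * (2 * Q2 * Y) := by
  refine (abs_reducedSum_le P hP R e2).trans ?_
  calc _ ≤ ∑ T ∈ P.powerset with #T ≤ R,
        ((∏ q ∈ T, (2 / q : ℝ)) * ((5 * Y ^ 2) * ((#e2.divisors : ℝ) / (e2 : ℝ) ^ 2))
          + 2 * Q2 * Y) := by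
        refine sum_le_sum fun T hT => ?_
        rw [mem_filter, mem_powerset] at hT
        refine (abs_pairSum_le_div_add hD1 hY hQ (odd_prod_of_subset hodd hT.1) he2).trans ?_
        refine add_le_add ?_ le_rfl
        have h1 : (#(e2 * ∏ q ∈ T, q).divisors : ℝ) ≤ #e2.divisors * 2 ^ #T := by
          have := (card_divisors_mul_le e2 (∏ q ∈ T, q)).trans
            (Nat.mul_le_mul_left _ (card_divisors_prod_le T fun q hq => hP q (hT.1 hq)))
          exact_mod_cast this
        rw [prod_div_distrib, prod_const]
        push_cast
        have h0 : (0 : ℝ) < ∏ q ∈ T, (q : ℝ) :=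
          prod_pos fun q hq => by exact_mod_cast (hP q (hT.1 hq)).pos
        calc _ ≤ 5 * ((#e2.divisors : ℝ) * 2 ^ #T) / (∏ q ∈ T, (q : ℝ))
              * ((Y : ℝ) ^ 2 / (e2 : ℝ) ^ 2) := by gcongr
          _ = _ := by ring
    _ = (∑ T ∈ P.powerset with #T ≤ R, ∏ q ∈ T, (2 / q : ℝ))
          * ((5 * Y ^ 2) * ((#e2.divisors : ℝ) / (e2 : ℝ) ^ 2))
          + (#{T ∈ P.powerset | #T ≤ R} : ℝ) * (2 * Q2 * Y) := by
        rw [sum_add_distrib, sum_mul, sum_const, nsmul_eq_mul]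
    _ ≤ Real.exp (2 * ∑ q ∈ P, (1 : ℝ) / q) * ((5 * Y ^ 2) * ((#e2.divisors : ℝ) / (e2 : ℝ) ^ 2))
          + 3 * Z ^ R * (2 * Q2 * Y) := by
        gcongr
        · calc _ ≤ ∑ T ∈ P.powerset, ∏ q ∈ T, (2 / q : ℝ) :=
                sum_le_sum_of_subset_of_nonneg (filter_subset _ _)
                  fun _ _ _ => prod_nonneg fun _ _ => by positivity
            _ ≤ Real.exp (∑ q ∈ P, (2 / q : ℝ)) :=
                sum_powerset_prod_le_exp P fun _ _ => by positivity
            _ = _ := by rw [mul_sum]; simp_rw [mul_one_div]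
        · exact card_powerset_filter_le P R hZ hPZ
    _ = _ := by ring

theorem abs_reducedSum_le_of_small {Q2 : ℕ} (hD1 : D1 ≤ Y)
    (hQ2 : 1 ≤ Q2) (hQ : D1 ≤ Q2 * D0) (P : Finset ℕ) (hP : ∀ q ∈ P, q.Prime) {R : ℕ} (hR : Even R)
    {Z : ℝ} (hZ : 1 ≤ Z) (hPZ : (#P : ℝ) ≤ Z) {b : ℝ}
    (hb : ∀ k, 0 < k → k ≤ N → ∑ q ∈ P with q ∣ k, (1 : ℝ) / q ≤ b) {e2 : ℕ} (he2 : 0 < e2) :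
    |reducedSum N D0 D1 Y (fun n => brunWeight P R (fun q => q ∣ n + 1)) e2|
      ≤ N * (Real.exp (b - ∑ q ∈ P, (1 : ℝ) / q) + Real.exp (3 * ∑ q ∈ P, (1 : ℝ) / q - R))
          * ((1 + Real.log (Q2 * e2)) * (1 + Real.log Q2)) * (1 / e2)
        + 3 * Z ^ R * (Q2 * Y) := by
  set κ := Real.exp (b - ∑ q ∈ P, (1 : ℝ) / q) + Real.exp (3 * ∑ q ∈ P, (1 : ℝ) / q - R)
  set W : ℕ → ℝ := fun n => brunWeight P R (fun q => q ∣ n + 1)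
  have hW : ∀ n, 0 ≤ W n := fun n => brunWeight_nonneg P hR _
  have hκ : 0 ≤ κ := by positivity
  have hsieve : ∀ k, 0 < k → ∑ m ∈ Ioc 0 (N / k), W (k * m) ≤ N * κ * (1 / k) + 3 * Z ^ R := by
    intro k hk
    rcases le_or_gt k N with hkN | hkN
    · refine (sum_brunWeight_dvd_mul_add_one_le P hP R k (N / k) (hb k hk hkN) hZ hPZ).trans ?_
      have : ((N / k : ℕ) : ℝ) ≤ N / k := Nat.cast_div_le
      have h2 : ((N / k : ℕ) : ℝ) * κ ≤ N / k * κ := by gcongr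
      calc _ ≤ (N : ℝ) / k * κ + 3 * Z ^ R := by gcongr
        _ = _ := by ring
    · rw [Nat.div_eq_of_lt hkN]
      simp only [Ioc_self, sum_empty]
      positivity
  have hstep : |reducedSum N D0 D1 Y W e2|
      ≤ ∑ g ∈ Ioc (D0 / e2) (D1 / e2), ∑ e1 ∈ Ioc 0 (Q2 * e2),
        ∑ m ∈ Ioc 0 (N / (g * e1 * e2)), W (g * e1 * e2 * m) := by
    have h1 : |reducedSum N D0 D1 Y W e2| ≤ ∑ x ∈ Ioc 0 Y ×ˢ Ioc 0 Y ×ˢ Ioc 0 Y,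
        if DivisorPair N D0 D1 x.2.1 e2 x.1 x.2.2 then W (x.1 * x.2.1 * e2 * x.2.2) else 0 := by
      unfold reducedSum
      rw [sum_product]
      refine (abs_sum_le_sum_abs _ _).trans (sum_le_sum fun g _ => ?_)
      rw [sum_product, sum_comm]
      refine (abs_sum_le_sum_abs _ _).trans (sum_le_sum fun m _ => ?_)
      refine (abs_sum_le_sum_abs _ _).trans (sum_le_sum fun e1 _ => ?_)
      by_cases hp : DivisorPair N D0 D1 m e2 g e1
      · simp only [hp, true_and, if_true]
        split_ifs
        · rw [abs_mul, abs_mul, abs_of_nonneg (hW _)]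
          refine mul_le_of_le_one_left (hW _) ?_
          exact mul_le_one₀ (abs_chi4_le_one _) (abs_nonneg _) (abs_chi4_le_one _)
        · rw [abs_zero]; exact hW _
      · simp [hp]
    refine h1.trans ?_
    rw [← sum_filter]
    have h2 : ∑ g ∈ Ioc (D0 / e2) (D1 / e2), ∑ e1 ∈ Ioc 0 (Q2 * e2),
        ∑ m ∈ Ioc 0 (N / (g * e1 * e2)), W (g * e1 * e2 * m)
      = ∑ x ∈ (Ioc (D0 / e2) (D1 / e2) ×ˢ Ioc 0 (Q2 * e2) ×ˢ Ioc 0 N).filter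
          (fun x => x.2.2 ≤ N / (x.1 * x.2.1 * e2)), W (x.1 * x.2.1 * e2 * x.2.2) := by
      rw [sum_filter, sum_product]
      refine sum_congr rfl fun g _ => ?_
      rw [sum_product]
      refine sum_congr rfl fun e1 _ => ?_
      rw [← sum_filter]
      refine sum_congr ?_ fun _ _ => rfl
      ext m
      simp only [mem_filter, mem_Ioc]
      have := Nat.div_le_self N (g * e1 * e2)
      constructor
      · rintro ⟨h1, h2⟩; exact ⟨⟨h1, h2.trans this⟩, h2⟩
      · rintro ⟨⟨h1, _⟩, h2⟩; exact ⟨h1, h2⟩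
    rw [h2]
    refine sum_le_sum_of_subset_of_nonneg ?_ fun _ _ _ => hW _
    rintro ⟨g, e1, m⟩ hx
    simp only [mem_filter, mem_product, mem_Ioc] at hx ⊢
    obtain ⟨⟨⟨hg, _⟩, ⟨he1, _⟩, ⟨hm, _⟩⟩, hp⟩ := hx
    have hk : 0 < g * e1 * e2 := by positivity
    have hmk : m ≤ N / (g * e1 * e2) := by
      rw [Nat.le_div_iff_mul_le hk, mul_comm]; exact hp.2.2.2
    refine ⟨⟨⟨?_, ?_⟩, ⟨he1, hp.left_le hQ⟩, hm, hmk.trans (Nat.div_le_self _ _)⟩, hmk⟩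
    · rw [Nat.div_lt_iff_lt_mul he2]; exact hp.2.2.1.1
    · rw [Nat.le_div_iff_mul_le he2]; exact hp.2.2.1.2
  refine hstep.trans ?_
  calc _ ≤ ∑ g ∈ Ioc (D0 / e2) (D1 / e2), ∑ e1 ∈ Ioc 0 (Q2 * e2),
        (N * κ * (1 / (g * e1 * e2 : ℕ)) + 3 * Z ^ R) := by
        refine sum_le_sum fun g hg => sum_le_sum fun e1 he1 => hsieve _ ?_
        have := (mem_Ioc.1 hg).1
        have := (mem_Ioc.1 he1).1
        have : 0 < g := Nat.pos_of_ne_zero (by rintro rfl; simp at *)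
        positivity
    _ = N * κ * (1 / e2) * ((∑ g ∈ Ioc (D0 / e2) (D1 / e2), (1 : ℝ) / g)
          * ∑ e1 ∈ Ioc 0 (Q2 * e2), (1 : ℝ) / e1)
        + (#(Ioc (D0 / e2) (D1 / e2)) * #(Ioc 0 (Q2 * e2)) : ℝ) * (3 * Z ^ R) := by
        rw [sum_mul_sum, mul_sum]
        simp_rw [sum_add_distrib, sum_const, nsmul_eq_mul, mul_sum]
        push_cast
        congr 1
        · refine sum_congr rfl fun g _ => sum_congr rfl fun e1 _ => ?_
          rw [one_div, one_div, one_div, one_div, mul_inv, mul_inv]; ring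
        · ring
    _ ≤ N * κ * (1 / e2) * ((1 + Real.log Q2) * (1 + Real.log (Q2 * e2)))
        + (Y / e2 * (Q2 * e2)) * (3 * Z ^ R) := by
        have h1 : ∑ g ∈ Ioc (D0 / e2) (D1 / e2), (1 : ℝ) / g ≤ 1 + Real.log Q2 := by
          refine sum_Ioc_one_div_le hQ2 ?_
          have h1 : D1 / e2 ≤ Q2 * D0 / e2 := Nat.div_le_div_right hQ
          refine h1.trans ?_
          rw [Nat.div_le_iff_le_mul_add_pred he2]
          have h2 := Nat.lt_mul_div_succ D0 he2
          have h3 : Q2 * D0 ≤ Q2 * (e2 * (D0 / e2 + 1)) := Nat.mul_le_mul_left _ h2.le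
          have h4 : Q2 * (e2 * (D0 / e2 + 1)) = e2 * (Q2 * (D0 / e2 + 1)) := by ring
          omega
        have h2 : ∑ e1 ∈ Ioc 0 (Q2 * e2), (1 : ℝ) / e1 ≤ 1 + Real.log (Q2 * e2) := by
          have := sum_Ioc_one_div_le (a := 0) (b := Q2 * e2) (Q := Q2 * e2)
            (Nat.mul_pos hQ2 he2) (by simp)
          simpa using this
        have h3 : (#(Ioc (D0 / e2) (D1 / e2)) : ℝ) ≤ Y / e2 := by
          rw [Nat.card_Ioc]
          have h4 : ((D1 / e2 - D0 / e2 : ℕ) : ℝ) ≤ ((Y / e2 : ℕ) : ℝ) := by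
            exact_mod_cast (Nat.sub_le _ _).trans (Nat.div_le_div_right hD1)
          exact h4.trans Nat.cast_div_le
        have h4 : (#(Ioc 0 (Q2 * e2)) : ℝ) = Q2 * e2 := by simp
        rw [h4]
        have h5 : 0 ≤ 1 + Real.log Q2 := by
          have := Real.log_nonneg (show (1 : ℝ) ≤ Q2 by exact_mod_cast hQ2)
          linarith
        gcongr
    _ = _ := by
        have : (e2 : ℝ) ≠ 0 := by exact_mod_cast he2.ne'
        field_simp

end

theorem sum_rho_sq_mul_brunWeight_le {N D0 D1 Y Q2 E0 E1 : ℕ} (hD1 : D1 ≤ Y)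
    (hY : N < (Y + 1) * (D0 + 1))
    (hQ2 : 1 ≤ Q2) (hQ : D1 ≤ Q2 * D0) (P : Finset ℕ) (hP : ∀ q ∈ P, q.Prime)
    (hodd : ∀ q ∈ P, Odd q) {R : ℕ} (hR : Even R)
    {Z : ℝ} (hZ : 1 ≤ Z) (hPZ : (#P : ℝ) ≤ Z) {b : ℝ}
    (hb : ∀ k, 0 < k → k ≤ N → ∑ q ∈ P with q ∣ k, (1 : ℝ) / q ≤ b)
    (hE0 : 1 ≤ E0) (hE1 : 1 ≤ E1) :
    ∑ n ∈ Ioc 0 N, rho D0 D1 n ^ 2 * brunWeight P R (fun q => q ∣ n + 1)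
      ≤ N * (Real.exp (b - ∑ q ∈ P, (1 : ℝ) / q) + Real.exp (3 * ∑ q ∈ P, (1 : ℝ) / q - R))
          * (1 + Real.log (Q2 * E0)) ^ 3
        + 3 * Z ^ R * (Q2 * Y) * E0
        + Real.exp (2 * ∑ q ∈ P, (1 : ℝ) / q) * (5 * Y ^ 2) * (4 / Real.sqrt E0)
        + 3 * Z ^ R * (2 * Q2 * Y) * E1
        + 3 * Z ^ R * (5 * Y ^ 2) * (4 / Real.sqrt E1) := by
  set κ := Real.exp (b - ∑ q ∈ P, (1 : ℝ) / q) + Real.exp (3 * ∑ q ∈ P, (1 : ℝ) / q - R)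
  have hκ : 0 ≤ κ := by positivity
  set t := reducedSum N D0 D1 Y (fun n => brunWeight P R (fun q => q ∣ n + 1))
  have hQ1 : (1 : ℝ) ≤ Q2 := by exact_mod_cast hQ2
  have hE01 : (1 : ℝ) ≤ E0 := by exact_mod_cast hE0
  have hlQ : 0 ≤ Real.log Q2 := Real.log_nonneg hQ1
  have hlE : 0 ≤ Real.log E0 := Real.log_nonneg hE01
  have hlQE : Real.log (Q2 * E0) = Real.log Q2 + Real.log E0 :=
    Real.log_mul (by positivity) (by positivity)
  rw [sum_rho_sq_mul_eq hD1 hY]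
  have hS : ∑ e2 ∈ Ioc 0 Y with e2 ≤ E0, t e2
      ≤ N * κ * (1 + Real.log (Q2 * E0)) ^ 3 + 3 * Z ^ R * (Q2 * Y) * E0 := by
    calc _ ≤ ∑ e2 ∈ Ioc 0 Y with e2 ≤ E0,
          (N * κ * (1 + Real.log (Q2 * E0)) ^ 2 * (1 / e2) + 3 * Z ^ R * (Q2 * Y)) := by
          refine sum_le_sum fun e2 he2 => ?_
          simp only [mem_filter, mem_Ioc] at he2
          refine (le_abs_self _).trans ((abs_reducedSum_le_of_small hD1 hQ2 hQ P hP hR hZ hPZ hb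
            he2.1.1).trans ?_)
          have h1 : Real.log (Q2 * e2) ≤ Real.log (Q2 * E0) := by
            have : (0 : ℝ) < e2 := by exact_mod_cast he2.1.1
            refine Real.log_le_log (by positivity) ?_
            have : (e2 : ℝ) ≤ E0 := by exact_mod_cast he2.2
            gcongr
          have h0 : 0 ≤ Real.log (Q2 * e2) := by
            refine Real.log_nonneg ?_
            exact_mod_cast Nat.mul_pos hQ2 he2.1.1
          have h2 : Real.log Q2 ≤ Real.log (Q2 * E0) := by linarith
          have h3 : 0 ≤ 1 + Real.log (Q2 * E0) := by linarith
          rw [sq]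
          gcongr
      _ ≤ ∑ e2 ∈ Ioc 0 E0,
          (N * κ * (1 + Real.log (Q2 * E0)) ^ 2 * (1 / e2) + 3 * Z ^ R * (Q2 * Y)) := by
          refine sum_le_sum_of_subset_of_nonneg ?_ fun _ _ _ => by positivity
          intro x hx
          simp only [mem_filter, mem_Ioc] at hx ⊢
          exact ⟨hx.1.1, hx.2⟩
      _ = N * κ * (1 + Real.log (Q2 * E0)) ^ 2 * (∑ e2 ∈ Ioc 0 E0, (1 : ℝ) / e2)
          + 3 * Z ^ R * (Q2 * Y) * E0 := by
          rw [sum_add_distrib, mul_sum, sum_const, nsmul_eq_mul, Nat.card_Ioc, Nat.sub_zero]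
          ring
      _ ≤ N * κ * (1 + Real.log (Q2 * E0)) ^ 2 * (1 + Real.log (Q2 * E0))
          + 3 * Z ^ R * (Q2 * Y) * E0 := by
          have h1 := sum_Ioc_one_div_le (a := 0) (b := E0) (Q := E0) hE0 (by simp)
          have h2 : ∑ e2 ∈ Ioc 0 E0, (1 : ℝ) / e2 ≤ 1 + Real.log (Q2 * E0) := by linarith
          gcongr
      _ = _ := by ring
  have hM : ∑ e2 ∈ (Ioc 0 Y).filter (fun e2 => ¬ e2 ≤ E0) with e2 ≤ E1, t e2
      ≤ Real.exp (2 * ∑ q ∈ P, (1 : ℝ) / q) * (5 * Y ^ 2) * (4 / Real.sqrt E0)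
        + 3 * Z ^ R * (2 * Q2 * Y) * E1 := by
    set S := ((Ioc 0 Y).filter (fun e2 => ¬ e2 ≤ E0)).filter (fun e2 => e2 ≤ E1)
    have hS1 : ∀ e ∈ S, E0 < e := by
      intro e he
      simp only [S, mem_filter] at he
      omega
    have hcard : (#S : ℝ) ≤ E1 := by
      have : S ⊆ Ioc 0 E1 := by
        intro e he
        simp only [S, mem_filter, mem_Ioc] at he ⊢
        omega
      have := card_le_card this
      rw [Nat.card_Ioc, Nat.sub_zero] at this
      exact_mod_cast this
    calc _ ≤ ∑ e2 ∈ S, (Real.exp (2 * ∑ q ∈ P, (1 : ℝ) / q) * (5 * Y ^ 2)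
          * ((#e2.divisors : ℝ) / (e2 : ℝ) ^ 2) + 3 * Z ^ R * (2 * Q2 * Y)) :=
          sum_le_sum fun e2 he2 => (le_abs_self _).trans
            (abs_reducedSum_le_of_medium hD1 hY hQ P hP hodd R hZ hPZ
              ((Nat.zero_le _).trans_lt (hS1 e2 he2)))
      _ = Real.exp (2 * ∑ q ∈ P, (1 : ℝ) / q) * (5 * Y ^ 2)
          * (∑ e2 ∈ S, (#e2.divisors : ℝ) / (e2 : ℝ) ^ 2) + 3 * Z ^ R * (2 * Q2 * Y) * #S := by
          rw [sum_add_distrib, ← mul_sum, sum_const, nsmul_eq_mul]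
          ring
      _ ≤ _ := by
          have := sum_card_divisors_div_sq_le S hE0 hS1
          gcongr
  have hL : ∑ e2 ∈ (Ioc 0 Y).filter (fun e2 => ¬ e2 ≤ E0) with ¬ e2 ≤ E1, t e2
      ≤ 3 * Z ^ R * (5 * Y ^ 2) * (4 / Real.sqrt E1) := by
    set S := ((Ioc 0 Y).filter (fun e2 => ¬ e2 ≤ E0)).filter (fun e2 => ¬ e2 ≤ E1)
    have hS1 : ∀ e ∈ S, E1 < e := by
      intro e he
      simp only [S, mem_filter] at he
      omega
    calc _ ≤ ∑ e2 ∈ S, 3 * Z ^ R * (5 * Y ^ 2) * ((#e2.divisors : ℝ) / (e2 : ℝ) ^ 2) :=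
          sum_le_sum fun e2 he2 => (le_abs_self _).trans
            (abs_reducedSum_le_of_large hD1 hY P hP hodd R hZ hPZ
              ((Nat.zero_le _).trans_lt (hS1 e2 he2)))
      _ = 3 * Z ^ R * (5 * Y ^ 2) * (∑ e2 ∈ S, (#e2.divisors : ℝ) / (e2 : ℝ) ^ 2) := by
          rw [mul_sum]
      _ ≤ _ := by
          have := sum_card_divisors_div_sq_le S hE1 hS1
          gcongr
  rw [← sum_filter_add_sum_filter_not (Ioc 0 Y) (fun e2 => e2 ≤ E0),
    ← sum_filter_add_sum_filter_not ((Ioc 0 Y).filter (fun e2 => ¬ e2 ≤ E0)) (fun e2 => e2 ≤ E1)]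
  linarith

/-- The largest divisor of `n` composed of primes from `P`. -/
def smoothPart (P : Finset ℕ) (n : ℕ) : ℕ := ∏ q ∈ P, q ^ n.factorization q

theorem smoothPart_pos {P : Finset ℕ} (hP : ∀ q ∈ P, q.Prime) (n : ℕ) : 0 < smoothPart P n :=
  prod_pos fun q hq => pow_pos (hP q hq).pos _

theorem smoothPart_mul (P : Finset ℕ) {m n : ℕ} (hm : m ≠ 0) (hn : n ≠ 0) :
    smoothPart P (m * n) = smoothPart P m * smoothPart P n := by
  unfold smoothPart
  rw [← prod_mul_distrib, Nat.factorization_mul hm hn]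
  exact prod_congr rfl fun q _ => by rw [Finsupp.add_apply, pow_add]

theorem factorization_smoothPart {P : Finset ℕ} (hP : ∀ q ∈ P, q.Prime) (n : ℕ) {p : ℕ}
    (hp : p ∈ P) : (smoothPart P n).factorization p = n.factorization p := by
  unfold smoothPart
  rw [Nat.factorization_prod_apply fun q hq => (pow_pos (hP q hq).pos _).ne']
  rw [sum_eq_single p]
  · rw [(hP p hp).factorization_pow, Finsupp.single_eq_same]
  · intro q hq hqp
    rw [(hP q hq).factorization_pow, Finsupp.single_eq_of_ne hqp.symm]
  · exact fun h => (h hp).elim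

theorem smoothPart_mem_factoredNumbers {P : Finset ℕ} (hP : ∀ q ∈ P, q.Prime) (n : ℕ) :
    smoothPart P n ∈ Nat.factoredNumbers P := by
  rw [Nat.mem_factoredNumbers']
  intro p hp hdvd
  obtain ⟨q, hq, hpq⟩ := (Prime.dvd_finsetProd_iff hp.prime _).1 hdvd
  rw [(Nat.prime_dvd_prime_iff_eq hp (hP q hq)).1 (hp.dvd_of_dvd_pow hpq)]
  exact hq

theorem smoothPart_dvd {P : Finset ℕ} (hP : ∀ q ∈ P, q.Prime) (n : ℕ) : smoothPart P n ∣ n := by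
  rcases eq_or_ne n 0 with rfl | hn
  · exact dvd_zero _
  rw [← Nat.factorization_le_iff_dvd (smoothPart_pos hP n).ne' hn]
  intro p
  by_cases hp : p.Prime ∧ p ∣ smoothPart P n
  · have hpP : p ∈ P :=
      (Nat.mem_factoredNumbers'.1 (smoothPart_mem_factoredNumbers hP n)) p hp.1 hp.2
    exact (factorization_smoothPart hP n hpP).le
  · have : (smoothPart P n).factorization p = 0 := by
      rw [Nat.factorization_eq_zero_iff]
      tauto
    omega

theorem not_dvd_div_smoothPart {P : Finset ℕ} (hP : ∀ q ∈ P, q.Prime) {n : ℕ} (hn : n ≠ 0) {p : ℕ}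
    (hp : p ∈ P) : ¬ p ∣ n / smoothPart P n := by
  have hd := smoothPart_dvd hP n
  have h0 : n / smoothPart P n ≠ 0 :=
    (Nat.div_pos (Nat.le_of_dvd (Nat.pos_of_ne_zero hn) hd) (smoothPart_pos hP n)).ne'
  rw [(hP p hp).dvd_iff_one_le_factorization h0, Nat.factorization_div hd, Finsupp.tsub_apply,
    factorization_smoothPart hP n hp]
  omega

/-- Splitting the integers of an interval according to their smooth part. -/
theorem sum_Ioc_le_sum_smooth_mul_rough {P : Finset ℕ} (hP : ∀ q ∈ P, q.Prime) (u v : ℕ)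
    {φ : ℕ → ℝ} (hφ : ∀ n, 0 ≤ φ n) [DecidablePred fun a => a ∈ Nat.factoredNumbers P] :
    ∑ n ∈ Ioc u v, φ n ≤ ∑ a ∈ Ioc 0 v with a ∈ Nat.factoredNumbers P,
      ∑ b ∈ Ioc (u / a) (v / a) with (∀ q ∈ P, ¬ q ∣ b) ∧ smoothPart P (a * b) = a, φ (a * b) := by
  classical
  rw [sum_sigma']
  set f : ℕ → (_ : ℕ) × ℕ := fun n => ⟨smoothPart P n, n / smoothPart P n⟩
  have hmul : ∀ n, smoothPart P n * (n / smoothPart P n) = n := fun n =>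
    Nat.mul_div_cancel' (smoothPart_dvd hP n)
  have hinj : Set.InjOn f (Ioc u v) := by
    intro n _ n' _ h
    simp only [f, Sigma.mk.injEq, heq_eq_eq] at h
    rw [← hmul n, ← hmul n', h.1, ← h.1, h.2, h.1]
  have himg : ∑ n ∈ Ioc u v, φ n = ∑ x ∈ (Ioc u v).image f, φ (x.1 * x.2) := by
    rw [sum_image hinj]
    exact sum_congr rfl fun n _ => by rw [hmul n]
  rw [himg]
  refine sum_le_sum_of_subset_of_nonneg ?_ fun _ _ _ => hφ _
  intro x hx
  obtain ⟨n, hn, rfl⟩ := mem_image.1 hx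
  rw [mem_Ioc] at hn
  have hn0 : n ≠ 0 := by omega
  have hpos := smoothPart_pos hP n
  simp only [f, mem_sigma, mem_filter, mem_Ioc]
  refine ⟨⟨⟨hpos, (Nat.le_of_dvd (by omega) (smoothPart_dvd hP n)).trans hn.2⟩,
    smoothPart_mem_factoredNumbers hP n⟩, ⟨?_, Nat.div_le_div_right hn.2⟩,
    ⟨fun q hq => not_dvd_div_smoothPart hP hn0 hq, by rw [hmul n]⟩⟩
  rw [Nat.div_lt_iff_lt_mul hpos, mul_comm, hmul n]
  exact hn.1

/-- The completely multiplicative function `n ↦ z ^ Ω(n) / n`. -/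
def omegaDiv (z : ℝ) : ℕ →* ℝ where
  toFun n := z ^ ArithmeticFunction.cardFactors n / n
  map_one' := by simp
  map_mul' m n := by
    rcases eq_or_ne m 0 with rfl | hm
    · simp
    rcases eq_or_ne n 0 with rfl | hn
    · simp
    rw [ArithmeticFunction.cardFactors_mul hm hn, pow_add, Nat.cast_mul]
    exact mul_div_mul_comm _ _ _ _

theorem omegaDiv_apply (z : ℝ) (n : ℕ) :
    omegaDiv z n = z ^ ArithmeticFunction.cardFactors n / n := rfl

theorem omegaDiv_nonneg {z : ℝ} (hz : 0 ≤ z) (n : ℕ) : 0 ≤ omegaDiv z n := by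
  rw [omegaDiv_apply]
  positivity

theorem inv_one_sub_le_exp {x : ℝ} (hx : x < 1) : (1 - x)⁻¹ ≤ Real.exp (x / (1 - x)) := by
  have h : 0 < 1 - x := by linarith
  have h2 : (1 - x)⁻¹ = x / (1 - x) + 1 := by field_simp; ring
  rw [h2]
  exact Real.add_one_le_exp _

theorem sum_omegaDiv_le {P : Finset ℕ} (hP : ∀ q ∈ P, q.Prime) (h3 : ∀ q ∈ P, 3 ≤ q) {z : ℝ}
    (hz : 0 ≤ z) (hz2 : z ^ 2 ≤ 2) (A : Finset ℕ) (hA : ∀ a ∈ A, a ∈ Nat.factoredNumbers P) :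
    ∑ a ∈ A, omegaDiv z a ≤ Real.exp (z * ∑ q ∈ P, (1 : ℝ) / q + 4) := by
  have hz32 : z ≤ 3 / 2 := by nlinarith
  have hprime : ∀ p : ℕ, p.Prime → omegaDiv z p < 1 := by
    intro p hp
    have : (2 : ℝ) ≤ p := by exact_mod_cast hp.two_le
    rw [omegaDiv_apply, ArithmeticFunction.cardFactors_apply_prime hp, pow_one, div_lt_one] <;>
      linarith
  refine (sum_factoredNumbers_le (omegaDiv z) (omegaDiv_nonneg hz) hprime P A hA).trans ?_
  rw [filter_true_of_mem hP]
  calc ∏ q ∈ P, (1 - omegaDiv z q)⁻¹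
      ≤ ∏ q ∈ P, Real.exp (z * (1 / q) + 4 * (1 / ((q : ℝ) * (q - 1)))) := by
        refine prod_le_prod (fun q hq => ?_) fun q hq => ?_
        · have := hprime q (hP q hq)
          exact inv_nonneg.2 (by linarith)
        · refine (inv_one_sub_le_exp (hprime q (hP q hq))).trans ?_
          have h3q : (3 : ℝ) ≤ q := by exact_mod_cast h3 q hq
          rw [omegaDiv_apply, ArithmeticFunction.cardFactors_apply_prime (hP q hq), pow_one]
          refine Real.exp_le_exp.2 ?_
          have e1 : z / q / (1 - z / q) = z / (q - z) := by
            have : (q : ℝ) - z ≠ 0 := by linarith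
            have : (q : ℝ) ≠ 0 := by linarith
            field_simp
          have e2 : z * (1 / q) + 4 * (1 / ((q : ℝ) * (q - 1)))
              = (z * (q - 1) + 4) / (q * (q - 1)) := by
            have : (q : ℝ) - 1 ≠ 0 := by linarith
            have : (q : ℝ) ≠ 0 := by linarith
            field_simp
          rw [e1, e2, div_le_div_iff₀ (by linarith) (by nlinarith)]
          nlinarith
    _ = Real.exp (z * ∑ q ∈ P, (1 : ℝ) / q + 4 * ∑ q ∈ P, 1 / ((q : ℝ) * (q - 1))) := by
        rw [← Real.exp_sum, sum_add_distrib, mul_sum, mul_sum]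
    _ ≤ _ := by
        have h1 := sum_one_div_mul_pred_le P 1 le_rfl fun q hq => (hP q hq).one_lt
        simp only [Nat.cast_one, div_one] at h1
        refine Real.exp_le_exp.2 ?_
        linarith

/-- The completely multiplicative function `n ↦ n ^ (s - 1)`. -/
def rpowSubOne (s : ℝ) : ℕ →* ℝ where
  toFun n := (n : ℝ) ^ (s - 1)
  map_one' := by simp
  map_mul' m n := by
    rw [Nat.cast_mul, Real.mul_rpow (Nat.cast_nonneg _) (Nat.cast_nonneg _)]

/-- Rankin's bound for the number of integers with a large smooth part. -/
theorem card_lt_smoothPart_le {P : Finset ℕ} (hP : ∀ q ∈ P, q.Prime) (h6 : ∀ q ∈ P, 6 ≤ q)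
    {s : ℝ} (hs0 : 0 < s) (hs1 : s < 1) (hPs : ∀ q ∈ P, (q : ℝ) ^ s ≤ 3) (N : ℕ) {A0 : ℕ}
    (hA0 : 1 ≤ A0) :
    (#{n ∈ Ioc 0 N | A0 < smoothPart P n} : ℝ)
      ≤ N * (A0 : ℝ) ^ (-s) * Real.exp (6 * ∑ q ∈ P, (1 : ℝ) / q) := by
  classical
  set f := rpowSubOne s
  have hf : ∀ n, f n = (n : ℝ) ^ (s - 1) := fun _ => rfl
  have hf0 : ∀ n, 0 ≤ f n := fun n => Real.rpow_nonneg (Nat.cast_nonneg _) _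
  have hf1 : ∀ p : ℕ, p.Prime → f p < 1 := fun p hp =>
    Real.rpow_lt_one_of_one_lt_of_neg (by exact_mod_cast hp.one_lt) (by linarith)
  have hA0' : (0 : ℝ) < A0 := by exact_mod_cast hA0
  have hprod : ∏ q ∈ P, (1 - f q)⁻¹ ≤ Real.exp (6 * ∑ q ∈ P, (1 : ℝ) / q) := by
    rw [mul_sum, Real.exp_sum]
    refine prod_le_prod (fun q hq => ?_) fun q hq => ?_
    · have := hf1 q (hP q hq)
      exact inv_nonneg.2 (by linarith)
    · refine (inv_one_sub_le_exp (hf1 q (hP q hq))).trans (Real.exp_le_exp.2 ?_)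
      have h6q : (6 : ℝ) ≤ q := by exact_mod_cast h6 q hq
      have h1 : f q ≤ 3 / q := by
        rw [hf, Real.rpow_sub_one (by positivity)]
        exact div_le_div_of_nonneg_right (hPs q hq) (by positivity)
      have h2 : 3 / (q : ℝ) ≤ 1 / 2 := by
        rw [div_le_div_iff₀ (by positivity) (by norm_num)]
        linarith
      rw [div_le_iff₀ (by linarith)]
      have h3 : 6 * (1 / (q : ℝ)) = 2 * (3 / q) := by ring
      have h4 : 0 ≤ 3 / (q : ℝ) := by positivity
      rw [h3]
      nlinarith [hf0 q]
  rw [card_filter]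
  push_cast
  refine (sum_Ioc_le_sum_smooth_mul_rough hP 0 N (fun n => by split_ifs <;> norm_num)).trans ?_
  calc _ ≤ ∑ a ∈ Ioc 0 N with a ∈ Nat.factoredNumbers P, N * (A0 : ℝ) ^ (-s) * f a := by
        refine sum_le_sum fun a ha => ?_
        simp only [mem_filter, mem_Ioc] at ha
        have ha0 : (0 : ℝ) < a := by exact_mod_cast ha.1.1
        by_cases haA : A0 < a
        · calc _ ≤ ∑ b ∈ Ioc (0 / a) (N / a), (1 : ℝ) := by
                refine (sum_le_sum fun b _ => ?_).trans
                  (sum_le_sum_of_subset_of_nonneg (filter_subset _ _) fun _ _ _ => zero_le_one)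
                split_ifs <;> norm_num
            _ = ((N / a : ℕ) : ℝ) := by simp
            _ ≤ N / a := Nat.cast_div_le
            _ ≤ N / a * ((A0 : ℝ) ^ (-s) * (a : ℝ) ^ s) := by
                refine le_mul_of_one_le_right (by positivity) ?_
                rw [Real.rpow_neg hA0'.le, inv_mul_eq_div, one_le_div (by positivity)]
                exact Real.rpow_le_rpow hA0'.le (by exact_mod_cast haA.le) hs0.le
            _ = _ := by
                rw [hf, Real.rpow_sub_one ha0.ne']
                ring
        · rw [sum_eq_zero]
          · have := hf0 a
            positivity
          · intro b hb
            simp only [mem_filter] at hb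
            rw [hb.2.2, if_neg haA]
    _ ≤ N * (A0 : ℝ) ^ (-s) * ∏ q ∈ P, (1 - f q)⁻¹ := by
        rw [← mul_sum]
        refine mul_le_mul_of_nonneg_left ?_ (by positivity)
        have := sum_factoredNumbers_le f hf0 hf1 P _
          (fun a ha => (mem_filter.1 ha).2 : ∀ a ∈ (Ioc 0 N).filter (· ∈ Nat.factoredNumbers P), _)
        rwa [filter_true_of_mem hP] at this
    _ ≤ _ := by gcongr

theorem card_rough_le {P : Finset ℕ} (hP : ∀ q ∈ P, q.Prime) {R : ℕ} (hR : Even R) {u v : ℕ}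
    (huv : u ≤ v) {Z : ℝ} (hZ : 1 ≤ Z) (hPZ : (#P : ℝ) ≤ Z) :
    (#{n ∈ Ioc u v | ∀ q ∈ P, ¬ q ∣ n} : ℝ)
      ≤ ((v : ℝ) - u) * (Real.exp (-∑ q ∈ P, (1 : ℝ) / q) + Real.exp (3 * ∑ q ∈ P, (1 : ℝ) / q - R))
        + 3 * Z ^ R := by
  have h := sum_brunWeight_le P hP R (fun _ => {0}) (fun q hq => by simpa using (hP q hq).pos) huv
    hZ (by simpa using hPZ)
  simp only [card_singleton, Nat.cast_one] at h
  refine le_trans ?_ h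
  rw [card_filter]
  push_cast
  refine sum_le_sum fun n _ => ?_
  split_ifs with hn
  · rw [brunWeight_eq_one]
    intro q hq h0
    exact hn q hq (Nat.dvd_of_mod_eq_zero (mem_singleton.1 h0))
  · exact brunWeight_nonneg P hR _

/-- Residues `c` modulo `q` with `q ∣ c`, `q ∣ k * c + 1` or `k * c ≡ M`. -/
def badResidues (k M q : ℕ) : Finset ℕ :=
  {c ∈ range q | q ∣ c ∨ q ∣ k * c + 1 ∨ k * c ≡ M [MOD q]}

theorem card_badResidues {k M q : ℕ} (hq : q.Prime) (hk : ¬ q ∣ k * M * (M + 1)) :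
    #(badResidues k M q) = 3 := by
  have : Fact q.Prime := ⟨hq⟩
  have hk' : (k : ZMod q) ≠ 0 ∧ (M : ZMod q) ≠ 0 ∧ (M : ZMod q) + 1 ≠ 0 := by
    rw [← ZMod.natCast_eq_zero_iff] at hk
    push_cast at hk
    simp only [mul_eq_zero, not_or] at hk
    tauto
  obtain ⟨h1, h2, h3⟩ := hk'
  have hmem : ∀ c : ℕ, (q ∣ c ∨ q ∣ k * c + 1 ∨ k * c ≡ M [MOD q]) ↔
      (c : ZMod q) ∈ ({0, -(k : ZMod q)⁻¹, (M : ZMod q) * (k : ZMod q)⁻¹} : Finset (ZMod q)) := by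
    intro c
    simp only [← ZMod.natCast_eq_zero_iff, ← ZMod.natCast_eq_natCast_iff, mem_insert,
      mem_singleton]
    push_cast
    refine or_congr Iff.rfl (or_congr ?_ ?_)
    · rw [← eq_neg_iff_add_eq_zero, neg_eq_neg_one_mul (k : ZMod q)⁻¹, eq_mul_inv_iff_mul_eq₀ h1,
        mul_comm]
    · rw [eq_mul_inv_iff_mul_eq₀ h1, mul_comm]
  have himg : (badResidues k M q).image (fun c : ℕ => (c : ZMod q))
      = {0, -(k : ZMod q)⁻¹, (M : ZMod q) * (k : ZMod q)⁻¹} := by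
    ext x
    simp only [mem_image, badResidues, mem_filter, mem_range]
    constructor
    · rintro ⟨c, ⟨_, hc⟩, rfl⟩
      exact (hmem c).1 hc
    · intro hx
      refine ⟨x.val, ⟨ZMod.val_lt x, (hmem _).2 ?_⟩, ZMod.natCast_zmod_val x⟩
      rwa [ZMod.natCast_zmod_val]
  have hinj : Set.InjOn (fun c : ℕ => (c : ZMod q)) (badResidues k M q) := by
    intro c hc c' hc' h
    simp only [badResidues, mem_coe, mem_filter, mem_range] at hc hc'
    have := (ZMod.natCast_eq_natCast_iff c c' q).1 h
    rwa [Nat.ModEq, Nat.mod_eq_of_lt hc.1, Nat.mod_eq_of_lt hc'.1] at this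
  rw [← card_image_of_injOn hinj, himg, card_eq_three]
  refine ⟨_, _, _, ?_, ?_, ?_, rfl⟩
  · exact (neg_ne_zero.2 (inv_ne_zero h1)).symm
  · exact (mul_ne_zero h2 (inv_ne_zero h1)).symm
  · intro h
    refine h3 ?_
    rw [neg_eq_neg_one_mul, mul_left_inj' (inv_ne_zero h1)] at h
    rw [← h, neg_add_cancel]

theorem card_three_sifted_le {P : Finset ℕ} (hP : ∀ q ∈ P, q.Prime) {R : ℕ} (hR : Even R)
    {u v : ℕ} (huv : u ≤ v) {Z : ℝ} (hZ : 1 ≤ Z) (hPZ : 3 * (#P : ℝ) ≤ Z) (k M : ℕ) {b : ℝ}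
    (hb : ∑ q ∈ P with q ∣ k * M * (M + 1), (1 : ℝ) / q ≤ b) :
    (#{c ∈ Ioc u v | ∀ q ∈ P, ¬ q ∣ c ∧ ¬ q ∣ k * c + 1 ∧ ¬ k * c ≡ M [MOD q]} : ℝ)
      ≤ ((v : ℝ) - u) * (Real.exp (3 * (b - ∑ q ∈ P, (1 : ℝ) / q))
          + Real.exp (9 * ∑ q ∈ P, (1 : ℝ) / q - R)) + 3 * Z ^ R := by
  set P' := P.filter (fun q => ¬ q ∣ k * M * (M + 1))
  have hP' : ∀ q ∈ P', q.Prime := fun q hq => hP q (mem_filter.1 hq).1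
  have hc : ∀ q ∈ P', #(badResidues k M q) = 3 := fun q hq =>
    card_badResidues (hP' q hq) (mem_filter.1 hq).2
  have hsplit : ∑ q ∈ P with q ∣ k * M * (M + 1), (1 : ℝ) / q + ∑ q ∈ P', (1 : ℝ) / q
      = ∑ q ∈ P, (1 : ℝ) / q := sum_filter_add_sum_filter_not _ _ _
  have hcard : (#P' : ℝ) ≤ #P := by exact_mod_cast card_le_card (filter_subset _ _)
  have hsum : ∑ q ∈ P', (#(badResidues k M q) : ℝ) / q = 3 * ∑ q ∈ P', (1 : ℝ) / q := by
    rw [mul_sum]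
    refine sum_congr rfl fun q hq => ?_
    rw [hc q hq]
    push_cast
    ring
  have h := sum_brunWeight_le P' hP' R (badResidues k M) (fun q _ => filter_subset _ _) huv
    hZ (by
      rw [sum_congr rfl fun q hq => by rw [hc q hq], sum_const, nsmul_eq_mul]
      push_cast
      linarith)
  rw [hsum] at h
  have hnn : 0 ≤ ∑ q ∈ P with q ∣ k * M * (M + 1), (1 : ℝ) / q :=
    sum_nonneg fun _ _ => by positivity
  have huv' : (u : ℝ) ≤ v := by exact_mod_cast huv
  calc _ ≤ ∑ n ∈ Ioc u v, brunWeight P' R (fun q => n % q ∈ badResidues k M q) := by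
        rw [card_filter]
        push_cast
        refine sum_le_sum fun n _ => ?_
        split_ifs with hn
        · rw [brunWeight_eq_one]
          intro q hq h0
          have h1 := hn q (mem_filter.1 hq).1
          simp only [badResidues, mem_filter] at h0
          have h2 : n % q ≡ n [MOD q] := Nat.mod_modEq _ _
          rcases h0.2 with h3 | h3 | h3
          · exact h1.1 ((h2.dvd_iff dvd_rfl).1 h3)
          · exact h1.2.1 ((((h2.mul_left k).add_right 1).dvd_iff dvd_rfl).1 h3)
          · exact h1.2.2 ((h2.mul_left k).symm.trans h3)
        · exact brunWeight_nonneg P' hR _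
    _ ≤ _ := h
    _ ≤ _ := by
        have e1 : Real.exp (-(3 * ∑ q ∈ P', (1 : ℝ) / q))
            ≤ Real.exp (3 * (b - ∑ q ∈ P, (1 : ℝ) / q)) := Real.exp_le_exp.2 (by linarith)
        have e2 : Real.exp (3 * (3 * ∑ q ∈ P', (1 : ℝ) / q) - R)
            ≤ Real.exp (9 * ∑ q ∈ P, (1 : ℝ) / q - R) := Real.exp_le_exp.2 (by linarith)
        have e3 : (0 : ℝ) ≤ (v : ℝ) - u := by linarith
        gcongr

/-- Neither `n + 1` nor `M - n` has a prime factor in `P`. -/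
def Sifted (P : Finset ℕ) (M n : ℕ) : Prop := ∀ q ∈ P, ¬ q ∣ n + 1 ∧ ¬ n ≡ M [MOD q]

open Classical in
theorem sum_pow_cardFactors_sifted_le {P : Finset ℕ} (hP : ∀ q ∈ P, q.Prime)
    (h3 : ∀ q ∈ P, 3 ≤ q) {R : ℕ} (hR : Even R) {Z : ℝ} (hZ : 1 ≤ Z) (hPZ : 3 * (#P : ℝ) ≤ Z)
    {k M X : ℕ} {b : ℝ} (hk : 0 < k)
    (hb : ∀ a, 0 < a → a ≤ k * X → ∑ q ∈ P with q ∣ a * M * (M + 1), (1 : ℝ) / q ≤ b)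
    {z : ℝ} (hz : 0 ≤ z) (hz2 : z ^ 2 ≤ 2) (A0 : ℕ) :
    ∑ m ∈ Ioc 0 X with Sifted P M (k * m) ∧ smoothPart P m ≤ A0,
        z ^ ArithmeticFunction.cardFactors (smoothPart P m)
      ≤ Real.exp (z * ∑ q ∈ P, (1 : ℝ) / q + 4)
        * (X * (Real.exp (3 * (b - ∑ q ∈ P, (1 : ℝ) / q))
          + Real.exp (9 * ∑ q ∈ P, (1 : ℝ) / q - R)) + 3 * Z ^ R * A0) := by
  set κ := Real.exp (3 * (b - ∑ q ∈ P, (1 : ℝ) / q)) + Real.exp (9 * ∑ q ∈ P, (1 : ℝ) / q - R)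
  have hκ : 0 ≤ κ := by positivity
  rw [sum_filter]
  refine (sum_Ioc_le_sum_smooth_mul_rough hP 0 X
    (fun n => by split_ifs <;> positivity)).trans ?_
  calc _ ≤ ∑ a ∈ Ioc 0 X with a ∈ Nat.factoredNumbers P,
        omegaDiv z a * (X * κ + 3 * Z ^ R * A0) := by
        refine sum_le_sum fun a ha => ?_
        simp only [mem_filter, mem_Ioc] at ha
        have ha0 : (0 : ℝ) < a := by exact_mod_cast ha.1.1
        have hnn := omegaDiv_nonneg hz a
        by_cases haA : a ≤ A0
        · have haA' : (a : ℝ) ≤ A0 := by exact_mod_cast haA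
          have hcard := card_three_sifted_le hP hR (Nat.zero_le (X / a)) hZ hPZ (k * a) M
            (hb (k * a) (Nat.mul_pos hk ha.1.1) (Nat.mul_le_mul_left k ha.1.2))
          rw [Nat.cast_zero, sub_zero] at hcard
          have hdiv : ((X / a : ℕ) : ℝ) ≤ X / a := Nat.cast_div_le
          calc _ ≤ ∑ c ∈ Ioc 0 (X / a) with
                  ∀ q ∈ P, ¬ q ∣ c ∧ ¬ q ∣ k * a * c + 1 ∧ ¬ k * a * c ≡ M [MOD q],
                z ^ ArithmeticFunction.cardFactors a := by
                rw [Nat.zero_div, sum_filter, sum_filter]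
                refine sum_le_sum fun c _ => ?_
                by_cases hc : (∀ q ∈ P, ¬ q ∣ c) ∧ smoothPart P (a * c) = a
                · rw [if_pos hc, hc.2]
                  by_cases hs : Sifted P M (k * (a * c)) ∧ a ≤ A0
                  · rw [if_pos hs, if_pos]
                    intro q hq
                    have := hs.1 q hq
                    rw [← mul_assoc] at this
                    exact ⟨hc.1 q hq, this⟩
                  · rw [if_neg hs]
                    positivity
                · rw [if_neg hc]
                  positivity
            _ = #{c ∈ Ioc 0 (X / a) | ∀ q ∈ P, ¬ q ∣ c ∧ ¬ q ∣ k * a * c + 1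
                  ∧ ¬ k * a * c ≡ M [MOD q]} * z ^ ArithmeticFunction.cardFactors a := by
                rw [sum_const, nsmul_eq_mul]
            _ ≤ (X / a * κ + 3 * Z ^ R) * z ^ ArithmeticFunction.cardFactors a := by
                refine mul_le_mul_of_nonneg_right (hcard.trans ?_) (by positivity)
                gcongr
            _ = omegaDiv z a * (X * κ + 3 * Z ^ R * a) := by
                rw [omegaDiv_apply]
                field_simp
            _ ≤ _ := by gcongr
        · rw [sum_eq_zero]
          · positivity
          · intro c hc
            simp only [mem_filter] at hc
            rw [hc.2.2, if_neg fun h => haA h.2]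
    _ ≤ _ := by
        rw [← sum_mul]
        refine mul_le_mul_of_nonneg_right ?_ (by positivity)
        exact sum_omegaDiv_le hP h3 hz hz2 _ fun a ha => (mem_filter.1 ha).2

theorem sum_Ioc_div_eq (g : ℕ → ℝ) {u v : ℕ} (huv : u ≤ v) :
    ∑ b ∈ Ioc u v, g b / b = (∑ b ∈ Ioc u v, g b) / (v + 1)
      + ∑ t ∈ Ioc u v, (∑ b ∈ Ioc u t, g b) / (t * (t + 1)) := by
  induction v, huv using Nat.le_induction with
  | base => simp
  | succ v huv ih =>
    have h1 : ((v : ℝ) + 1) ≠ 0 := by positivity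
    have h2 : ((v : ℝ) + 1 + 1) ≠ 0 := by positivity
    rw [sum_Ioc_succ_top (by omega), sum_Ioc_succ_top (by omega), ih,
      sum_Ioc_succ_top (f := fun t => (∑ b ∈ Ioc u t, g b) / ((t : ℝ) * (t + 1))) (by omega),
      sum_Ioc_succ_top (by omega)]
    push_cast
    field_simp
    ring

theorem sum_Ioc_div_le_of_forall_sum_le {g : ℕ → ℝ} {u v : ℕ} (huv : u ≤ v) {κ E : ℝ} (hκ : 0 ≤ κ)
    (hg : ∀ t, u ≤ t → ∑ b ∈ Ioc u t, g b ≤ κ * t + E) :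
    ∑ b ∈ Ioc u v, g b / b ≤ κ * (1 + ∑ t ∈ Ioc u v, (1 : ℝ) / t) + E / (u + 1) := by
  rw [sum_Ioc_div_eq g huv]
  have htel : ∑ t ∈ Ioc u v, (1 : ℝ) / (t * (t + 1)) = 1 / (u + 1) - 1 / (v + 1) := by
    clear hg
    induction v, huv using Nat.le_induction with
    | base => simp
    | succ v huv ih =>
      have h1 : ((v : ℝ) + 1) ≠ 0 := by positivity
      have h2 : ((v : ℝ) + 1 + 1) ≠ 0 := by positivity
      have h3 : ((u : ℝ) + 1) ≠ 0 := by positivity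
      rw [sum_Ioc_succ_top (by omega), ih]
      push_cast
      field_simp
      ring
  have h1 : (∑ b ∈ Ioc u v, g b) / (v + 1) ≤ κ + E * (1 / (v + 1)) := by
    rw [div_le_iff₀ (by positivity)]
    refine (hg v huv).trans ?_
    have : (κ + E * (1 / ((v : ℝ) + 1))) * (v + 1) = κ * v + κ + E := by
      field_simp
    linarith
  have h2 : ∑ t ∈ Ioc u v, (∑ b ∈ Ioc u t, g b) / (t * (t + 1))
      ≤ ∑ t ∈ Ioc u v, (κ * ((1 : ℝ) / t) + E * (1 / ((t : ℝ) * (t + 1)))) := by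
    refine sum_le_sum fun t ht => ?_
    rw [mem_Ioc] at ht
    have ht0 : (0 : ℝ) < t := by exact_mod_cast (Nat.zero_le u).trans_lt ht.1
    rw [div_le_iff₀ (by positivity)]
    refine (hg t ht.1.le).trans ?_
    have : (κ * ((1 : ℝ) / t) + E * (1 / ((t : ℝ) * (t + 1)))) * (t * (t + 1))
        = κ * t + κ + E := by
      field_simp
    linarith
  rw [sum_add_distrib, ← mul_sum, ← mul_sum, htel] at h2
  have h3 : E / ((u : ℝ) + 1) = E * (1 / (u + 1)) := by ring
  rw [h3]
  linarith

open Classical in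
theorem sum_pow_cardFactors_div_le {P : Finset ℕ} (hP : ∀ q ∈ P, q.Prime) (h3 : ∀ q ∈ P, 3 ≤ q)
    {R : ℕ} (hR : Even R) {Z : ℝ} (hZ : 1 ≤ Z) (hPZ : (#P : ℝ) ≤ Z) {D0 D1 Q2 : ℕ}
    (hD0 : 0 < D0) (hD : D0 ≤ D1) (hQ2 : 1 ≤ Q2) (hQ : D1 ≤ Q2 * D0)
    {z : ℝ} (hz : 0 ≤ z) (hz2 : z ^ 2 ≤ 2) (A0 : ℕ) :
    ∑ d ∈ Ioc D0 D1 with smoothPart P d ≤ A0,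
        z ^ ArithmeticFunction.cardFactors (smoothPart P d) / d
      ≤ Real.exp (z * ∑ q ∈ P, (1 : ℝ) / q + 4)
        * ((Real.exp (-∑ q ∈ P, (1 : ℝ) / q) + Real.exp (3 * ∑ q ∈ P, (1 : ℝ) / q - R))
            * (2 + Real.log Q2) + 3 * Z ^ R * A0 / D0) := by
  set κ := Real.exp (-∑ q ∈ P, (1 : ℝ) / q) + Real.exp (3 * ∑ q ∈ P, (1 : ℝ) / q - R)
  have hκ : 0 ≤ κ := by positivity
  have hD0' : (0 : ℝ) < D0 := by exact_mod_cast hD0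
  have hlQ : 0 ≤ Real.log Q2 := Real.log_nonneg (by exact_mod_cast hQ2)
  rw [sum_filter]
  refine (sum_Ioc_le_sum_smooth_mul_rough hP D0 D1
    (fun n => by split_ifs <;> positivity)).trans ?_
  calc _ ≤ ∑ a ∈ Ioc 0 D1 with a ∈ Nat.factoredNumbers P,
        omegaDiv z a * (κ * (2 + Real.log Q2) + 3 * Z ^ R * A0 / D0) := by
        refine sum_le_sum fun a ha => ?_
        simp only [mem_filter, mem_Ioc] at ha
        have ha0 : (0 : ℝ) < a := by exact_mod_cast ha.1.1
        have hnn := omegaDiv_nonneg hz a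
        by_cases haA : a ≤ A0
        · have haA' : (a : ℝ) ≤ A0 := by exact_mod_cast haA
          have huv : D0 / a ≤ D1 / a := Nat.div_le_div_right hD
          have hharm := sum_Ioc_div_le_of_forall_sum_le
            (g := fun b => if ∀ q ∈ P, ¬ q ∣ b then (1 : ℝ) else 0) huv hκ
            (fun t ht => by
              have h := card_rough_le hP hR ht hZ hPZ
              rw [card_filter] at h
              push_cast at h
              refine h.trans ?_
              rw [mul_comm κ]
              have : (t : ℝ) - (D0 / a : ℕ) ≤ t := by
                have : (0 : ℝ) ≤ (D0 / a : ℕ) := Nat.cast_nonneg _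
                linarith
              gcongr)
          have hlog : ∑ t ∈ Ioc (D0 / a) (D1 / a), (1 : ℝ) / t ≤ 1 + Real.log Q2 := by
            refine sum_Ioc_one_div_le hQ2 ?_
            rw [← Nat.lt_add_one_iff, Nat.div_lt_iff_lt_mul ha.1.1]
            have h1 : D0 < (D0 / a + 1) * a := by
              rw [← Nat.div_lt_iff_lt_mul ha.1.1]
              omega
            have h2 : Q2 * D0 ≤ Q2 * ((D0 / a + 1) * a) := Nat.mul_le_mul_left _ h1.le
            nlinarith [ha.1.1]
          have herr : 3 * Z ^ R / (((D0 / a : ℕ) : ℝ) + 1) ≤ 3 * Z ^ R * A0 / D0 := by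
            rw [div_le_div_iff₀ (by positivity) hD0', mul_assoc (3 * Z ^ R) (A0 : ℝ)]
            refine mul_le_mul_of_nonneg_left ?_ (by positivity : 0 ≤ 3 * Z ^ R)
            have h1 : (D0 : ℝ) / a < (D0 / a : ℕ) + 1 := by
              rw [div_lt_iff₀ ha0]
              have : D0 < (D0 / a + 1) * a := by
                rw [← Nat.div_lt_iff_lt_mul ha.1.1]
                omega
              exact_mod_cast this
            rw [div_lt_iff₀ ha0] at h1
            have h0 : (0 : ℝ) ≤ (D0 / a : ℕ) + 1 := by positivity
            nlinarith
          calc _ ≤ ∑ c ∈ Ioc (D0 / a) (D1 / a),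
                  omegaDiv z a * ((if ∀ q ∈ P, ¬ q ∣ c then (1 : ℝ) else 0) / c) := by
                rw [sum_filter]
                refine sum_le_sum fun c _ => ?_
                by_cases hc : (∀ q ∈ P, ¬ q ∣ c) ∧ smoothPart P (a * c) = a
                · rw [if_pos hc, hc.2, if_pos haA, if_pos hc.1, omegaDiv_apply, Nat.cast_mul]
                  apply le_of_eq
                  rw [div_mul_div_comm, mul_one]
                · rw [if_neg hc]
                  split_ifs <;> positivity
            _ = omegaDiv z a * ∑ c ∈ Ioc (D0 / a) (D1 / a),
                  ((if ∀ q ∈ P, ¬ q ∣ c then (1 : ℝ) else 0) / c) := by rw [mul_sum]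
            _ ≤ _ := by
                refine mul_le_mul_of_nonneg_left (hharm.trans ?_) hnn
                have : κ * (1 + ∑ t ∈ Ioc (D0 / a) (D1 / a), (1 : ℝ) / t)
                    ≤ κ * (2 + Real.log Q2) := mul_le_mul_of_nonneg_left (by linarith) hκ
                linarith
        · rw [sum_eq_zero]
          · positivity
          · intro c hc
            simp only [mem_filter] at hc
            rw [hc.2.2, if_neg haA]
    _ ≤ _ := by
        rw [← sum_mul]
        refine mul_le_mul_of_nonneg_right ?_ (by positivity)
        exact sum_omegaDiv_le hP h3 hz hz2 _ fun a ha => (mem_filter.1 ha).2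

open Classical in
theorem sum_inv_pow_cardFactors_mul_card_dvd_le {P : Finset ℕ} (hP : ∀ q ∈ P, q.Prime)
    (h3 : ∀ q ∈ P, 3 ≤ q) {R : ℕ} (hR : Even R) {Z : ℝ} (hZ : 1 ≤ Z) (hPZ : 3 * (#P : ℝ) ≤ Z)
    {M D0 D1 Q2 : ℕ} (hD0 : 0 < D0) (hD : D0 ≤ D1) (hQ2 : 1 ≤ Q2) (hQ : D1 ≤ Q2 * D0) {b : ℝ}
    (hb : ∀ a, 0 < a → a ≤ M → ∑ q ∈ P with q ∣ a * M * (M + 1), (1 : ℝ) / q ≤ b)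
    {z : ℝ} (hz : 0 ≤ z) (hz1 : z ≤ 1) (A0 : ℕ) :
    ∑ n ∈ Ioc 0 M with Sifted P M n ∧ smoothPart P n ≤ A0,
        z ^ ArithmeticFunction.cardFactors (smoothPart P n) * #{d ∈ Ioc D0 D1 | d ∣ n}
      ≤ Real.exp (z * ∑ q ∈ P, (1 : ℝ) / q + 4)
        * (M * (Real.exp (3 * (b - ∑ q ∈ P, (1 : ℝ) / q))
            + Real.exp (9 * ∑ q ∈ P, (1 : ℝ) / q - R))
          * (Real.exp (z * ∑ q ∈ P, (1 : ℝ) / q + 4)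
            * ((Real.exp (-∑ q ∈ P, (1 : ℝ) / q) + Real.exp (3 * ∑ q ∈ P, (1 : ℝ) / q - R))
              * (2 + Real.log Q2) + 3 * Z ^ R * A0 / D0))
          + 3 * Z ^ R * A0 * D1) := by
  set κ := Real.exp (3 * (b - ∑ q ∈ P, (1 : ℝ) / q)) + Real.exp (9 * ∑ q ∈ P, (1 : ℝ) / q - R)
  have hκ : 0 ≤ κ := by positivity
  have hz2 : z ^ 2 ≤ 2 := by nlinarith
  set x := Real.exp (z * ∑ q ∈ P, (1 : ℝ) / q + 4)
  have hx : 0 < x := Real.exp_pos _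
  have hPZ1 : (#P : ℝ) ≤ Z := by
    have : (0 : ℝ) ≤ #P := Nat.cast_nonneg _
    linarith
  set ω : ℕ → ℝ := fun n => z ^ ArithmeticFunction.cardFactors (smoothPart P n)
  have hω0 : ∀ n, 0 ≤ ω n := fun n => pow_nonneg hz _
  have hω1 : ∀ n, ω n ≤ 1 := fun n => pow_le_one₀ hz hz1
  have hωmul : ∀ d m, d ≠ 0 → m ≠ 0 → ω (d * m) = ω d * ω m := by
    intro d m hd hm
    simp only [ω]
    rw [smoothPart_mul P hd hm, ArithmeticFunction.cardFactors_mul (smoothPart_pos hP d).ne'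
      (smoothPart_pos hP m).ne', pow_add]
  calc _ = ∑ d ∈ Ioc D0 D1, ∑ n ∈ Ioc 0 M,
        if d ∣ n then (if Sifted P M n ∧ smoothPart P n ≤ A0 then ω n else 0) else 0 := by
        rw [sum_comm, sum_filter]
        refine sum_congr rfl fun n _ => ?_
        rw [← sum_filter, sum_const, nsmul_eq_mul]
        split_ifs
        · exact mul_comm _ _
        · exact (mul_zero _).symm
    _ = ∑ d ∈ Ioc D0 D1, ∑ m ∈ Ioc 0 (M / d),
        if Sifted P M (d * m) ∧ smoothPart P (d * m) ≤ A0 then ω (d * m) else 0 := by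
        refine sum_congr rfl fun d hd => ?_
        have hd0 : 0 < d := (Nat.zero_le _).trans_lt (mem_Ioc.1 hd).1
        have := sum_Ioc_dvd
          (fun n => if Sifted P M n ∧ smoothPart P n ≤ A0 then ω n else 0) hd0 0 M
        rwa [Nat.zero_div] at this
    _ ≤ ∑ d ∈ Ioc D0 D1, (if smoothPart P d ≤ A0 then
          (x * M * κ) * (ω d / d) else 0) + ∑ d ∈ Ioc D0 D1, x * (3 * Z ^ R * A0) := by
        rw [← sum_add_distrib]
        refine sum_le_sum fun d hd => ?_
        have hd0 : 0 < d := (Nat.zero_le _).trans_lt (mem_Ioc.1 hd).1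
        have hd0' : (0 : ℝ) < d := by exact_mod_cast hd0
        by_cases hdA : smoothPart P d ≤ A0
        · rw [if_pos hdA]
          have h := sum_pow_cardFactors_sifted_le hP h3 hR hZ hPZ (k := d) (M := M) (X := M / d)
            hd0 (fun a ha haM => hb a ha (haM.trans (Nat.mul_div_le M d))) hz hz2 A0
          rw [sum_filter] at h
          have hdiv : ((M / d : ℕ) : ℝ) ≤ M / d := Nat.cast_div_le
          calc _ ≤ ∑ m ∈ Ioc 0 (M / d),
                ω d * (if Sifted P M (d * m) ∧ smoothPart P m ≤ A0 then ω m else 0) := by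
                refine sum_le_sum fun m hm => ?_
                have hm0 : m ≠ 0 := by
                  rw [mem_Ioc] at hm
                  omega
                by_cases hs : Sifted P M (d * m) ∧ smoothPart P (d * m) ≤ A0
                · rw [if_pos hs, if_pos, hωmul d m hd0.ne' hm0]
                  refine ⟨hs.1, le_trans ?_ hs.2⟩
                  rw [smoothPart_mul P hd0.ne' hm0]
                  exact Nat.le_mul_of_pos_left _ (smoothPart_pos hP d)
                · rw [if_neg hs]
                  have := hω0 d
                  have := hω0 m
                  split_ifs <;> positivity
            _ ≤ ω d * (x * ((M / d : ℕ) * κ + 3 * Z ^ R * A0)) := by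
                rw [← mul_sum]
                exact mul_le_mul_of_nonneg_left h (hω0 d)
            _ ≤ ω d * (x * (M / d * κ)) + 1 * (x * (3 * Z ^ R * A0)) := by
                rw [mul_add x, mul_add (ω d)]
                have := hω0 d
                have := hω1 d
                gcongr
            _ = _ := by
                field_simp
        · rw [if_neg hdA, sum_eq_zero]
          · positivity
          · intro m hm
            rw [mem_Ioc] at hm
            rw [if_neg fun hs => hdA (le_trans ?_ hs.2)]
            rw [smoothPart_mul P hd0.ne' (by omega)]
            exact Nat.le_mul_of_pos_right _ (smoothPart_pos hP m)
    _ ≤ (x * M * κ) * (x * ((Real.exp (-∑ q ∈ P, (1 : ℝ) / q)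
            + Real.exp (3 * ∑ q ∈ P, (1 : ℝ) / q - R))
              * (2 + Real.log Q2) + 3 * Z ^ R * A0 / D0)) + D1 * (x * (3 * Z ^ R * A0)) := by
        have h := sum_pow_cardFactors_div_le hP h3 hR hZ hPZ1 hD0 hD hQ2 hQ hz hz2 A0
        rw [← sum_filter, ← mul_sum, sum_const, nsmul_eq_mul, Nat.card_Ioc]
        have h2 : ((D1 - D0 : ℕ) : ℝ) ≤ D1 := by exact_mod_cast Nat.sub_le _ _
        gcongr
    _ = _ := by ring

open Classical in
theorem card_sifted_exists_dvd_le {P : Finset ℕ} (hP : ∀ q ∈ P, q.Prime)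
    (h6 : ∀ q ∈ P, 6 ≤ q) {R : ℕ} (hR : Even R) {Z : ℝ} (hZ : 1 ≤ Z) (hPZ : 3 * (#P : ℝ) ≤ Z)
    {N M D0 D1 Q2 : ℕ} (hMN : M ≤ N) (hD0 : 0 < D0) (hD : D0 ≤ D1) (hQ2 : 1 ≤ Q2)
    (hQ : D1 ≤ Q2 * D0) {b : ℝ}
    (hb : ∀ a, 0 < a → a ≤ M → ∑ q ∈ P with q ∣ a * M * (M + 1), (1 : ℝ) / q ≤ b)
    {s : ℝ} (hs0 : 0 < s) (hs1 : s < 1) (hPs : ∀ q ∈ P, (q : ℝ) ^ s ≤ 3) {A0 : ℕ} (hA0 : 1 ≤ A0)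
    {V κ₁ κ₃ : ℝ} (hV : V = ∑ q ∈ P, (1 : ℝ) / q)
    (hκ₁ : κ₁ = Real.exp (-V) + Real.exp (3 * V - R))
    (hκ₃ : κ₃ = Real.exp (3 * (b - V)) + Real.exp (9 * V - R)) :
    (#{n ∈ Ioc 0 M | Sifted P M n ∧ ∃ d ∈ Ioc D0 D1, d ∣ n} : ℝ)
      ≤ N * (A0 : ℝ) ^ (-s) * Real.exp (6 * V)
        + Real.exp (-(V / 2)) * (Real.exp (Real.sqrt 2 * V + 4) * (N * κ₃ + 3 * Z ^ R * A0))
        + Real.exp (V / 2) * (Real.exp (Real.sqrt 2 / 2 * V + 4) * (N * κ₃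
            * (Real.exp (Real.sqrt 2 / 2 * V + 4)
              * (κ₁ * (2 + Real.log Q2) + 3 * Z ^ R * A0 / D0)) + 3 * Z ^ R * A0 * D1)) := by
  have h3 : ∀ q ∈ P, 3 ≤ q := fun q hq => (by norm_num : 3 ≤ 6).trans (h6 q hq)
  have hsq : Real.sqrt 2 * Real.sqrt 2 = 2 := Real.mul_self_sqrt (by norm_num)
  have hs2 : 0 < Real.sqrt 2 := by positivity
  have hs32 : Real.sqrt 2 ≤ 2 := by nlinarith
  have hMN' : (M : ℝ) ≤ N := by exact_mod_cast hMN
  have hlQ : 0 ≤ Real.log Q2 := Real.log_nonneg (by exact_mod_cast hQ2)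
  have hA := card_lt_smoothPart_le hP h6 hs0 hs1 hPs N hA0
  have hB := sum_pow_cardFactors_sifted_le hP h3 hR hZ hPZ (k := 1) (M := M) (X := M) one_pos
    (by simpa using hb) hs2.le (by rw [sq, hsq]) A0
  have hC := sum_inv_pow_cardFactors_mul_card_dvd_le hP h3 hR hZ hPZ hD0 hD hQ2 hQ hb
    (z := Real.sqrt 2 / 2) (by positivity) (by linarith) A0
  simp only [one_mul] at hB
  rw [← hV] at hA hB hC
  rw [← hκ₃] at hB hC
  rw [← hκ₁] at hC
  have hκ₁0 : 0 ≤ κ₁ := by rw [hκ₁]; positivity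
  have hκ₃0 : 0 ≤ κ₃ := by rw [hκ₃]; positivity
  set ω := fun n => ArithmeticFunction.cardFactors (smoothPart P n)
  set τ : ℕ → ℕ := fun n => #{d ∈ Ioc D0 D1 | d ∣ n}
  have hpt : ∀ n, (if Sifted P M n ∧ ∃ d ∈ Ioc D0 D1, d ∣ n then (1 : ℝ) else 0)
      ≤ (if A0 < smoothPart P n then 1 else 0)
        + Real.exp (-(V / 2)) * (if Sifted P M n ∧ smoothPart P n ≤ A0
            then Real.sqrt 2 ^ ω n else 0)
        + Real.exp (V / 2) * (if Sifted P M n ∧ smoothPart P n ≤ A0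
            then (Real.sqrt 2 / 2) ^ ω n * τ n else 0) := by
    intro n
    by_cases hn : Sifted P M n ∧ ∃ d ∈ Ioc D0 D1, d ∣ n
    · by_cases hA0 : smoothPart P n ≤ A0
      · rw [if_pos hn, if_neg hA0.not_gt, if_pos ⟨hn.1, hA0⟩, if_pos ⟨hn.1, hA0⟩]
        obtain ⟨d, hd, hdn⟩ := hn.2
        have hτ : (1 : ℝ) ≤ τ n := by
          have : 0 < τ n := card_pos.2 ⟨d, mem_filter.2 ⟨hd, hdn⟩⟩
          exact_mod_cast this
        set p := Real.exp (-(V / 2)) * Real.sqrt 2 ^ ω n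
        set r := Real.exp (V / 2) * (Real.sqrt 2 / 2) ^ ω n
        have hp : 0 < p := by positivity
        have hr : 0 < r := by positivity
        have hpr : p * r = 1 := by
          have e1 : Real.exp (-(V / 2)) * Real.exp (V / 2) = 1 := by
            rw [← Real.exp_add, neg_add_cancel, Real.exp_zero]
          have e2 : Real.sqrt 2 ^ ω n * (Real.sqrt 2 / 2) ^ ω n = 1 := by
            rw [← mul_pow, mul_div_assoc', hsq, div_self (by norm_num), one_pow]
          calc p * r = (Real.exp (-(V / 2)) * Real.exp (V / 2))
                * (Real.sqrt 2 ^ ω n * (Real.sqrt 2 / 2) ^ ω n) := by simp only [p, r]; ring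
            _ = 1 := by rw [e1, e2, one_mul]
        have : 1 ≤ p + r := by nlinarith [sq_nonneg (p - r)]
        have : r ≤ r * τ n := le_mul_of_one_le_right hr.le hτ
        rw [← mul_assoc]
        linarith
      · rw [if_pos hn, if_pos (not_le.1 hA0)]
        have : 0 ≤ Real.exp (-(V / 2)) * (if Sifted P M n ∧ smoothPart P n ≤ A0
            then Real.sqrt 2 ^ ω n else 0) :=
          mul_nonneg (Real.exp_pos _).le (ite_nonneg (by positivity) le_rfl)
        have : 0 ≤ Real.exp (V / 2) * (if Sifted P M n ∧ smoothPart P n ≤ A0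
            then (Real.sqrt 2 / 2) ^ ω n * τ n else 0) :=
          mul_nonneg (Real.exp_pos _).le (ite_nonneg (by positivity) le_rfl)
        linarith
    · rw [if_neg hn]
      split_ifs <;> positivity
  have hsub : (#{n ∈ Ioc 0 M | A0 < smoothPart P n} : ℝ)
      ≤ #{n ∈ Ioc 0 N | A0 < smoothPart P n} := by
    exact_mod_cast card_le_card (filter_subset_filter _ (Ioc_subset_Ioc_right hMN))
  calc _ = ∑ n ∈ Ioc 0 M, (if Sifted P M n ∧ ∃ d ∈ Ioc D0 D1, d ∣ n then (1 : ℝ) else 0) := by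
        rw [card_filter]
        push_cast
        rfl
    _ ≤ _ := sum_le_sum fun n _ => hpt n
    _ = #{n ∈ Ioc 0 M | A0 < smoothPart P n}
        + Real.exp (-(V / 2)) * ∑ n ∈ Ioc 0 M with Sifted P M n ∧ smoothPart P n ≤ A0,
            Real.sqrt 2 ^ ω n
        + Real.exp (V / 2) * ∑ n ∈ Ioc 0 M with Sifted P M n ∧ smoothPart P n ≤ A0,
            (Real.sqrt 2 / 2) ^ ω n * τ n := by
        rw [sum_add_distrib, sum_add_distrib, ← mul_sum, ← mul_sum, card_filter, sum_filter,
          sum_filter]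
        push_cast
        rfl
    _ ≤ _ := by
        refine add_le_add (add_le_add (hsub.trans hA) ?_) ?_
        · refine mul_le_mul_of_nonneg_left (hB.trans ?_) (by positivity)
          gcongr
        · refine mul_le_mul_of_nonneg_left (hC.trans ?_) (by positivity)
          gcongr

open Classical in
theorem abs_tripleSum_self_le (N : ℕ) (w : ℕ → ℝ) {G : ℝ}
    (hG : ∀ p1 : ℕ, (#{p2 ∈ range (N + 1) | p2.Prime ∧ w p2 ≠ 0 ∧
      ∃ p3 : ℕ, p3.Prime ∧ p1 + p2 + p3 = N} : ℝ) ≤ G) :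
    |tripleSum N w w|
      ≤ Real.log N ^ 3 * (G * ∑ p ∈ (range (N + 1) : Finset ℕ) with p.Prime, w p ^ 2) := by
  set I : ℕ → ℕ → ℕ → ℝ := fun p1 p2 p3 =>
    if p1.Prime ∧ p2.Prime ∧ p3.Prime ∧ p1 + p2 + p3 = N then 1 else 0
  have hI : ∀ p1 p2 p3, 0 ≤ I p1 p2 p3 := fun _ _ _ => ite_nonneg zero_le_one le_rfl
  have hIsymm : ∀ p1 p2 p3, I p1 p2 p3 = I p2 p1 p3 := by
    intro p1 p2 p3
    simp only [I]
    refine if_congr ?_ rfl rfl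
    rw [add_comm p1 p2]
    tauto
  have hL : 0 ≤ Real.log N := Real.log_natCast_nonneg N
  set a : ℕ → ℕ → ℝ := fun p1 p2 => w p1 ^ 2 * (if w p2 ≠ 0 then 1 else 0)
  have ha : ∀ p1 p2, 0 ≤ a p1 p2 := fun p1 p2 =>
    mul_nonneg (sq_nonneg _) (ite_nonneg zero_le_one le_rfl)
  have habs : |tripleSum N w w| ≤ ∑ p1 ∈ range (N + 1), ∑ p2 ∈ range (N + 1),
      ∑ p3 ∈ range (N + 1), Real.log N ^ 3 * (1 / 2) * ((a p1 p2 + a p2 p1) * I p1 p2 p3) := by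
    unfold tripleSum
    refine (abs_sum_le_sum_abs _ _).trans (sum_le_sum fun p1 h1 => ?_)
    refine (abs_sum_le_sum_abs _ _).trans (sum_le_sum fun p2 h2 => ?_)
    refine (abs_sum_le_sum_abs _ _).trans (sum_le_sum fun p3 h3 => ?_)
    simp only [I]
    split_ifs with h
    · rw [mem_range] at h1 h2 h3
      have hlog : ∀ p : ℕ, p < N + 1 → 0 ≤ Real.log p ∧ Real.log p ≤ Real.log N := by
        intro p hp
        refine ⟨Real.log_natCast_nonneg p, ?_⟩
        rcases Nat.eq_zero_or_pos p with rfl | hp0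
        · simpa using hL
        · exact Real.log_le_log (by exact_mod_cast hp0) (by exact_mod_cast Nat.lt_succ_iff.1 hp)
      have hw : |w p1 * w p2| ≤ 1 / 2 * (a p1 p2 + a p2 p1) := by
        simp only [a]
        by_cases h1 : w p1 = 0
        · simp [h1]
        by_cases h2 : w p2 = 0
        · simp [h2]
        rw [if_pos h1, if_pos h2, mul_one, mul_one, abs_le]
        constructor <;> nlinarith [sq_nonneg (w p1 - w p2), sq_nonneg (w p1 + w p2)]
      obtain ⟨e1, f1⟩ := hlog p1 h1
      obtain ⟨e2, f2⟩ := hlog p2 h2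
      obtain ⟨e3, f3⟩ := hlog p3 h3
      rw [abs_mul, abs_mul, abs_mul, abs_of_nonneg e1, abs_of_nonneg e2, abs_of_nonneg e3]
      have := ha p1 p2
      have := ha p2 p1
      calc _ ≤ 1 / 2 * (a p1 p2 + a p2 p1) * Real.log N * Real.log N * Real.log N := by gcongr
        _ = _ := by ring
    · rw [abs_zero, mul_zero, mul_zero]
  have hswap : ∑ p1 ∈ range (N + 1), ∑ p2 ∈ range (N + 1), ∑ p3 ∈ range (N + 1),
      a p2 p1 * I p1 p2 p3 = ∑ p1 ∈ range (N + 1), ∑ p2 ∈ range (N + 1), ∑ p3 ∈ range (N + 1),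
      a p1 p2 * I p1 p2 p3 := by
    rw [sum_comm]
    refine sum_congr rfl fun p1 _ => sum_congr rfl fun p2 _ => sum_congr rfl fun p3 _ => ?_
    rw [hIsymm]
  have hmain : ∑ p1 ∈ range (N + 1), ∑ p2 ∈ range (N + 1), ∑ p3 ∈ range (N + 1),
      a p1 p2 * I p1 p2 p3 ≤ G * ∑ p ∈ (range (N + 1) : Finset ℕ) with p.Prime, w p ^ 2 := by
    rw [sum_filter, mul_sum]
    refine sum_le_sum fun p1 _ => ?_
    by_cases hp1 : p1.Prime
    · rw [if_pos hp1, mul_comm]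
      refine le_trans ?_ (mul_le_mul_of_nonneg_left (hG p1) (sq_nonneg _))
      rw [card_filter]
      push_cast
      rw [mul_sum]
      refine sum_le_sum fun p2 _ => ?_
      simp only [a]
      rw [← mul_sum, mul_assoc]
      refine mul_le_mul_of_nonneg_left ?_ (sq_nonneg _)
      have h1 : ∑ p3 ∈ range (N + 1), I p1 p2 p3 ≤ 1 := by
        calc _ ≤ ∑ p3 ∈ range (N + 1), if p3 = N - p1 - p2 then (1 : ℝ) else 0 := by
              refine sum_le_sum fun p3 _ => ?_
              simp only [I]
              split_ifs with h h'
              · exact le_rfl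
              · exact absurd (by omega) h'
              · exact zero_le_one
              · exact le_rfl
          _ ≤ 1 := by
              rw [sum_ite_eq']
              split_ifs <;> norm_num
      by_cases hw : w p2 = 0
      · rw [if_neg (not_not.2 hw), zero_mul]
        exact ite_nonneg zero_le_one le_rfl
      rw [if_pos hw, one_mul]
      by_cases h : p2.Prime ∧ w p2 ≠ 0 ∧ ∃ p3 : ℕ, p3.Prime ∧ p1 + p2 + p3 = N
      · rwa [if_pos h]
      · rw [if_neg h, sum_eq_zero]
        intro p3 _
        simp only [I]
        rw [if_neg]
        rintro ⟨_, h2, h3, h4⟩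
        exact h ⟨h2, hw, p3, h3, h4⟩
    · rw [if_neg hp1, mul_zero]
      refine (sum_eq_zero fun p2 _ => sum_eq_zero fun p3 _ => ?_).le
      simp only [I]
      rw [if_neg fun h => hp1 h.1, mul_zero]
  refine habs.trans ?_
  simp_rw [← mul_sum (a := Real.log N ^ 3 * (1 / 2)), add_mul, sum_add_distrib]
  rw [hswap]
  have : 0 ≤ Real.log N ^ 3 := by positivity
  nlinarith

theorem le_of_rho_ne_zero {D0 D1 n : ℕ} (h : rho D0 D1 n ≠ 0) :
    ∃ d ∈ Ioc D0 D1, d ∣ n := by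
  by_contra hn
  push Not at hn
  exact h (sum_eq_zero fun d hd => if_neg (hn d hd))

theorem sum_prime_rho_sq_le {N D0 D1 y : ℕ} (hy : y ≤ D0) (P : Finset ℕ)
    (hP : ∀ q ∈ P, q.Prime ∧ q ≤ y) {R : ℕ} (hR : Even R) :
    ∑ p ∈ (range (N + 1) : Finset ℕ) with p.Prime, rho D0 D1 (p - 1) ^ 2
      ≤ ∑ n ∈ Ioc 0 N, rho D0 D1 n ^ 2 * brunWeight P R (fun q => q ∣ n + 1) := by
  have hnn : ∀ n, 0 ≤ rho D0 D1 n ^ 2 * brunWeight P R (fun q => q ∣ n + 1) := fun n =>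
    mul_nonneg (sq_nonneg _) (brunWeight_nonneg P hR _)
  have hinj : Set.InjOn (fun p : ℕ => p - 1) ((range (N + 1)).filter Nat.Prime) := by
    intro p hp p' hp' h
    rw [mem_coe, mem_filter] at hp hp'
    have := hp.2.two_le
    have := hp'.2.two_le
    simp only at h
    omega
  calc _ ≤ ∑ p ∈ (range (N + 1) : Finset ℕ) with p.Prime,
        rho D0 D1 (p - 1) ^ 2 * brunWeight P R (fun q => q ∣ p - 1 + 1) := by
        refine sum_le_sum fun p hp => ?_
        rw [mem_filter] at hp
        by_cases h0 : rho D0 D1 (p - 1) = 0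
        · rw [h0]
          simp
        · obtain ⟨d, hd, hdp⟩ := le_of_rho_ne_zero h0
          have h2 := hp.2.two_le
          have := Nat.le_of_dvd (by omega) hdp
          rw [mem_Ioc] at hd
          rw [brunWeight_eq_one, mul_one]
          intro q hq hqp
          rw [Nat.sub_add_cancel (by omega), Nat.prime_dvd_prime_iff_eq (hP q hq).1 hp.2] at hqp
          have := (hP q hq).2
          omega
    _ = ∑ n ∈ ((range (N + 1)).filter Nat.Prime).image (fun p => p - 1),
        rho D0 D1 n ^ 2 * brunWeight P R (fun q => q ∣ n + 1) := by rw [sum_image hinj]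
    _ ≤ _ := by
        refine sum_le_sum_of_subset_of_nonneg ?_ fun _ _ _ => hnn _
        intro n hn
        obtain ⟨p, hp, rfl⟩ := mem_image.1 hn
        rw [mem_filter, mem_range] at hp
        have := hp.2.two_le
        rw [mem_Ioc]
        omega

open Classical in
theorem card_prime_pairs_le {N D0 D1 y : ℕ} (hy : y ≤ D0) (P : Finset ℕ)
    (hP : ∀ q ∈ P, q.Prime ∧ q ≤ y) {w : ℕ → ℝ}
    (hw : ∀ p : ℕ, p.Prime → w p = rho D0 D1 (p - 1)) {G : ℝ} (hG0 : 0 ≤ G)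
    (hG : ∀ M, 0 < M → M ≤ N →
      (#{n ∈ Ioc 0 M | Sifted P M n ∧ ∃ d ∈ Ioc D0 D1, d ∣ n} : ℝ) ≤ G) (p1 : ℕ) :
    (#{p2 ∈ range (N + 1) | p2.Prime ∧ w p2 ≠ 0 ∧ ∃ p3 : ℕ, p3.Prime ∧ p1 + p2 + p3 = N} : ℝ)
      ≤ G + (y + 1) := by
  set M := N - p1 - 1
  set S := {n ∈ Ioc 0 M | Sifted P M n ∧ ∃ d ∈ Ioc D0 D1, d ∣ n}
  have hS : (#S : ℝ) ≤ G := by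
    rcases Nat.eq_zero_or_pos M with hM | hM
    · simp only [S]
      rw [hM]
      simpa using hG0
    · exact hG M hM (by omega)
  have hsub : {p2 ∈ range (N + 1) | p2.Prime ∧ w p2 ≠ 0 ∧ ∃ p3 : ℕ, p3.Prime ∧ p1 + p2 + p3 = N}
      ⊆ S.image (fun n => n + 1) ∪ (range (y + 1)).image (fun p3 => N - p1 - p3) := by
    intro p2 hp2
    simp only [mem_filter] at hp2
    obtain ⟨-, hprime, hw2, p3, hp3, hsum⟩ := hp2
    rw [hw p2 hprime] at hw2
    have hd := le_of_rho_ne_zero hw2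
    have h2 := hprime.two_le
    have h3 := hp3.two_le
    rw [mem_union, mem_image, mem_image]
    rcases le_or_gt p3 y with h | h
    · right
      exact ⟨p3, mem_range.2 (by omega), by omega⟩
    · left
      refine ⟨p2 - 1, ?_, by omega⟩
      rw [mem_filter, mem_Ioc]
      refine ⟨by omega, ?_, hd⟩
      intro q hq
      obtain ⟨hqp, hqy⟩ := hP q hq
      obtain ⟨d, hdm, hdn⟩ := hd
      have := Nat.le_of_dvd (by omega) hdn
      rw [mem_Ioc] at hdm
      constructor
      · intro hdvd
        rw [Nat.sub_add_cancel (by omega), Nat.prime_dvd_prime_iff_eq hqp hprime] at hdvd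
        omega
      · intro hmod
        rw [Nat.modEq_iff_dvd' (by omega)] at hmod
        have : M - (p2 - 1) = p3 := by omega
        rw [this, Nat.prime_dvd_prime_iff_eq hqp hp3] at hmod
        omega
  have h1 := (card_le_card hsub).trans (card_union_le _ _)
  have h2 : #(S.image (fun n => n + 1)) ≤ #S := card_image_le
  have h3 : #((range (y + 1)).image (fun p3 => N - p1 - p3)) ≤ y + 1 :=
    card_image_le.trans (card_range _).le
  have h4 : (#{p2 ∈ range (N + 1) | p2.Prime ∧ w p2 ≠ 0
      ∧ ∃ p3 : ℕ, p3.Prime ∧ p1 + p2 + p3 = N} : ℝ) ≤ #S + (y + 1) := by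
    exact_mod_cast h1.trans (add_le_add h2 h3)
  linarith

/-- The sum of `1 / q` over the primes `q > w` dividing `k` is small. -/
theorem sum_one_div_dvd_le {P : Finset ℕ} (hP : ∀ q ∈ P, q.Prime) {w : ℝ} (hw : 0 < w)
    (hPw : ∀ q ∈ P, w ≤ q) {k : ℕ} (hk : 0 < k) :
    ∑ q ∈ P with q ∣ k, (1 : ℝ) / q ≤ Real.log k / Real.log 2 / w := by
  set S := P.filter (fun q => q ∣ k)
  have hS : ∀ q ∈ S, q.Prime := fun q hq => hP q (mem_filter.1 hq).1
  have hdvd : ∏ q ∈ S, q ∣ k :=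
    (forall_dvd_iff_prod_dvd S hS k).1 fun q hq => (mem_filter.1 hq).2
  have hpow : 2 ^ #S ≤ k := by
    refine le_trans ?_ (Nat.le_of_dvd hk hdvd)
    rw [← prod_const]
    exact prod_le_prod' fun q hq => (hS q hq).two_le
  have hlog2 : 0 < Real.log 2 := Real.log_pos (by norm_num)
  have hcard : (#S : ℝ) ≤ Real.log k / Real.log 2 := by
    rw [le_div_iff₀ hlog2, ← Real.log_pow]
    exact Real.log_le_log (by positivity) (by exact_mod_cast hpow)
  calc _ ≤ ∑ q ∈ S, 1 / w := by
        refine sum_le_sum fun q hq => ?_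
        exact one_div_le_one_div_of_le hw (hPw q (mem_filter.1 hq).1)
    _ = #S / w := by
        rw [sum_const, nsmul_eq_mul, mul_one_div]
    _ ≤ _ := by gcongr

theorem four_div_sqrt_le {E a : ℝ} (h : Real.exp (2 * a) ≤ E) :
    4 / Real.sqrt E ≤ 4 * Real.exp (-a) := by
  have h1 : Real.exp a ≤ Real.sqrt E := by
    refine Real.le_sqrt_of_sq_le ?_
    rwa [← Real.exp_nat_mul]
  rw [Real.exp_neg, ← div_eq_mul_inv]
  exact div_le_div_of_nonneg_left (by norm_num) (Real.exp_pos _) h1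

theorem twenty_le_exp_five : (20 : ℝ) ≤ Real.exp 5 := by
  have h : (2 : ℝ) ≤ Real.exp 1 := by linarith [Real.add_one_le_exp (1 : ℝ)]
  calc (20 : ℝ) ≤ 2 ^ 5 := by norm_num
    _ ≤ Real.exp 1 ^ 5 := by gcongr
    _ = Real.exp 5 := by
        rw [← Real.exp_nat_mul]
        norm_num

set_option maxHeartbeats 1000000 in
theorem square_side_bound {c l U L V R X Q2 Y E0 E1 : ℝ} (hc : 0 < c) (hl : 1 ≤ l)
    (hV0 : 0 ≤ V) (hV5 : V ≤ 5 * l) (hR : 12 * V ≤ R) (hX : 3 * X ≤ Real.exp (7 * U))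
    (hQ1 : 1 ≤ Q2) (hQ : Q2 ≤ Real.exp ((2 * c + 1) * l)) (hY0 : 0 ≤ Y)
    (hY : Y ≤ Real.exp (L / 2 + c * l)) (hE0l : Real.exp (2 * ((2 * c + 30) * l)) ≤ E0)
    (hE0u : E0 ≤ Real.exp ((4 * c + 61) * l)) (hE1l : Real.exp (2 * (10 * U)) ≤ E1)
    (hE1u : E1 ≤ Real.exp (21 * U)) (hU : (10 * c + 100) * l ≤ U) (hL : 100 * U ≤ L)
    (hbig : (Real.exp 6 + 1) * (1 + (6 * c + 62) * l) ^ 3 + 4 ≤ Real.exp (l / 500)) :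
    Real.exp L * (Real.exp (6 - V) + Real.exp (3 * V - R)) * (1 + Real.log (Q2 * E0)) ^ 3
      + 3 * X * (Q2 * Y) * E0
      + Real.exp (2 * V) * (5 * Y ^ 2) * (4 / Real.sqrt E0)
      + 3 * X * (2 * Q2 * Y) * E1
      + 3 * X * (5 * Y ^ 2) * (4 / Real.sqrt E1)
      ≤ Real.exp L * Real.exp (-V) * Real.exp (l / 500) := by
  have h20 := twenty_le_exp_five
  have hcl : 0 < c * l := by positivity
  have hU' : 10 * (c * l) + 100 * l ≤ U := by linarith
  have hE0p : 0 < E0 := (Real.exp_pos _).trans_le hE0l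
  have hE1p : 0 < E1 := (Real.exp_pos _).trans_le hE1l
  have hE01 : 1 ≤ E0 := (Real.one_le_exp (by positivity)).trans hE0l
  have hY2 : Y ^ 2 ≤ Real.exp (L + 2 * (c * l)) := by
    calc Y ^ 2 ≤ Real.exp (L / 2 + c * l) ^ 2 := by gcongr
      _ = _ := by
          rw [← Real.exp_nat_mul]
          congr 1
          push_cast
          ring
  have h1 : Real.exp L * (Real.exp (6 - V) + Real.exp (3 * V - R)) * (1 + Real.log (Q2 * E0)) ^ 3
      ≤ Real.exp L * Real.exp (-V) * ((Real.exp 6 + 1) * (1 + (6 * c + 62) * l) ^ 3) := by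
    have hlog0 : 0 ≤ Real.log (Q2 * E0) := Real.log_nonneg (by nlinarith)
    have hlog : Real.log (Q2 * E0) ≤ (6 * c + 62) * l := by
      rw [Real.log_le_iff_le_exp (by positivity)]
      calc Q2 * E0 ≤ Real.exp ((2 * c + 1) * l) * Real.exp ((4 * c + 61) * l) := by gcongr
        _ = _ := by
            rw [← Real.exp_add]
            congr 1
            ring
    have e1 : Real.exp (6 - V) = Real.exp (-V) * Real.exp 6 := by
      rw [← Real.exp_add]
      congr 1
      ring
    have e2 : Real.exp (3 * V - R) ≤ Real.exp (-V) := Real.exp_le_exp.2 (by linarith)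
    calc _ ≤ Real.exp L * (Real.exp (-V) * Real.exp 6 + Real.exp (-V))
          * (1 + (6 * c + 62) * l) ^ 3 := by
          rw [e1]
          gcongr
      _ = _ := by ring
  have h2 : 3 * X * (Q2 * Y) * E0 ≤ Real.exp L * Real.exp (-V) := by
    calc _ ≤ Real.exp (7 * U) * (Real.exp ((2 * c + 1) * l) * Real.exp (L / 2 + c * l))
          * Real.exp ((4 * c + 61) * l) := by gcongr
      _ ≤ _ := by
          simp only [← Real.exp_add]
          refine Real.exp_le_exp.2 ?_
          linarith
  have h3 : Real.exp (2 * V) * (5 * Y ^ 2) * (4 / Real.sqrt E0) ≤ Real.exp L * Real.exp (-V) := by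
    calc _ ≤ Real.exp (2 * V) * (5 * Real.exp (L + 2 * (c * l)))
          * (4 * Real.exp (-((2 * c + 30) * l))) := by
          have := four_div_sqrt_le hE0l
          gcongr
      _ = 20 * (Real.exp (2 * V) * Real.exp (L + 2 * (c * l)) * Real.exp (-((2 * c + 30) * l))) := by
          ring
      _ ≤ Real.exp 5 * (Real.exp (2 * V) * Real.exp (L + 2 * (c * l))
          * Real.exp (-((2 * c + 30) * l))) := by gcongr
      _ ≤ _ := by
          simp only [← Real.exp_add]
          refine Real.exp_le_exp.2 ?_
          linarith
  have h4 : 3 * X * (2 * Q2 * Y) * E1 ≤ Real.exp L * Real.exp (-V) := by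
    calc _ ≤ Real.exp (7 * U) * (Real.exp 5 * Real.exp ((2 * c + 1) * l)
          * Real.exp (L / 2 + c * l)) * Real.exp (21 * U) := by
          have : (2 : ℝ) ≤ Real.exp 5 := by linarith
          gcongr
      _ ≤ _ := by
          simp only [← Real.exp_add]
          refine Real.exp_le_exp.2 ?_
          linarith
  have h5 : 3 * X * (5 * Y ^ 2) * (4 / Real.sqrt E1) ≤ Real.exp L * Real.exp (-V) := by
    calc _ ≤ Real.exp (7 * U) * (5 * Real.exp (L + 2 * (c * l)))
          * (4 * Real.exp (-(10 * U))) := by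
          have := four_div_sqrt_le hE1l
          gcongr
      _ = 20 * (Real.exp (7 * U) * Real.exp (L + 2 * (c * l)) * Real.exp (-(10 * U))) := by
          ring
      _ ≤ Real.exp 5 * (Real.exp (7 * U) * Real.exp (L + 2 * (c * l))
          * Real.exp (-(10 * U))) := by gcongr
      _ ≤ _ := by
          simp only [← Real.exp_add]
          refine Real.exp_le_exp.2 ?_
          linarith
  have h6 : 0 ≤ Real.exp L * Real.exp (-V) := by positivity
  calc _ ≤ Real.exp L * Real.exp (-V) * ((Real.exp 6 + 1) * (1 + (6 * c + 62) * l) ^ 3 + 4) := by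
        linarith
    _ ≤ _ := by gcongr

set_option maxHeartbeats 1000000 in
theorem sifted_side_bound {c l S U L V R X Q2 A0 As D0 D1 y κ₁ κ₃ : ℝ} (hc : 0 < c) (hl : 1 ≤ l)
    (hV0 : 0 ≤ V) (hV5 : V ≤ 5 * l) (hR : 12 * V ≤ R) (hX0 : 0 ≤ X) (hX : 3 * X ≤ Real.exp (7 * U))
    (hQ1 : 1 ≤ Q2) (hQ : Q2 ≤ Real.exp ((2 * c + 1) * l))
    (hA0 : 0 ≤ A0) (hA : A0 ≤ Real.exp (2 * U)) (hAs : As ≤ Real.exp (-S)) (hS : 10 * V ≤ S)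
    (hD1 : D1 ≤ Real.exp (L / 2 + c * l)) (hD10 : 0 ≤ D1)
    (hD0 : Real.exp (L / 2 - c * l) / 2 ≤ D0) (hy : y + 1 ≤ Real.exp (2 * U))
    (hU : (10 * c + 100) * l ≤ U) (hL : 100 * U ≤ L)
    (hκ₁ : κ₁ = Real.exp (-V) + Real.exp (3 * V - R))
    (hκ₃ : κ₃ = Real.exp (3 * (6 - V)) + Real.exp (9 * V - R))
    (hbig : Real.exp 8 * (Real.exp 18 + 1) * (6 + 2 * (2 * c + 1) * l) + 4 ≤ Real.exp (l / 500)) :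
    Real.exp L * As * Real.exp (6 * V)
        + Real.exp (-(V / 2)) * (Real.exp (Real.sqrt 2 * V + 4) * (Real.exp L * κ₃ + 3 * X * A0))
        + Real.exp (V / 2) * (Real.exp (Real.sqrt 2 / 2 * V + 4) * (Real.exp L * κ₃
            * (Real.exp (Real.sqrt 2 / 2 * V + 4)
              * (κ₁ * (2 + Real.log Q2) + 3 * X * A0 / D0)) + 3 * X * A0 * D1)) + (y + 1)
      ≤ Real.exp L * Real.exp (-((7 / 2 - Real.sqrt 2) * V)) * Real.exp (l / 500) := by
  have hs2 : Real.sqrt 2 ≤ 2 := by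
    rw [Real.sqrt_le_left (by norm_num)]
    norm_num
  have hs0 : 0 ≤ Real.sqrt 2 := Real.sqrt_nonneg _
  have hsV0 : 0 ≤ Real.sqrt 2 * V := by positivity
  have hsV : Real.sqrt 2 * V ≤ 2 * V := by gcongr
  have hcl : 0 < c * l := by positivity
  have hU' : 10 * (c * l) + 100 * l ≤ U := by linarith
  have hD0p : 0 < D0 := lt_of_lt_of_le (by positivity) hD0
  have h20 := twenty_le_exp_five
  set T := Real.exp L * Real.exp (-((7 / 2 - Real.sqrt 2) * V)) with hT
  have hT0 : 0 ≤ T := by positivity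
  have hlog0 : 0 ≤ Real.log Q2 := Real.log_nonneg hQ1
  have hlog : Real.log Q2 ≤ (2 * c + 1) * l := by
    rwa [Real.log_le_iff_le_exp (by positivity)]
  have hk1 : κ₁ ≤ 2 * Real.exp (-V) := by
    have : Real.exp (3 * V - R) ≤ Real.exp (-V) := Real.exp_le_exp.2 (by linarith)
    linarith
  have hk3 : κ₃ ≤ (Real.exp 18 + 1) * Real.exp (-(3 * V)) := by
    have h1 : Real.exp (9 * V - R) ≤ Real.exp (-(3 * V)) := Real.exp_le_exp.2 (by linarith)
    have h2 : Real.exp (3 * (6 - V)) = Real.exp 18 * Real.exp (-(3 * V)) := by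
      rw [← Real.exp_add]
      congr 1
      ring
    linarith
  have hk10 : 0 ≤ κ₁ := by rw [hκ₁]; positivity
  have hk30 : 0 ≤ κ₃ := by rw [hκ₃]; positivity
  have ha : Real.exp L * As * Real.exp (6 * V) ≤ T := by
    calc _ ≤ Real.exp L * Real.exp (-S) * Real.exp (6 * V) := by gcongr
      _ ≤ _ := by
          simp only [hT, ← Real.exp_add]
          refine Real.exp_le_exp.2 ?_
          linarith
  have hb : Real.exp (-(V / 2)) * (Real.exp (Real.sqrt 2 * V + 4) * (Real.exp L * κ₃ + 3 * X * A0))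
      ≤ T * (Real.exp 4 * (Real.exp 18 + 1)) + T := by
    have e1 : Real.exp (-(V / 2)) * (Real.exp (Real.sqrt 2 * V + 4) * (Real.exp L
        * ((Real.exp 18 + 1) * Real.exp (-(3 * V))))) = T * (Real.exp 4 * (Real.exp 18 + 1)) := by
      have : Real.exp (-(V / 2)) * Real.exp (Real.sqrt 2 * V + 4) * Real.exp L
          * Real.exp (-(3 * V)) = T * Real.exp 4 := by
        simp only [hT, ← Real.exp_add]
        congr 1
        ring
      linear_combination (Real.exp 18 + 1) * this
    have e2 : Real.exp (-(V / 2)) * (Real.exp (Real.sqrt 2 * V + 4) * (3 * X * A0)) ≤ T := by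
      calc _ ≤ Real.exp (-(V / 2)) * (Real.exp (Real.sqrt 2 * V + 4)
            * (Real.exp (7 * U) * Real.exp (2 * U))) := by gcongr
        _ ≤ _ := by
            simp only [hT, ← Real.exp_add]
            refine Real.exp_le_exp.2 ?_
            linarith
    calc _ ≤ Real.exp (-(V / 2)) * (Real.exp (Real.sqrt 2 * V + 4) * (Real.exp L
            * ((Real.exp 18 + 1) * Real.exp (-(3 * V))) + 3 * X * A0)) := by gcongr
      _ ≤ _ := by
          rw [mul_add (Real.exp (Real.sqrt 2 * V + 4)), mul_add, e1]
          linarith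
  have hc1 : Real.exp (V / 2) * (Real.exp (Real.sqrt 2 / 2 * V + 4) * (Real.exp L * κ₃
            * (Real.exp (Real.sqrt 2 / 2 * V + 4)
              * (κ₁ * (2 + Real.log Q2) + 3 * X * A0 / D0))))
      ≤ T * (Real.exp 8 * (Real.exp 18 + 1) * (5 + 2 * (2 * c + 1) * l)) := by
    have e1 : 3 * X * A0 / D0 ≤ Real.exp (-V) := by
      rw [div_le_iff₀ hD0p]
      calc _ ≤ Real.exp (7 * U) * Real.exp (2 * U) := by gcongr
        _ ≤ Real.exp (-V) * Real.exp (-5) * Real.exp (L / 2 - c * l) := by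
            simp only [← Real.exp_add]
            refine Real.exp_le_exp.2 ?_
            linarith
        _ ≤ Real.exp (-V) * (1 / 2) * Real.exp (L / 2 - c * l) := by
            have : Real.exp (-5) ≤ 1 / 2 := by
              rw [Real.exp_neg, inv_le_comm₀ (by positivity) (by norm_num)]
              linarith
            gcongr
        _ = Real.exp (-V) * (Real.exp (L / 2 - c * l) / 2) := by ring
        _ ≤ _ := by gcongr
    have e2 : κ₁ * (2 + Real.log Q2) + 3 * X * A0 / D0
        ≤ Real.exp (-V) * (5 + 2 * (2 * c + 1) * l) := by
      calc _ ≤ 2 * Real.exp (-V) * (2 + (2 * c + 1) * l) + Real.exp (-V) := by gcongr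
        _ = _ := by ring
    have e3 : Real.exp (V / 2) * Real.exp (Real.sqrt 2 / 2 * V + 4) * Real.exp L
          * Real.exp (-(3 * V)) * Real.exp (Real.sqrt 2 / 2 * V + 4) * Real.exp (-V)
        = T * Real.exp 8 := by
      simp only [hT, ← Real.exp_add]
      congr 1
      ring
    calc _ ≤ Real.exp (V / 2) * (Real.exp (Real.sqrt 2 / 2 * V + 4) * (Real.exp L
            * ((Real.exp 18 + 1) * Real.exp (-(3 * V)))
            * (Real.exp (Real.sqrt 2 / 2 * V + 4)
              * (Real.exp (-V) * (5 + 2 * (2 * c + 1) * l))))) := by gcongr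
      _ = _ := by
          linear_combination ((Real.exp 18 + 1) * (5 + 2 * (2 * c + 1) * l)) * e3
  have hc2 : Real.exp (V / 2) * (Real.exp (Real.sqrt 2 / 2 * V + 4) * (3 * X * A0 * D1)) ≤ T := by
    calc _ ≤ Real.exp (V / 2) * (Real.exp (Real.sqrt 2 / 2 * V + 4)
          * (Real.exp (7 * U) * Real.exp (2 * U) * Real.exp (L / 2 + c * l))) := by gcongr
      _ ≤ _ := by
          simp only [hT, ← Real.exp_add]
          refine Real.exp_le_exp.2 ?_
          linarith
  have hy' : y + 1 ≤ T := by
    refine hy.trans ?_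
    simp only [hT, ← Real.exp_add]
    refine Real.exp_le_exp.2 ?_
    linarith
  have h48 : Real.exp 4 ≤ Real.exp 8 := Real.exp_le_exp.2 (by norm_num)
  have h48' : T * (Real.exp 4 * (Real.exp 18 + 1)) ≤ T * (Real.exp 8 * (Real.exp 18 + 1)) := by
    gcongr
  rw [mul_add (Real.exp (Real.sqrt 2 / 2 * V + 4)), mul_add (Real.exp (V / 2))]
  calc _ ≤ T * (Real.exp 8 * (Real.exp 18 + 1) * (6 + 2 * (2 * c + 1) * l) + 4) := by
        linarith
    _ ≤ _ := by gcongr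

theorem r2_eq_rho {D x : ℝ} (hD : 0 ≤ D) {n : ℕ} (hn : 0 < n) :
    r2 D x n = rho ⌊D⌋₊ (⌈x / D⌉₊ - 1) n := by
  unfold r2 rho
  rw [← sum_filter, ← sum_filter]
  refine sum_congr ?_ fun _ _ => rfl
  ext d
  simp only [mem_filter, mem_Ioc, Nat.mem_divisors]
  rw [← Nat.floor_lt hD, ← Nat.lt_ceil]
  constructor
  · rintro ⟨⟨h, -⟩, h1, h2⟩
    exact ⟨⟨h1, by omega⟩, h⟩
  · rintro ⟨⟨h1, h2⟩, h⟩
    exact ⟨⟨h, hn.ne'⟩, h1, by omega⟩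

theorem natCeil_exp_le {a b : ℝ} (ha : 0 ≤ a) (hab : a + 1 ≤ b) :
    (⌈Real.exp a⌉₊ : ℝ) ≤ Real.exp b := by
  have h1 : 1 ≤ Real.exp a := Real.one_le_exp ha
  have h2 : (2 : ℝ) ≤ Real.exp 1 := by linarith [Real.add_one_le_exp (1 : ℝ)]
  calc (⌈Real.exp a⌉₊ : ℝ) ≤ Real.exp a + 1 := (Nat.ceil_lt_add_one (by positivity)).le
    _ ≤ Real.exp a * 2 := by linarith
    _ ≤ Real.exp a * Real.exp 1 := by gcongr
    _ = Real.exp (a + 1) := (Real.exp_add _ _).symm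
    _ ≤ Real.exp b := Real.exp_le_exp.2 hab

theorem le_sum_one_div_prime_gt {w y : ℕ} (hw : 1 ≤ w) (hy : 2 ≤ y) :
    Real.log (Real.log y) - 6 - 4 * Real.log (2 * Real.log w + 1)
      ≤ ∑ q ∈ range (y + 1) with q.Prime ∧ w < q, (1 : ℝ) / q := by
  have h1 := log_log_sub_one_le_sum_one_div_prime hy
  have h2 := sum_one_div_prime_le hw
  have h3 : ∑ q ∈ range (y + 1) with q.Prime, (1 : ℝ) / q
      ≤ ∑ q ∈ range (y + 1) with q.Prime ∧ w < q, (1 : ℝ) / q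
        + ∑ q ∈ range (w + 1) with q.Prime, (1 : ℝ) / q := by
    rw [← sum_filter_add_sum_filter_not _ (fun q => w < q), filter_filter, filter_filter]
    refine add_le_add le_rfl (sum_le_sum_of_subset_of_nonneg ?_ fun _ _ _ => by positivity)
    intro q hq
    simp only [mem_filter, mem_range] at hq ⊢
    exact ⟨by omega, hq.2.1⟩
  linarith

theorem exists_sieve_set {l : ℝ} (hl : 10 ≤ l) (hS : 100 * (l + 1) ≤ Real.exp (l / 1000))
    (hlog : 7 + 4 * Real.log (2 * l + 1) ≤ l / 500) :
    ∃ (y : ℕ) (P : Finset ℕ) (R : ℕ) (Z : ℝ), (y : ℝ) ≤ Real.exp (Real.exp (998 / 1000 * l)) ∧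
      (∀ q ∈ P, q.Prime ∧ q ≤ y) ∧ (∀ q ∈ P, Real.exp l ≤ q) ∧
      498 / 500 * l ≤ ∑ q ∈ P, (1 : ℝ) / q ∧ ∑ q ∈ P, (1 : ℝ) / q ≤ 5 * l ∧ Even R ∧
      12 * ∑ q ∈ P, (1 : ℝ) / q ≤ R ∧ 1 ≤ Z ∧ 3 * (#P : ℝ) ≤ Z ∧
      3 * Z ^ R ≤ Real.exp (7 * Real.exp (999 / 1000 * l)) := by
  set S := Real.exp (l / 1000)
  set K := Real.exp (998 / 1000 * l) with hK
  set U := Real.exp (999 / 1000 * l)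
  have hKS : U = K * S := by
    simp only [hK, U, S, ← Real.exp_add]
    congr 1
    ring
  have hKl : 998 / 1000 * l + 1 ≤ K := Real.add_one_le_exp _
  have hK5 : 5 ≤ K := by linarith
  have hE20 : 20 ≤ Real.exp K := twenty_le_exp_five.trans (Real.exp_le_exp.2 hK5)
  set y := ⌊Real.exp K⌋₊
  set w := ⌊Real.exp l⌋₊
  have hyK : (y : ℝ) ≤ Real.exp K := Nat.floor_le (by positivity)
  have hyK' : Real.exp K < y + 1 := Nat.lt_floor_add_one _
  have hy2 : 2 ≤ y := by
    have : (19 : ℝ) < y := by linarith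
    have : 19 < y := by exact_mod_cast this
    omega
  have hw1 : 1 ≤ w := by
    rw [Nat.one_le_floor_iff]
    exact Real.one_le_exp (by linarith)
  have hy0 : (0 : ℝ) < y := by positivity
  have hlogy : K / 2 ≤ Real.log y := by
    rw [Real.le_log_iff_exp_le hy0]
    have h1 : Real.exp (K / 2) * Real.exp (K / 2) = Real.exp K := by
      rw [← Real.exp_add]
      congr 1
      ring
    have h2 : 2 ≤ Real.exp (K / 2) := by linarith [Real.add_one_le_exp (K / 2)]
    nlinarith
  have hlogy' : Real.log y ≤ K := (Real.log_le_iff_le_exp hy0).2 hyK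
  have hlogw : Real.log w ≤ l :=
    (Real.log_le_iff_le_exp (by positivity)).2 (Nat.floor_le (by positivity))
  have hlogw0 : 0 ≤ Real.log w := Real.log_natCast_nonneg _
  set P := (range (y + 1)).filter fun q => q.Prime ∧ w < q
  have hPy : ∀ q ∈ P, q.Prime ∧ q ≤ y := by
    intro q hq
    simp only [P, mem_filter, mem_range] at hq
    exact ⟨hq.2.1, by omega⟩
  have hPw : ∀ q ∈ P, Real.exp l ≤ q := by
    intro q hq
    simp only [P, mem_filter] at hq
    exact (Nat.lt_of_floor_lt hq.2.2).le
  set V := ∑ q ∈ P, (1 : ℝ) / q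
  have hV0 : 0 ≤ V := sum_nonneg fun _ _ => by positivity
  have hVl : 498 / 500 * l ≤ V := by
    have h1 : Real.log (Real.log y) - 6 - 4 * Real.log (2 * Real.log w + 1) ≤ V :=
      le_sum_one_div_prime_gt hw1 hy2
    have h2 : 998 / 1000 * l - 1 ≤ Real.log (Real.log y) := by
      rw [Real.le_log_iff_exp_le (by linarith)]
      refine le_trans ?_ hlogy
      rw [Real.exp_sub, div_le_div_iff₀ (by positivity) (by norm_num)]
      have : (2 : ℝ) ≤ Real.exp 1 := by linarith [Real.add_one_le_exp (1 : ℝ)]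
      gcongr
    have h3 : Real.log (2 * Real.log w + 1) ≤ Real.log (2 * l + 1) :=
      Real.log_le_log (by linarith) (by linarith)
    linarith
  have hVu : V ≤ 5 * l := by
    have h1 : V ≤ ∑ q ∈ range (y + 1) with q.Prime, (1 : ℝ) / q := by
      refine sum_le_sum_of_subset_of_nonneg ?_ fun _ _ _ => by positivity
      intro q hq
      simp only [P, mem_filter] at hq ⊢
      exact ⟨hq.1, hq.2.1⟩
    have h2 := sum_one_div_prime_le (n := y) (by omega)
    have h3 : Real.log (2 * Real.log y + 1) ≤ l := by
      have : 0 ≤ Real.log y := by linarith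
      rw [Real.log_le_iff_le_exp (by linarith)]
      have e1 : Real.exp l = K * (S * S) := by
        simp only [hK, S, ← Real.exp_add]
        congr 1
        ring
      have e2 : 3 ≤ S * S := by nlinarith
      rw [e1]
      nlinarith
    linarith
  set R := 2 * ⌈6 * V⌉₊ with hR
  have hR1 : 12 * V ≤ R := by
    rw [hR]
    push_cast
    linarith [Nat.le_ceil (6 * V)]
  have hR2 : (R : ℝ) ≤ S := by
    rw [hR]
    push_cast
    linarith [Nat.ceil_lt_add_one (a := 6 * V) (by positivity)]
  have hcard : (#P : ℝ) ≤ y + 1 := by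
    have h : #P ≤ y + 1 := (card_filter_le _ _).trans (card_range _).le
    exact_mod_cast h
  refine ⟨y, P, R, 3 * (y + 1), hyK, hPy, hPw, hVl, hVu, even_two_mul _, hR1, by linarith,
    by linarith, ?_⟩
  have hZ : 3 * ((y : ℝ) + 1) ≤ Real.exp (2 * K) := by
    rw [two_mul, Real.exp_add]
    nlinarith
  have h3 : (3 : ℝ) ≤ Real.exp U := by
    have : 1 ≤ S := Real.one_le_exp (by positivity)
    have : K ≤ U := by
      rw [hKS]
      exact le_mul_of_one_le_right (by positivity) this
    linarith [Real.add_one_le_exp U]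
  have hU0 : 0 < U := Real.exp_pos _
  calc 3 * (3 * ((y : ℝ) + 1)) ^ R ≤ Real.exp U * Real.exp (2 * K) ^ R := by gcongr
    _ = Real.exp (U + R * (2 * K)) := by rw [← Real.exp_nat_mul, ← Real.exp_add]
    _ ≤ Real.exp (7 * U) := by
        refine Real.exp_le_exp.2 ?_
        have : (R : ℝ) * K ≤ S * K := by gcongr
        linarith

theorem sum_one_div_dvd_le_six {N : ℕ} {P : Finset ℕ} (hP : ∀ q ∈ P, q.Prime)
    {L : ℝ} (hL0 : 0 < L) (hL : Real.log N = L) (hPL : ∀ q ∈ P, L ≤ q) {k : ℕ} (hk : 0 < k)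
    (hkN : k ≤ N ^ 4) : ∑ q ∈ P with q ∣ k, (1 : ℝ) / q ≤ 6 := by
  refine (sum_one_div_dvd_le hP hL0 hPL hk).trans ?_
  have h1 : Real.log k ≤ 4 * L := by
    have : (k : ℝ) ≤ (N : ℝ) ^ 4 := by exact_mod_cast hkN
    rw [← hL]
    refine (Real.log_le_log (by positivity) this).trans ?_
    rw [Real.log_pow]
    norm_num
  have h2 := Real.log_two_gt_d9
  rw [div_le_iff₀ hL0, div_le_iff₀ (by positivity)]
  nlinarith

theorem eventually_mul_pow_le_exp (A : ℝ) (k : ℕ) {b : ℝ} (hb : 0 < b) :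
    ∀ᶠ l : ℝ in Filter.atTop, A * l ^ k ≤ Real.exp (b * l) := by
  have h := (isLittleO_pow_exp_pos_mul_atTop k hb).def
    (show (0 : ℝ) < 1 / (|A| + 1) by positivity)
  filter_upwards [h, Filter.eventually_ge_atTop 0] with l hl hl0
  rw [Real.norm_of_nonneg (by positivity), Real.norm_of_nonneg (by positivity), one_div,
    ← div_eq_inv_mul, le_div_iff₀ (by positivity)] at hl
  have : A * l ^ k ≤ (|A| + 1) * l ^ k := by
    gcongr
    linarith [le_abs_self A]
  linarith

theorem eventually_log_le (b : ℝ) (hb : 0 < b) :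
    ∀ᶠ l : ℝ in Filter.atTop, 7 + 4 * Real.log (2 * l + 1) ≤ b * l := by
  filter_upwards [eventually_mul_pow_le_exp (3 * Real.exp 2) 1 (show 0 < b / 4 by positivity),
    Filter.eventually_ge_atTop 1] with l hl hl1
  have h : Real.log (2 * l + 1) ≤ b / 4 * l - 2 := by
    rw [Real.log_le_iff_le_exp (by linarith), Real.exp_sub, le_div_iff₀ (by positivity)]
    refine le_trans ?_ hl
    rw [pow_one]
    nlinarith [Real.exp_pos 2]
  linarith

theorem main_exponent_le : 3 + 2 / 500 - (9 / 2 - Real.sqrt 2) * (498 / 500) ≤ -2 * theta0 := by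
  have h1 := Real.log_two_gt_d9
  have h2 := Real.exp_one_gt_d9
  have h3 : Real.sqrt 2 ≤ 1.41422 := by
    rw [Real.sqrt_le_left (by norm_num)]
    norm_num
  unfold theta0
  nlinarith

theorem window_bounds {N : ℕ} {a t : ℝ} (ha : 1 ≤ a) (ht : 1 ≤ t)
    (hN : (N : ℝ) = Real.exp (2 * a + t)) {D0 D1 Q2 : ℕ} (hD0 : D0 = ⌊Real.exp a⌋₊)
    (hD1 : D1 = ⌈Real.exp (a + t)⌉₊ - 1) (hQ2 : Q2 = ⌈2 * Real.exp t⌉₊) :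
    Real.exp a / 2 ≤ D0 ∧ D0 ≤ D1 ∧ (D1 : ℝ) ≤ Real.exp (a + t) ∧ N < (D1 + 1) * (D0 + 1) ∧
      1 ≤ Q2 ∧ D1 ≤ Q2 * D0 ∧ (Q2 : ℝ) ≤ Real.exp (t + 2) := by
  have hea : 2 ≤ Real.exp a := by linarith [Real.add_one_le_exp a]
  have het : 2 ≤ Real.exp t := by linarith [Real.add_one_le_exp t]
  have hat : Real.exp (a + t) = Real.exp a * Real.exp t := Real.exp_add _ _
  have hat0 : 0 < ⌈Real.exp (a + t)⌉₊ := Nat.ceil_pos.2 (Real.exp_pos _)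
  have hD1' : (D1 : ℝ) + 1 = ⌈Real.exp (a + t)⌉₊ := by
    rw [hD1]
    exact_mod_cast Nat.succ_pred_eq_of_pos hat0
  have hD1l : Real.exp (a + t) ≤ D1 + 1 := by
    rw [hD1']
    exact Nat.le_ceil _
  have hD1u : (D1 : ℝ) ≤ Real.exp (a + t) := by
    linarith [Nat.ceil_lt_add_one (Real.exp_pos (a + t)).le]
  have hD0l : Real.exp a < D0 + 1 := by
    rw [hD0]
    exact Nat.lt_floor_add_one _
  have hD0u : (D0 : ℝ) ≤ Real.exp a := by
    rw [hD0]
    exact Nat.floor_le (by positivity)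
  have hhalf : Real.exp a / 2 ≤ D0 := by
    have h2 : 2 ≤ D0 := by
      rw [hD0]
      exact Nat.le_floor (by exact_mod_cast hea)
    have h2' : (2 : ℝ) ≤ D0 := by exact_mod_cast h2
    linarith
  have hQl : 2 * Real.exp t ≤ Q2 := by
    rw [hQ2]
    exact Nat.le_ceil _
  refine ⟨hhalf, ?_, hD1u, ?_, ?_, ?_, ?_⟩
  · have : (D0 : ℝ) ≤ D1 := by nlinarith
    exact_mod_cast this
  · have : (N : ℝ) < ((D1 : ℝ) + 1) * (D0 + 1) := by
      calc (N : ℝ) = Real.exp (a + t) * Real.exp a := by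
            rw [hN, ← Real.exp_add]
            congr 1
            ring
        _ ≤ (D1 + 1) * Real.exp a := by gcongr
        _ < (D1 + 1) * (D0 + 1) := mul_lt_mul_of_pos_left hD0l (by positivity)
    exact_mod_cast this
  · have : (1 : ℝ) ≤ Q2 := by linarith
    exact_mod_cast this
  · have : (D1 : ℝ) ≤ Q2 * D0 := by
      calc (D1 : ℝ) ≤ 2 * Real.exp t * (Real.exp a / 2) := by linarith
        _ ≤ Q2 * D0 := by gcongr
    exact_mod_cast this
  · have h1 : (2 : ℝ) ≤ Real.exp 1 := by linarith [Real.add_one_le_exp (1 : ℝ)]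
    have h2 : Real.exp (t + 2) = Real.exp t * (Real.exp 1 * Real.exp 1) := by
      rw [← Real.exp_add, ← Real.exp_add]
      norm_num
    have h3 : (Q2 : ℝ) ≤ 2 * Real.exp t + 1 := by
      rw [hQ2]
      exact (Nat.ceil_lt_add_one (by positivity)).le
    have h4 : 4 ≤ Real.exp 1 * Real.exp 1 := by nlinarith
    rw [h2]
    nlinarith

set_option maxHeartbeats 1000000 in
theorem abs_tripleSum_rho_le {c l : ℝ} {N : ℕ} (hc : 0 < c) (hl : 10 ≤ l) (hcl : 1 ≤ c * l)
    (hN : (N : ℝ) = Real.exp (Real.exp l))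
    (hS : (10 * c + 100) * (l + 1) ≤ Real.exp (l / 1000))
    (hlog : 7 + 4 * Real.log (2 * l + 1) ≤ l / 500)
    (hbig : (Real.exp 6 + 1) * (1 + (6 * c + 62) * l) ^ 3 + 4 ≤ Real.exp (l / 500))
    (hbig' : Real.exp 8 * (Real.exp 18 + 1) * (6 + 2 * (2 * c + 1) * l) + 4 ≤ Real.exp (l / 500))
    {w : ℕ → ℝ} (hw : ∀ p : ℕ, p.Prime → w p = rho ⌊Real.exp (Real.exp l / 2 - c * l)⌋₊
      (⌈Real.exp (Real.exp l / 2 + c * l)⌉₊ - 1) (p - 1)) :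
    |tripleSum N w w| ≤ (N : ℝ) ^ 2
      * Real.exp ((3 + 2 / 500 - (9 / 2 - Real.sqrt 2) * (498 / 500)) * l) := by
  classical
  set S := Real.exp (l / 1000)
  set K := Real.exp (998 / 1000 * l) with hK
  set U := Real.exp (999 / 1000 * l) with hU
  set L := Real.exp l with hL
  have hUKS : U = K * S := by
    simp only [hK, U, S, ← Real.exp_add]
    congr 1
    ring
  have hLUS : L = U * S := by
    simp only [hL, U, S, ← Real.exp_add]
    congr 1
    ring
  have hK2 : 2 ≤ K := by linarith [Real.add_one_le_exp (998 / 1000 * l)]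
  have hU0 : 0 < U := Real.exp_pos _
  have hSl : 100 * (l + 1) ≤ S := by linarith
  have hS100 : 100 ≤ S := by linarith
  have hKU : K ≤ U := by
    rw [hUKS]
    exact le_mul_of_one_le_right (by linarith) (by linarith)
  have hUS : S ≤ U := by
    rw [hUKS]
    exact le_mul_of_one_le_left (by linarith) (by linarith)
  have hUl : (10 * c + 100) * l ≤ U := by linarith
  have hLU : 100 * U ≤ L := by
    rw [hLUS, mul_comm]
    gcongr
  have hlogN : Real.log N = L := by rw [hN, Real.log_exp]
  have hN1 : 1 < N := by
    have : (1 : ℝ) < N := by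
      rw [hN]
      exact Real.one_lt_exp_iff.2 (Real.exp_pos _)
    exact_mod_cast this
  obtain ⟨y, P, R, Z, hyK, hPy, hPL, hVl, hVu, hR, hRV, hZ, hPZ, hZR⟩ :=
    exists_sieve_set hl hSl hlog
  obtain ⟨hD0, hDD, hD1, hND, hQ1, hQ, hQu⟩ := window_bounds (N := N) (a := L / 2 - c * l)
    (t := 2 * (c * l)) (by linarith) (by linarith) (by rw [hN]; congr 1; ring) rfl rfl rfl
  rw [show L / 2 - c * l + 2 * (c * l) = L / 2 + c * l by ring] at hDD hD1 hND hQ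
  set D0 := ⌊Real.exp (L / 2 - c * l)⌋₊ with hD0d
  set D1 := ⌈Real.exp (L / 2 + c * l)⌉₊ - 1
  set Q2 := ⌈2 * Real.exp (2 * (c * l))⌉₊
  have hQu' : (Q2 : ℝ) ≤ Real.exp ((2 * c + 1) * l) :=
    hQu.trans (Real.exp_le_exp.2 (by linarith))
  have hyD : y ≤ D0 := by
    rw [hD0d]
    refine Nat.le_floor (hyK.trans (Real.exp_le_exp.2 ?_))
    linarith
  have hyU : (y : ℝ) + 1 ≤ Real.exp (2 * U) := by
    have h1 : (y : ℝ) ≤ Real.exp U := hyK.trans (Real.exp_le_exp.2 hKU)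
    have h3 : 2 ≤ Real.exp U := by linarith [Real.add_one_le_exp U]
    rw [two_mul, Real.exp_add]
    nlinarith
  have hPp : ∀ q ∈ P, q.Prime := fun q hq => (hPy q hq).1
  have hP6 : ∀ q ∈ P, 6 ≤ q := by
    intro q hq
    have h : (6 : ℝ) ≤ q := le_trans (by linarith) (hPL q hq)
    exact_mod_cast h
  have hPodd : ∀ q ∈ P, Odd q := fun q hq =>
    (hPp q hq).odd_of_ne_two (by have := hP6 q hq; omega)
  have hb : ∀ k, 0 < k → k ≤ N ^ 4 → ∑ q ∈ P with q ∣ k, (1 : ℝ) / q ≤ 6 := fun k hk hkN =>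
    sum_one_div_dvd_le_six hPp (Real.exp_pos _) hlogN hPL hk hkN
  have hD0pos : 0 < D0 := by
    have : (0 : ℝ) < D0 := lt_of_lt_of_le (by positivity) hD0
    exact_mod_cast this
  set V := ∑ q ∈ P, (1 : ℝ) / q with hV
  have hV0 : 0 ≤ V := by linarith
  have hZ0 : 0 ≤ Z ^ R := by positivity
  set E0 := ⌈Real.exp (2 * ((2 * c + 30) * l))⌉₊
  set E1 := ⌈Real.exp (2 * (10 * U))⌉₊
  set A0 := ⌈Real.exp U⌉₊
  have hceil : ∀ x : ℝ, 1 ≤ ⌈Real.exp x⌉₊ := fun x => Nat.ceil_pos.2 (Real.exp_pos _)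
  have hsq : ∑ p ∈ (range (N + 1) : Finset ℕ) with p.Prime, w p ^ 2
      ≤ Real.exp L * Real.exp (-V) * Real.exp (l / 500) := by
    have h0 : ∑ p ∈ (range (N + 1) : Finset ℕ) with p.Prime, w p ^ 2
        = ∑ p ∈ (range (N + 1) : Finset ℕ) with p.Prime, rho D0 D1 (p - 1) ^ 2 :=
      sum_congr rfl fun p hp => by rw [hw p (mem_filter.1 hp).2]
    rw [h0]
    refine (sum_prime_rho_sq_le hyD P hPy hR).trans ?_
    refine (sum_rho_sq_mul_brunWeight_le (N := N) (E0 := E0) (E1 := E1) le_rfl hND hQ1 hQ P hPp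
      hPodd hR hZ (by linarith [(Nat.cast_nonneg #P : (0 : ℝ) ≤ #P)])
      (fun k hk hkN => hb k hk (hkN.trans (Nat.le_self_pow (by norm_num) N)))
      (hceil _) (hceil _)).trans ?_
    rw [hN]
    exact square_side_bound hc (by linarith) hV0 hVu hRV hZR (by exact_mod_cast hQ1) hQu'
      (by positivity) hD1 (Nat.le_ceil _)
      (natCeil_exp_le (by positivity) (by linarith)) (Nat.le_ceil _)
      (natCeil_exp_le (by positivity) (by linarith)) hUl hLU hbig
  set T := Real.exp L * Real.exp (-((7 / 2 - Real.sqrt 2) * V)) * Real.exp (l / 500)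
  have hpairs : ∀ p1 : ℕ, (#{p2 ∈ range (N + 1) | p2.Prime ∧ w p2 ≠ 0 ∧
      ∃ p3 : ℕ, p3.Prime ∧ p1 + p2 + p3 = N} : ℝ) ≤ T := by
    intro p1
    have hPs : ∀ q ∈ P, (q : ℝ) ^ (1 / K) ≤ 3 := by
      intro q hq
      have h1 : (q : ℝ) ≤ Real.exp K :=
        le_trans (by exact_mod_cast (hPy q hq).2) hyK
      calc (q : ℝ) ^ (1 / K) ≤ Real.exp K ^ (1 / K) := by gcongr
        _ = Real.exp 1 := by
            rw [← Real.exp_mul]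
            congr 1
            field_simp
        _ ≤ 3 := Real.exp_one_lt_three.le
    have hAs : (A0 : ℝ) ^ (-(1 / K)) ≤ Real.exp (-S) := by
      calc (A0 : ℝ) ^ (-(1 / K)) ≤ Real.exp U ^ (-(1 / K)) := by
            refine Real.rpow_le_rpow_of_nonpos (Real.exp_pos _) (Nat.le_ceil _) ?_
            rw [neg_nonpos]
            positivity
        _ = Real.exp (-S) := by
            rw [← Real.exp_mul, hUKS]
            congr 1
            field_simp
    have key := sifted_side_bound (S := S) hc (by linarith) hV0 hVu hRV hZ0 hZR
      (by exact_mod_cast hQ1) hQu' (Nat.cast_nonneg A0)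
      (natCeil_exp_le hU0.le (by linarith)) hAs (by linarith) hD1 (Nat.cast_nonneg _) hD0 hyU hUl
      hLU rfl rfl hbig'
    refine (card_prime_pairs_le hyD P hPy hw ?_ (fun M hM hMN => ?_) p1).trans key
    · have hlQ : 0 ≤ Real.log Q2 := Real.log_natCast_nonneg _
      positivity
    · have h := card_sifted_exists_dvd_le hPp hP6 hR hZ hPZ hMN hD0pos hDD hQ1 hQ (b := 6)
        (fun a ha haM => ?_) (s := 1 / K) (by positivity)
        (by rw [div_lt_one (by positivity)]; linarith) hPs (hceil U) hV rfl rfl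
      · rw [hN] at h
        convert h
      · refine hb _ (by positivity) ?_
        have h1 : M + 1 ≤ N ^ 2 := by nlinarith
        calc a * M * (M + 1) ≤ N * N * N ^ 2 := by
              gcongr
              exact haM.trans hMN
          _ = N ^ 4 := by ring
  have hsq2 : 0 ≤ 9 / 2 - Real.sqrt 2 := by
    have : Real.sqrt 2 ≤ 2 := by
      rw [Real.sqrt_le_left (by norm_num)]
      norm_num
    linarith
  calc |tripleSum N w w| ≤ Real.log N ^ 3 * (T * ∑ p ∈ (range (N + 1) : Finset ℕ) with p.Prime,
        w p ^ 2) := abs_tripleSum_self_le N w hpairs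
    _ ≤ L ^ 3 * (T * (Real.exp L * Real.exp (-V) * Real.exp (l / 500))) := by
        rw [hlogN]
        gcongr
    _ = Real.exp L ^ 2 * Real.exp ((3 + 2 / 500) * l - (9 / 2 - Real.sqrt 2) * V) := by
        have h1 : Real.exp ((3 + 2 / 500) * l - (9 / 2 - Real.sqrt 2) * V)
            = L ^ 3 * (Real.exp (-((7 / 2 - Real.sqrt 2) * V)) * Real.exp (l / 500)
              * (Real.exp (-V) * Real.exp (l / 500))) := by
          rw [hL, ← Real.exp_nat_mul]
          simp only [← Real.exp_add]
          congr 1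
          push_cast
          ring
        rw [h1]
        ring
    _ ≤ (N : ℝ) ^ 2 * Real.exp ((3 + 2 / 500 - (9 / 2 - Real.sqrt 2) * (498 / 500)) * l) := by
        rw [hN]
        gcongr
        nlinarith

/-- with D = √N (log N)^{-c} for any constant c > 0,
R₂,₂(N) ≪ N² (log N)^{-2θ₀} (log log N)¹³ for large odd N. -/
theorem R_two_two_bound :
    ∀ c : ℝ, 0 < c → ∃ C : ℝ, 0 < C ∧ ∃ N0 : ℕ,
      ∀ N : ℕ, N0 ≤ N → Odd N →
        |tripleSum N (fun p => r2 (Real.sqrt N * Real.log N ^ (-c)) (N : ℝ) (p - 1))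
            (fun p => r2 (Real.sqrt N * Real.log N ^ (-c)) (N : ℝ) (p - 1))| ≤
          C * (N : ℝ) ^ 2 * Real.log N ^ (-2 * theta0) * Real.log (Real.log N) ^ 13 := by
  intro c hc
  refine ⟨1, one_pos, ?_⟩
  have hloglog : Filter.Tendsto (fun N : ℕ => Real.log (Real.log N)) Filter.atTop Filter.atTop :=
    Real.tendsto_log_atTop.comp (Real.tendsto_log_atTop.comp tendsto_natCast_atTop_atTop)
  have hev : ∀ᶠ l : ℝ in Filter.atTop, 10 ≤ l ∧ 1 ≤ c * l ∧
      (10 * c + 100) * (l + 1) ≤ Real.exp (l / 1000) ∧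
      7 + 4 * Real.log (2 * l + 1) ≤ l / 500 ∧
      (Real.exp 6 + 1) * (1 + (6 * c + 62) * l) ^ 3 + 4 ≤ Real.exp (l / 500) ∧
      Real.exp 8 * (Real.exp 18 + 1) * (6 + 2 * (2 * c + 1) * l) + 4 ≤ Real.exp (l / 500) := by
    filter_upwards [Filter.eventually_ge_atTop 10, Filter.eventually_ge_atTop (1 / c),
      eventually_mul_pow_le_exp (2 * (10 * c + 100)) 1 (show (0 : ℝ) < 1 / 1000 by norm_num),
      eventually_log_le (1 / 500) (by norm_num),
      eventually_mul_pow_le_exp ((Real.exp 6 + 1) * (6 * c + 63) ^ 3 + 4) 3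
        (show (0 : ℝ) < 1 / 500 by norm_num),
      eventually_mul_pow_le_exp (Real.exp 8 * (Real.exp 18 + 1) * (6 + 2 * (2 * c + 1)) + 4) 1
        (show (0 : ℝ) < 1 / 500 by norm_num)] with l h1 h2 h3 h4 h5 h6
    rw [one_div_mul_eq_div] at h3 h4 h5 h6
    rw [pow_one] at h3 h6
    refine ⟨h1, ?_, ?_, h4, ?_, ?_⟩
    · rwa [div_le_iff₀' hc] at h2
    · nlinarith
    · refine le_trans ?_ h5
      have e1 : 1 + (6 * c + 62) * l ≤ (6 * c + 63) * l := by linarith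
      have e2 : (1 : ℝ) ≤ l ^ 3 := one_le_pow₀ (by linarith)
      calc (Real.exp 6 + 1) * (1 + (6 * c + 62) * l) ^ 3 + 4
          ≤ (Real.exp 6 + 1) * ((6 * c + 63) * l) ^ 3 + 4 * l ^ 3 := by
            have : 0 ≤ 1 + (6 * c + 62) * l := by positivity
            gcongr
            linarith
        _ = _ := by ring
    · refine le_trans ?_ h6
      have e1 : 6 + 2 * (2 * c + 1) * l ≤ (6 + 2 * (2 * c + 1)) * l := by linarith
      calc Real.exp 8 * (Real.exp 18 + 1) * (6 + 2 * (2 * c + 1) * l) + 4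
          ≤ Real.exp 8 * (Real.exp 18 + 1) * ((6 + 2 * (2 * c + 1)) * l) + 4 * l := by
            gcongr
            linarith
        _ = _ := by ring
  obtain ⟨N0, hN0⟩ := Filter.eventually_atTop.1 (hloglog.eventually hev)
  refine ⟨max N0 3, fun N hN _ => ?_⟩
  obtain ⟨hl, hcl, hS, hlog, hbig, hbig'⟩ := hN0 N ((le_max_left _ _).trans hN)
  have hN3 : 3 ≤ N := (le_max_right _ _).trans hN
  have hN0' : (0 : ℝ) < N := by positivity
  have hlogN : 0 < Real.log N := Real.log_pos (by exact_mod_cast (by omega : 1 < N))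
  set l := Real.log (Real.log N) with hl_def
  have hel : Real.exp l = Real.log N := Real.exp_log hlogN
  have hNe : (N : ℝ) = Real.exp (Real.exp l) := by rw [hel, Real.exp_log hN0']
  have hpow : ∀ x : ℝ, Real.log N ^ x = Real.exp (x * l) := fun x => by
    rw [Real.rpow_def_of_pos hlogN, mul_comm]
  have hD : Real.sqrt N * Real.log N ^ (-c) = Real.exp (Real.exp l / 2 - c * l) := by
    rw [hpow, hNe, Real.sqrt_eq_rpow, ← Real.exp_mul, ← Real.exp_add]
    congr 1
    ring
  have hND : (N : ℝ) / Real.exp (Real.exp l / 2 - c * l) = Real.exp (Real.exp l / 2 + c * l) := by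
    rw [hNe, ← Real.exp_sub]
    congr 1
    ring
  rw [hD]
  refine (abs_tripleSum_rho_le hc hl hcl hNe hS hlog hbig hbig' fun p hp => ?_).trans ?_
  · rw [r2_eq_rho (by positivity) (by have := hp.two_le; omega), hND]
  · rw [hpow, one_mul]
    have h13 : (1 : ℝ) ≤ l ^ 13 := one_le_pow₀ (by linarith)
    refine le_trans ?_ (le_mul_of_one_le_right (by positivity) h13)
    have := main_exponent_le
    gcongr
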